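/- For every η ∈ (0, 1/12) there exists N₀ = N₀(q, η) such that for every integer N ≥ N₀ and every x ∈ 𝕋, |Σ_{f ∈ 𝔽_q[t], deg f ≤ N} (Λ'(f+1) − Λ_{N/4}(f+1)) · Λ_{N/12}(f−1) · H_{N/12}(f) · e(fx)| ≤ q^{N(11/12 + η)}/2. -/

import Mathlib

open Polynomial
open scoped Classical

noncomputable section

variable (p : ℕ) [Fact p.Prime] (Fq : Type) [Field Fq] [Fintype Fq] [Algebra (ZMod p) Fq]

/-- `t` as an element of `K∞ = 𝔽_q((1/t))`; the exponent of the Hahn series variable records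
the power of `1/t`, so that `res x = x.coeff 1` and `ord x = -x.order`. -/
def Kt : LaurentSeries Fq := HahnSeries.single (-1 : ℤ) 1

/-- The Laurent expansion at infinity of a polynomial. -/
def toK (f : Polynomial Fq) : LaurentSeries Fq := Polynomial.aeval (Kt Fq) f

/-- The additive character `e(x) = exp(2πi · tr(res x)/p)` on `K∞`. -/
def eC (x : LaurentSeries Fq) : ℂ :=
  Complex.exp (2 * Real.pi * Complex.I *
    ((Algebra.trace (ZMod p) Fq (x.coeff 1)).val : ℂ) / (p : ℂ))

/-- The norm `⟨x⟩ = q^(ord x)` on `K∞` (with `⟨0⟩ = 0`). -/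
def Knorm (x : LaurentSeries Fq) : ℝ :=
  if x = 0 then 0 else (Fintype.card Fq : ℝ) ^ (-x.order)

/-- The norm `⟨f⟩ = q^(deg f)` of a polynomial (with `⟨0⟩ = 0`). -/
def pnorm (f : Polynomial Fq) : ℝ :=
  if f = 0 then 0 else (Fintype.card Fq : ℝ) ^ f.natDegree

/-- The Euler totient function: the number of units of `𝔽_q[t]/(f)`. -/
def phiP (f : Polynomial Fq) : ℕ := Nat.card ((Polynomial Fq ⧸ Ideal.span {f})ˣ)

/-- The Möbius function on `𝔽_q[t]`: `(-1)^(number of distinct monic irreducible factors)`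
for squarefree `f`, and `0` otherwise. -/
def muP (f : Polynomial Fq) : ℤ :=
  if Squarefree f then
    (-1) ^ {P : Polynomial Fq | P.Monic ∧ Irreducible P ∧ P ∣ f}.ncard
  else 0

/-- The Ramanujan sum `c_s(f) = Σ_{deg a < deg s, gcd(a,s)=1} e(af/s)`. -/
def ramanujanC (s f : Polynomial Fq) : ℂ :=
  ∑ᶠ a ∈ {a : Polynomial Fq | a.degree < s.degree ∧ IsCoprime a s},
    eC p Fq (toK Fq (a * f) / toK Fq s)

/-- The modified von Mangoldt function `Λ'(f) = deg f` if `f` is irreducible, `0` otherwise. -/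
def vonMangoldt' (f : Polynomial Fq) : ℝ := if Irreducible f then (f.natDegree : ℝ) else 0

/-- The truncated Ramanujan expansion `Λ_X(f) = Σ_{g monic squarefree, deg g ≤ X} (μ(g)/φ(g))·c_g(f)`. -/
def LambdaX (X : ℝ) (f : Polynomial Fq) : ℂ :=
  ∑ᶠ g ∈ {g : Polynomial Fq | g.Monic ∧ Squarefree g ∧ (g.natDegree : ℝ) ≤ X},
    ((muP Fq g : ℂ) / (phiP Fq g : ℂ)) * ramanujanC p Fq g f

/-- `H_X(f) = Σ_{g monic squarefree, deg g ≤ X} α'(g)·c_g(f)`, with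
`α'(g) = ∏_{P monic irreducible, P ∣ g} (⟨P⟩+3)⁻¹`. -/
def HXf (X : ℝ) (f : Polynomial Fq) : ℂ :=
  ∑ᶠ g ∈ {g : Polynomial Fq | g.Monic ∧ Squarefree g ∧ (g.natDegree : ℝ) ≤ X},
    (∏ᶠ P ∈ {P : Polynomial Fq | P.Monic ∧ Irreducible P ∧ P ∣ g},
      ((1 : ℂ) / ((pnorm Fq P : ℂ) + 3))) * ramanujanC p Fq g f

namespace Stepanov

/-- In `K⟦X⟧` with `K` finite, raising to a power of `card K` is the substitution `X ↦ X ^ E`. -/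
theorem powerSeries_coeff_pow_card {K : Type*} [Field K] [Fintype K] (f : PowerSeries K) (m n : ℕ) :
    PowerSeries.coeff n (f ^ (Fintype.card K ^ m)) =
      if Fintype.card K ^ m ∣ n then PowerSeries.coeff (n / Fintype.card K ^ m) f else 0 := by
  obtain ⟨p, hp, k, hpk, hk⟩ := FiniteField.card' K
  have := Fact.mk hpk
  have hE : Fintype.card K ^ m ≠ 0 := pow_ne_zero _ Fintype.card_ne_zero
  have hcard : Fintype.card K ^ m = p ^ (k * m) := by rw [hk, pow_mul]
  have key := MvPowerSeries.map_iterateFrobenius_expand (σ := Unit) p hpk.ne_zero f (k * m)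
  rw [hcard, ← key]
  have hid : iterateFrobenius K p (k * m) = RingHom.id K := by
    ext x
    rw [iterateFrobenius_def, ← hcard, FiniteField.pow_card_pow, RingHom.id_apply]
  rw [hid, MvPowerSeries.map_id]
  simp only [← hcard]
  exact PowerSeries.coeff_expand (R := K) (Fintype.card K ^ m) hE f (n := n)

theorem exists_parameters (d C₀ C₁ : ℕ) (hd : 0 < d) :
    ∃ T₀ C : ℕ, ∀ E : ℕ, T₀ ≤ E → ∃ l l' : ℕ, d * (l + C₀) < E ∧
      l * E + l' + C₁ * E + 1 < d * (l + 1) * (l' + 1) ∧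
      d * (l + l' * E + C₁ * E) ≤ E ^ 2 + C * E := by
  set k := d * C₀ + 1 with hk
  set E₀ := 2 * (k + d * C₁ + 2 * d+ 1) with hE₀
  refine ⟨2 * k + d * (C₀ + 1), 1 + E₀ + d * C₁, fun E hE => ?_⟩
  obtain ⟨l, hl1, hl2⟩ : ∃ l, d * (l + C₀) < E ∧ E ≤ d * (l + C₀ + 1) := by
    have h1 := Nat.div_add_mod (E - 1) d
    have h2 := Nat.mod_lt (E - 1) hd
    have h3 : C₀ ≤ (E - 1) / d := by
      rw [Nat.le_div_iff_mul_le hd]; nlinarith [Nat.sub_add_cancel (show 1 ≤ E by nlinarith)]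
    refine ⟨(E - 1) / d - C₀, ?_, ?_⟩
    · rw [Nat.sub_add_cancel h3]; have : 1 ≤ E := by nlinarith
      omega
    · rw [Nat.sub_add_cancel h3, mul_add]; omega
  obtain ⟨l', hl1', hl2'⟩ : ∃ l', d * l' ≤ E + E₀ ∧ E + E₀ < d * (l' + 1) := by
    have h1 := Nat.div_add_mod (E + E₀) d
    have h2 := Nat.mod_lt (E + E₀) hd
    refine ⟨(E + E₀) / d, by omega, by rw [mul_add]; omega⟩
  refine ⟨l, l', hl1, ?_, ?_⟩
  · have e1 : E + 1 ≤ d * (l + 1) + k := by rw [hk]; nlinarith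
    have e2 : d * l < E := by nlinarith
    have e3 : 2 * k ≤ E := by nlinarith
    zify at *
    have hd' : (0:ℤ) < d := by exact_mod_cast hd
    have : (d:ℤ) * (l * E + l' + C₁ * E + 1) < d * (d * (l + 1) * (l' + 1)) := by
      have a1 : ((E:ℤ) + 1 - k) * (d * (l' + 1)) ≤ (d * (l + 1)) * (d * (l' + 1)) := by
        apply mul_le_mul_of_nonneg_right <;> [linarith; positivity]
      have a2 : ((E:ℤ) + 1 - k) * (E + E₀) ≤ ((E:ℤ) + 1 - k) * (d * (l' + 1)) := by
        apply mul_le_mul_of_nonneg_left <;> linarith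
      have a3 : (d:ℤ) * l * E ≤ E * E := by apply mul_le_mul_of_nonneg_right <;> [linarith; positivity]
      have a4 : (k:ℤ) * E₀ * 2 ≤ E * E₀ := by nlinarith
      have : (E:ℤ) * E₀ = 2 * (E * k + E * d * C₁ + 2 * E * d + E) := by rw [hE₀]; ring
      nlinarith
    exact lt_of_mul_lt_mul_left this hd'.le
  · have e2 : d * l ≤ E := by nlinarith
    nlinarith


section Degree

variable {K : Type*} [Field K] {A : Type*} [CommRing A] [Algebra K[X] A] {d : ℕ}
  (b : Module.Basis (Fin d) K[X] A)

/-- The largest degree of a coordinate. -/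
def coordDegree (w : A) : ℕ := Finset.univ.sup fun i => (b.repr w i).natDegree

theorem natDegree_repr_le (w : A) (i : Fin d) : (b.repr w i).natDegree ≤ coordDegree b w :=
  Finset.le_sup (f := fun i => (b.repr w i).natDegree) (Finset.mem_univ i)

theorem coordDegree_le {w : A} {D : ℕ} (h : ∀ i, (b.repr w i).natDegree ≤ D) :
    coordDegree b w ≤ D := Finset.sup_le fun i _ => h i

theorem coordDegree_sum_le {ι : Type*} (s : Finset ι) (f : ι → A) {D : ℕ}
    (h : ∀ i ∈ s, coordDegree b (f i) ≤ D) : coordDegree b (∑ i ∈ s, f i) ≤ D := by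
  refine coordDegree_le b fun j => ?_
  rw [map_sum, Finsupp.finsetSum_apply]
  exact natDegree_sum_le_of_forall_le _ _ fun i hi => (natDegree_repr_le b _ j).trans (h i hi)

theorem coordDegree_smul_le (r : K[X]) (w : A) :
    coordDegree b (r • w) ≤ r.natDegree + coordDegree b w := by
  refine coordDegree_le b fun j => ?_
  rw [map_smul, Finsupp.smul_apply, smul_eq_mul]
  exact natDegree_mul_le.trans (Nat.add_le_add_left (natDegree_repr_le b w j) _)

theorem coordDegree_basis (i : Fin d) : coordDegree b (b i) = 0 := by
  refine Nat.le_zero.1 (coordDegree_le b fun j => ?_)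
  rw [b.repr_self, Finsupp.single_apply]
  split_ifs <;> simp

theorem coordDegree_mul_le {C₀ : ℕ} (hC : ∀ i j, coordDegree b (b i * b j) ≤ C₀) (w w' : A) :
    coordDegree b (w * w') ≤ coordDegree b w + coordDegree b w' + C₀ := by
  have hw : w * w' = ∑ i, ∑ j, (b.repr w i * b.repr w' j) • (b i * b j) := by
    conv_lhs => rw [← b.sum_repr w, ← b.sum_repr w', Finset.sum_mul_sum]
    simp_rw [smul_mul_smul_comm]
  rw [hw]
  refine coordDegree_sum_le b _ _ fun i _ => coordDegree_sum_le b _ _ fun j _ => ?_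
  refine (coordDegree_smul_le b _ _).trans (Nat.add_le_add ?_ (hC i j))
  exact natDegree_mul_le.trans (Nat.add_le_add (natDegree_repr_le b _ _) (natDegree_repr_le b _ _))

theorem exists_coordDegree_mul_le :
    ∃ C₀ : ℕ, ∀ w w' : A, coordDegree b (w * w') ≤ coordDegree b w + coordDegree b w' + C₀ := by
  obtain ⟨M, hM⟩ := (Set.finite_range fun ij : Fin d × Fin d =>
    coordDegree b (b ij.1 * b ij.2)).bddAbove
  exact ⟨M, coordDegree_mul_le b fun i j => hM ⟨(i, j), rfl⟩⟩

theorem coordDegree_pow_le {C₀ : ℕ}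
    (h : ∀ w w' : A, coordDegree b (w * w') ≤ coordDegree b w + coordDegree b w' + C₀)
    (w : A) {n : ℕ} (hn : n ≠ 0) : coordDegree b (w ^ n) ≤ n * (coordDegree b w + C₀) := by
  induction n with
  | zero => exact absurd rfl hn
  | succ n ih =>
    rcases eq_or_ne n 0 with rfl | hn0
    · simp
    · rw [pow_succ]
      refine (h _ _).trans ?_
      have := ih hn0
      nlinarith

theorem natDegree_le_coordDegree [IsDomain A] {P : K[X]} {w : A} (hw : w ≠ 0)
    (h : algebraMap K[X] A P ∣ w) : P.natDegree ≤ coordDegree b w := by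
  obtain ⟨v, rfl⟩ := h
  rw [← Algebra.smul_def] at hw ⊢
  obtain ⟨i, hi⟩ : ∃ i, b.repr (P • v) i ≠ 0 := by
    by_contra! hc
    exact hw (b.repr.map_eq_zero_iff.1 (Finsupp.ext hc))
  refine le_trans ?_ (natDegree_repr_le b _ i)
  refine Polynomial.natDegree_le_of_dvd ?_ hi
  rw [map_smul, Finsupp.smul_apply, smul_eq_mul]
  exact dvd_mul_right _ _

theorem dvd_algebraMap_norm {K : Type*} [Field K] {A : Type*} [CommRing A] [Algebra K[X] A]
    {d : ℕ} (b : Module.Basis (Fin d) K[X] A) (w : A) : w ∣ algebraMap K[X] A (Algebra.norm K[X] w) := by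
  have h := Matrix.aeval_self_charpoly (Algebra.leftMulMatrix b w)
  have h2 : aeval w (Algebra.leftMulMatrix b w).charpoly = 0 := by
    apply Algebra.leftMulMatrix_injective b
    rw [map_zero, ← Polynomial.aeval_algHom_apply, h]
  have h3 : w ∣ algebraMap K[X] A ((Algebra.leftMulMatrix b w).charpoly.coeff 0) := by
    have := X_dvd_sub_C (p := (Algebra.leftMulMatrix b w).charpoly)
    have h4 := map_dvd (aeval w) this
    rw [map_sub, aeval_X, aeval_C, h2, zero_sub, dvd_neg] at h4
    exact h4
  rw [Algebra.norm_eq_matrix_det b, Matrix.det_eq_sign_charpoly_coeff, map_mul]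
  exact h3.mul_left _

theorem exists_coeff_ne_zero [IsDomain A] {C₀ : ℕ}
    (h : ∀ w w' : A, coordDegree b (w * w') ≤ coordDegree b w + coordDegree b w' + C₀)
    (ev : A →ₐ[K[X]] PowerSeries K) {w : A} (hw : w ≠ 0) :
    ∃ j ≤ d * (coordDegree b w + C₀), PowerSeries.coeff j (ev w) ≠ 0 := by
  have : Module.Free K[X] A := Module.Free.of_basis b
  have : Module.Finite K[X] A := Module.Finite.of_basis b
  have hN : Algebra.norm K[X] w ≠ 0 := Algebra.norm_ne_zero_iff.2 hw
  have hdeg : (Algebra.norm K[X] w).natDegree ≤ d * (coordDegree b w + C₀) := by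
    rw [Algebra.norm_eq_matrix_det b]
    have := Matrix.det_apply (Algebra.leftMulMatrix b w)
    rw [this]
    refine natDegree_sum_le_of_forall_le _ _ fun σ _ => ?_
    refine (natDegree_smul_le _ _).trans ?_
    refine (natDegree_prod_le _ _).trans ?_
    refine (Finset.sum_le_card_nsmul _ _ (coordDegree b w + C₀) fun i _ => ?_).trans ?_
    · rw [Algebra.leftMulMatrix_eq_repr_mul]
      refine (natDegree_repr_le b _ _).trans ((h _ _).trans ?_)
      rw [coordDegree_basis]; simp
    · simp
  by_contra! hc
  have hX : (PowerSeries.X : PowerSeries K) ^ (d * (coordDegree b w + C₀) + 1) ∣ ev w :=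
    PowerSeries.X_pow_dvd_iff.2 fun m hm => hc m (by omega)
  have h2 := hX.trans (map_dvd ev (Stepanov.dvd_algebraMap_norm b w))
  rw [AlgHom.commutes, PowerSeries.X_pow_dvd_iff] at h2
  apply hN
  ext n
  rw [coeff_zero]
  rcases le_or_gt n (d * (coordDegree b w + C₀)) with hn | hn
  · have := h2 n (by omega)
    simpa [PowerSeries.algebraMap_apply'] using this
  · exact coeff_eq_zero_of_natDegree_lt (by omega)

end Degree

theorem sum_pow_card_pow {K : Type*} [Field K] [Fintype K] {R : Type*} [CommRing R] (φ : K →+* R)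
    (m : ℕ) {ι : Type*} (s : Finset ι) (f : ι → R) :
    (∑ i ∈ s, f i) ^ (Fintype.card K ^ m) = ∑ i ∈ s, f i ^ (Fintype.card K ^ m) := by
  nontriviality R
  obtain ⟨p, hp, k, hpk, hk⟩ := FiniteField.card' K
  have := Fact.mk hpk
  have : CharP R p := charP_of_injective_ringHom φ.injective p
  rw [hk, ← pow_mul, sum_pow_char_pow]

theorem eq_zero_of_sum_mul_pow_eq_zero {K : Type*} [Field K] [Fintype K] {ι : Type*} [Fintype ι]
    (m : ℕ) (W f : ι → PowerSeries K)
    (hW : ∀ φ : ι → K, (∀ j < Fintype.card K ^ m, ∑ k, φ k * PowerSeries.coeff j (W k) = 0) → φ = 0)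
    (h : ∑ k, W k * f k ^ (Fintype.card K ^ m) = 0) : f = 0 := by
  set E := Fintype.card K ^ m with hE
  have hE0 : 0 < E := pow_pos Fintype.card_pos m
  suffices H : ∀ ν k, PowerSeries.coeff ν (f k) = 0 by
    funext k; ext ν; simpa using H ν k
  intro ν
  induction ν using Nat.strong_induction_on with
  | _ ν ih =>
  refine fun k => congrFun (hW (fun k => PowerSeries.coeff ν (f k)) fun j hj => ?_) k
  have h1 := congrArg (PowerSeries.coeff (j + ν * E)) h
  rw [map_sum, map_zero] at h1
  rw [← h1]
  refine Finset.sum_congr rfl fun k _ => ?_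
  rw [PowerSeries.coeff_mul, Finset.sum_eq_single (j, ν * E)]
  · rw [powerSeries_coeff_pow_card, if_pos (Dvd.intro_left _ rfl), ← hE, Nat.mul_div_cancel _ hE0,
      mul_comm]
  · rintro ⟨a, c⟩ hac hne
    rw [Finset.HasAntidiagonal.mem_antidiagonal] at hac
    rw [powerSeries_coeff_pow_card, ← hE]
    split_ifs with hdvd
    · obtain ⟨t, rfl⟩ := hdvd
      simp only at hac
      rw [Nat.mul_div_cancel_left _ hE0]
      rcases lt_trichotomy t ν with ht | rfl | ht
      · rw [ih t ht k, mul_zero]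
      · exact absurd (Prod.ext (by simp only; nlinarith) (mul_comm _ _)) hne
      · exfalso
        have : (ν + 1) * E ≤ t * E := Nat.mul_le_mul_right _ ht
        nlinarith
    · rw [mul_zero]
  · intro hn
    exact absurd (Finset.HasAntidiagonal.mem_antidiagonal.2 (by rfl)) hn

section

variable {K : Type*} [Field K] [Fintype K] {A : Type*} [CommRing A] [IsDomain A] [Algebra K[X] A]
  {d : ℕ} (b : Module.Basis (Fin d) K[X] A)

theorem eq_zero_of_sum_basis_mul_pow_eq_zero {C₀ : ℕ}
    (hC : ∀ w w' : A, coordDegree b (w * w') ≤ coordDegree b w + coordDegree b w' + C₀)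
    (ev : A →ₐ[K[X]] PowerSeries K) (hev : Function.Injective ev) (m l : ℕ)
    (hl : d * (l + C₀) < Fintype.card K ^ m) (F : Fin d × Fin (l + 1) → A)
    (h : ∑ k, ((X : K[X]) ^ (k.2 : ℕ) • b k.1) * F k ^ (Fintype.card K ^ m) = 0) : F = 0 := by
  have key := eq_zero_of_sum_mul_pow_eq_zero m
    (fun k : Fin d × Fin (l + 1) => ev ((X : K[X]) ^ (k.2 : ℕ) • b k.1)) (fun k => ev (F k)) ?_ ?_
  · funext k
    exact hev (by simpa using congrFun key k)
  · intro φ hφ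
    by_contra hne
    set w : A := ∑ k : Fin d × Fin (l + 1), (C (φ k) * (X : K[X]) ^ (k.2 : ℕ)) • b k.1 with hw
    have hw' : w = ∑ i, (∑ a : Fin (l + 1), C (φ (i, a)) * (X : K[X]) ^ (a : ℕ)) • b i := by
      rw [hw, Fintype.sum_prod_type]
      simp_rw [Finset.sum_smul]
    have hrepr : ∀ i, b.repr w i = ∑ a : Fin (l + 1), C (φ (i, a)) * (X : K[X]) ^ (a : ℕ) := by
      intro i
      rw [hw', b.repr_sum_self]
    have hdeg : coordDegree b w ≤ l := by
      refine coordDegree_le b fun i => ?_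
      rw [hrepr]
      refine natDegree_sum_le_of_forall_le _ _ fun a _ => ?_
      exact (natDegree_C_mul_X_pow_le _ _).trans (Nat.lt_succ_iff.1 a.2)
    have hw0 : w ≠ 0 := by
      intro h0
      apply hne
      funext ⟨i, a⟩
      have h1 : (b.repr w i).coeff a = φ (i, a) := by
        rw [hrepr, finsetSum_coeff, Finset.sum_eq_single a]
        · simp
        · intro c _ hca
          rw [coeff_C_mul_X_pow, if_neg]
          exact fun h => hca (Fin.ext h.symm)
        · simp
      rw [← h1, h0]; simp
    obtain ⟨j, hj, hne0⟩ := exists_coeff_ne_zero b hC ev hw0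
    apply hne0
    rw [← hφ j (lt_of_le_of_lt (hj.trans (by gcongr)) hl), hw, map_sum, map_sum]
    refine Finset.sum_congr rfl fun k _ => ?_
    rw [mul_smul, map_smul, ← PowerSeries.coeff_C_mul]
    congr 1
    rw [Algebra.smul_def, PowerSeries.algebraMap_apply']
    simp
  · have := congrArg ev h
    rw [map_sum, map_zero] at this
    rw [← this]
    exact Finset.sum_congr rfl fun k _ => by rw [map_mul, map_pow]

theorem exists_relation {ι : Type*} [Fintype ι] (M : ι → A) {D : ℕ}
    (hM : ∀ i, coordDegree b (M i) ≤ D) (hcard : d * (D + 1) < Fintype.card ι) :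
    ∃ c : ι → K, (∃ i, c i ≠ 0) ∧ ∑ i, (C (c i) : K[X]) • M i = 0 := by
  set v : ι → (Fin d × Fin (D + 1) → K) := fun i jk => (b.repr (M i) jk.1).coeff jk.2 with hv
  have hnot : ¬ LinearIndependent K v := by
    intro hli
    have := hli.fintype_card_le_finrank
    rw [Module.finrank_fintype_fun_eq_card, Fintype.card_prod, Fintype.card_fin,
      Fintype.card_fin] at this
    omega
  obtain ⟨c, hc0, hi⟩ := Fintype.not_linearIndependent_iff.1 hnot
  refine ⟨c, hi, b.repr.map_eq_zero_iff.1 (Finsupp.ext fun j => ?_)⟩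
  rw [map_sum, Finsupp.finsetSum_apply, Finsupp.zero_apply]
  ext k
  rw [finsetSum_coeff, coeff_zero]
  simp_rw [map_smul, Finsupp.smul_apply, smul_eq_mul, coeff_C_mul]
  rcases le_or_gt k D with hk | hk
  · have := congrFun hc0 (j, ⟨k, by omega⟩)
    simpa [hv] using this
  · refine Finset.sum_eq_zero fun i _ => ?_
    rw [coeff_eq_zero_of_natDegree_lt, mul_zero]
    exact ((natDegree_repr_le b _ _).trans (hM i)).trans_lt hk

/-- The Stepanov–Bombieri bound. -/
theorem exists_natDegree_bound (hd : 0 < d) (ev : A →ₐ[K[X]] PowerSeries K)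
    (hev : Function.Injective ev)
    {S : Type*} [Finite S] (G : S → Fin d → A) :
    ∃ C : ℕ, ∀ (m : ℕ) (P : K[X]) (g : S), m ≠ 0 →
      P ∣ X ^ (Fintype.card K ^ (2 * m)) - X →
      (∀ j, algebraMap K[X] A P ∣ b j ^ (Fintype.card K ^ (2 * m)) - G g j) →
      (∀ (w : A) (k : ℕ), algebraMap K[X] A P ∣ w ^ k → algebraMap K[X] A P ∣ w) →
      d * P.natDegree ≤ Fintype.card K ^ (2 * m) + C * Fintype.card K ^ m := by
  obtain ⟨C₀, hC⟩ := exists_coordDegree_mul_le b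
  obtain ⟨C₂, hC₂⟩ := (Set.finite_range fun ij : S × Fin d => coordDegree b (G ij.1 ij.2)).bddAbove
  have hG : ∀ g j, coordDegree b (G g j) ≤ C₂ := fun g j => hC₂ ⟨(g, j), rfl⟩
  set C₁ := 2 * C₀ + C₂ with hC₁
  obtain ⟨T₀, C', hT⟩ := exists_parameters d C₀ C₁ hd
  refine ⟨C' + d * T₀, fun m P g hm hP hcong hred => ?_⟩
  set E := Fintype.card K ^ m with hE
  have hQ : Fintype.card K ^ (2 * m) = E * E := by rw [hE, ← pow_add, two_mul]
  have hE1 : 1 < E := Nat.one_lt_pow hm Fintype.one_lt_card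
  have hPdeg : P.natDegree ≤ E * E := by
    have hQ1 : 1 < Fintype.card K ^ (2 * m) := by rw [hQ]; nlinarith
    have h1 := natDegree_le_of_dvd hP (FiniteField.X_pow_card_sub_X_ne_zero K hQ1)
    rwa [FiniteField.X_pow_card_sub_X_natDegree_eq K hQ1, hQ] at h1
  rw [hQ] at hcong hP ⊢
  rcases lt_or_ge E T₀ with hlt | hge
  · calc d * P.natDegree ≤ d * (E * E) := by gcongr
      _ ≤ d * (T₀ * E) := by gcongr
      _ ≤ _ := by nlinarith [Nat.zero_le (E * E), Nat.zero_le (C' * E)]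
  obtain ⟨l, l', hl, hdim, hfin⟩ := hT E hge
  set ι := (Fin d × Fin (l + 1)) × (Fin d × Fin (l' + 1)) with hι
  obtain ⟨c, ⟨i₀, hi₀⟩, hrel⟩ := exists_relation b (D := l * E + l' + C₁ * E)
    (fun i : ι => ((X : K[X]) ^ (i.1.2 : ℕ) • b i.1.1) ^ E * ((X : K[X]) ^ (i.2.2 : ℕ) • G g i.2.1))
    (by
      rintro ⟨⟨i, a⟩, ⟨j, e⟩⟩
      refine (hC _ _).trans ?_
      have h1 : coordDegree b (((X : K[X]) ^ (a : ℕ) • b i) ^ E) ≤ E * (l + C₀) := by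
        refine (coordDegree_pow_le b hC _ (by omega)).trans ?_
        have := coordDegree_smul_le b ((X : K[X]) ^ (a : ℕ)) (b i)
        rw [natDegree_X_pow, coordDegree_basis] at this
        have := a.2
        gcongr
        omega
      have h2 : coordDegree b ((X : K[X]) ^ (e : ℕ) • G g j) ≤ l' + C₂ := by
        have := coordDegree_smul_le b ((X : K[X]) ^ (e : ℕ)) (G g j)
        rw [natDegree_X_pow] at this
        have := e.2
        have := hG g j
        omega
      simp only
      have h3 : (C₀ + C₂) * 1 ≤ (C₀ + C₂) * E := Nat.mul_le_mul_left _ hE1.le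
      rw [hC₁]
      nlinarith)
    (by
      simp only [hι, Fintype.card_prod, Fintype.card_fin]
      calc d * (l * E + l' + C₁ * E + 1) < d * (d * (l + 1) * (l' + 1)) := by gcongr
        _ = _ := by ring)
  set R₀ : A := ∑ i : ι, (C (c i) : K[X]) •
    (((X : K[X]) ^ (i.1.2 : ℕ) • b i.1.1) * ((X : K[X]) ^ (i.2.2 : ℕ) • b i.2.1) ^ E) with hR₀
  have hsum : ∀ {κ : Type} (s : Finset κ) (f : κ → A), (∑ i ∈ s, f i) ^ E = ∑ i ∈ s, f i ^ E :=
    fun s f => sum_pow_card_pow ((algebraMap K[X] A).comp C) m s f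
  have hCpow : ∀ (a : K) (w : A), ((C a : K[X]) • w) ^ E = (C a : K[X]) • w ^ E := fun a w => by
    rw [_root_.smul_pow, ← C_pow, hE, FiniteField.pow_card_pow]
  have hR₀ne : R₀ ≠ 0 := by
    intro h0
    have hF := eq_zero_of_sum_basis_mul_pow_eq_zero b hC ev hev m l hl
      (fun k => ∑ e : Fin d × Fin (l' + 1), (C (c (k, e)) : K[X]) • ((X : K[X]) ^ (e.2 : ℕ) • b e.1)) (by
        rw [← h0, hR₀, Fintype.sum_prod_type (α₁ := Fin d × Fin (l + 1))]
        refine Finset.sum_congr rfl fun k _ => ?_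
        rw [← hE, hsum, Finset.mul_sum]
        refine Finset.sum_congr rfl fun e _ => ?_
        rw [hCpow, mul_smul_comm])
    have h1 := congrFun hF i₀.1
    simp only [Pi.zero_apply] at h1
    have h2 : ∑ i, (∑ a : Fin (l' + 1), C (c (i₀.1, (i, a))) * (X : K[X]) ^ (a : ℕ)) • b i = 0 := by
      rw [← h1, Fintype.sum_prod_type]
      simp_rw [Finset.sum_smul, mul_smul]
    have h3 := congrArg (fun w => (b.repr w i₀.2.1).coeff i₀.2.2) h2
    simp only [b.repr_sum_self, map_zero, Finsupp.zero_apply, coeff_zero, finsetSum_coeff] at h3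
    rw [Finset.sum_eq_single i₀.2.2] at h3
    · exact hi₀ (by simpa using h3)
    · intro e _ hca
      rw [coeff_C_mul_X_pow, if_neg]
      exact fun h => hca (Fin.ext h.symm)
    · simp
  have hdvd : algebraMap K[X] A P ∣ R₀ ^ E := by
    rw [← sub_zero (R₀ ^ E), ← hrel, hR₀, hsum, ← Finset.sum_sub_distrib]
    refine Finset.dvd_sum fun i _ => ?_
    rw [hCpow, ← smul_sub, mul_pow, ← pow_mul, ← mul_sub, Algebra.smul_def]
    refine Dvd.dvd.mul_left (Dvd.dvd.mul_left ?_ _) _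
    rw [_root_.smul_pow, Algebra.smul_def, Algebra.smul_def]
    have e1 : algebraMap K[X] A P ∣ algebraMap K[X] A ((X ^ (i.2.2 : ℕ)) ^ (E * E)) -
        algebraMap K[X] A (X ^ (i.2.2 : ℕ)) := by
      rw [← map_sub, ← pow_mul, mul_comm, pow_mul]
      exact map_dvd _ (hP.trans (sub_dvd_pow_sub_pow _ _ _))
    have e2 := hcong i.2.1
    have e3 := (e1.mul_right (b i.2.1 ^ (E * E))).add
      (e2.mul_left (algebraMap K[X] A (X ^ (i.2.2 : ℕ))))
    convert e3 using 1
    ring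
  have h1 := natDegree_le_coordDegree b hR₀ne (hred _ _ hdvd)
  have h2 : coordDegree b R₀ ≤ l + l' * E + C₁ * E := by
    refine coordDegree_sum_le b _ _ ?_
    rintro ⟨⟨i, a⟩, ⟨j, e⟩⟩ -
    refine (coordDegree_smul_le b _ _).trans ?_
    rw [natDegree_C, zero_add]
    refine (hC _ _).trans ?_
    have h1 := coordDegree_smul_le b ((X : K[X]) ^ (a : ℕ)) (b i)
    rw [natDegree_X_pow, coordDegree_basis] at h1
    have h2 : coordDegree b (((X : K[X]) ^ (e : ℕ) • b j) ^ E) ≤ E * (l' + C₀) := by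
      refine (coordDegree_pow_le b hC _ (by omega)).trans ?_
      have := coordDegree_smul_le b ((X : K[X]) ^ (e : ℕ)) (b j)
      rw [natDegree_X_pow, coordDegree_basis] at this
      have := e.2
      gcongr
      omega
    have h3 : C₀ * 1 ≤ C₀ * E := Nat.mul_le_mul_left _ hE1.le
    have := a.2
    simp only
    rw [hC₁]
    nlinarith
  calc d * P.natDegree ≤ d * (l + l' * E + C₁ * E) := by gcongr; exact h1.trans h2
    _ ≤ E ^ 2 + C' * E := hfin
    _ ≤ _ := by nlinarith [Nat.zero_le (d * T₀ * E)]

end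

section Solution

variable {K : Type*} [Field K] [Fintype K] {ι : Type*} [Fintype ι]

/-- Coefficients of the matrix power series solving `Z^(q) = (1 - u M) Z`, `Z(0) = 1`. -/
def solCoeff (M : Matrix ι ι K) : ℕ → Matrix ι ι K
  | 0 => 1
  | k + 1 =>
    have _hq : 1 < Fintype.card K := Fintype.one_lt_card
    M * solCoeff M k +
      if Fintype.card K ∣ k + 1 then solCoeff M ((k + 1) / Fintype.card K) else 0
decreasing_by
  · exact Nat.lt_succ_self k
  · exact Nat.div_lt_self (Nat.succ_pos k) _hq

/-- The matrix power series with `Z^(q) = (1 - u M) Z`, `Z(0) = 1`. -/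
def sol (M : Matrix ι ι K) : Matrix ι ι (PowerSeries K) :=
  Matrix.of fun i j => PowerSeries.mk fun k => solCoeff M k i j

/-- The matrix polynomials with `Z^(q ^ n) = V_n Z`. -/
def frobStep (M : Matrix ι ι K) : ℕ → Matrix ι ι K[X]
  | 0 => 1
  | n + 1 => (FiniteField.frobeniusAlgHom K K[X]).mapMatrix (frobStep M n) *
      (1 - (X : K[X]) • M.map C)

theorem sol_pow_card (M : Matrix ι ι K) :
    (FiniteField.frobeniusAlgHom K (PowerSeries K)).mapMatrix (sol M) =
      (algebraMap K[X] (PowerSeries K)).mapMatrix (1 - (X : K[X]) • M.map C) * sol M := by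
  have h1 : (algebraMap K[X] (PowerSeries K)).mapMatrix (1 - (X : K[X]) • M.map C) =
      1 - (PowerSeries.X : PowerSeries K) • M.map PowerSeries.C := by
    rw [map_sub, map_one]
    congr 1
    ext i j : 2
    simp [PowerSeries.algebraMap_apply']
    exact mul_comm _ _
  rw [h1]
  ext i j n
  rw [AlgHom.mapMatrix_apply, Matrix.map_apply, FiniteField.coe_frobeniusAlgHom, sub_mul, one_mul,
    smul_mul_assoc, Matrix.sub_apply, Matrix.smul_apply, Matrix.mul_apply, smul_eq_mul]
  have := powerSeries_coeff_pow_card (sol M i j) 1 n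
  rw [pow_one] at this
  simp only [this, map_sub]
  rcases n with _ | n
  · simp [sol, solCoeff]
  · rw [PowerSeries.coeff_succ_X_mul, map_sum]
    simp only [Matrix.map_apply, PowerSeries.coeff_C_mul, sol, Matrix.of_apply, PowerSeries.coeff_mk]
    conv_rhs => rw [solCoeff]
    rw [Matrix.add_apply, Matrix.mul_apply, add_sub_cancel_left]
    split_ifs <;> rfl

theorem sol_pow_card_pow (M : Matrix ι ι K) (n : ℕ) :
    (sol M).map (· ^ (Fintype.card K ^ n)) =
      (algebraMap K[X] (PowerSeries K)).mapMatrix (frobStep M n) * sol M := by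
  induction n with
  | zero => simp [frobStep]
  | succ n ih =>
    have h1 : (sol M).map (· ^ (Fintype.card K ^ (n + 1))) =
        (FiniteField.frobeniusAlgHom K (PowerSeries K)).mapMatrix
          ((sol M).map (· ^ (Fintype.card K ^ n))) := by
      ext1 i j
      simp [pow_succ, pow_mul]
    rw [h1, ih, map_mul, sol_pow_card, frobStep, map_mul, ← mul_assoc]
    congr 2
    ext1 i j
    simp

theorem det_sol_ne_zero (M : Matrix ι ι K) : (sol M).det ≠ 0 := by
  intro h
  have h1 := congrArg (PowerSeries.constantCoeff (R := K)) h
  rw [RingHom.map_det, map_zero] at h1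
  have : (PowerSeries.constantCoeff (R := K)).mapMatrix (sol M) = 1 := by
    ext i j
    rw [RingHom.mapMatrix_apply, Matrix.map_apply, ← PowerSeries.coeff_zero_eq_constantCoeff_apply]
    simp [sol, solCoeff]
  rw [this, Matrix.det_one] at h1
  exact one_ne_zero h1

theorem isIntegral_sol (M : Matrix ι ι K) (i j : ι) : IsIntegral K[X] (sol M i j) := by
  set N : Submodule K[X] (PowerSeries K) := Submodule.span K[X] (Set.range fun l => sol M l j)
  have hN : N.FG := Submodule.fg_span (Set.finite_range _)
  have hmem : ∀ n, sol M i j ^ (Fintype.card K ^ n) ∈ N := by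
    intro n
    have := congrFun (congrFun (sol_pow_card_pow M n) i) j
    rw [Matrix.map_apply, Matrix.mul_apply] at this
    rw [this]
    refine Submodule.sum_mem _ fun l _ => ?_
    rw [RingHom.mapMatrix_apply, Matrix.map_apply, ← Algebra.smul_def]
    exact Submodule.smul_mem _ _ (Submodule.subset_span ⟨l, rfl⟩)
  have : Module.Finite K[X] N := Module.Finite.iff_fg.2 hN
  have : IsNoetherian K[X] N := isNoetherian_of_isNoetherianRing_of_finite _ _
  let y : ℕ → N := fun n => ⟨_, hmem n⟩
  obtain ⟨n, hn⟩ := monotone_stabilizes_iff_noetherian.2 this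
    ⟨fun k => Submodule.span K[X] (y '' Set.Iio k),
      fun a b hab => Submodule.span_mono (Set.image_mono (Set.Iio_subset_Iio hab))⟩
  have h1 : y n ∈ Submodule.span K[X] (y '' Set.Iio n) := by
    have h2 := hn (n + 1) (Nat.le_succ n)
    change Submodule.span K[X] (y '' Set.Iio n) = Submodule.span K[X] (y '' Set.Iio (n + 1)) at h2
    rw [h2]
    exact Submodule.subset_span ⟨n, Nat.lt_succ_self n, rfl⟩
  have hfin : y '' Set.Iio n = y '' (Finset.range n : Set ℕ) := by simp
  rw [hfin, Submodule.mem_span_image_finset_iff_exists_fun] at h1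
  obtain ⟨c, hc⟩ := h1
  refine ⟨X ^ (Fintype.card K ^ n) - ∑ k : Finset.range n, C (c k) * X ^ (Fintype.card K ^ (k : ℕ)),
    ?_, ?_⟩
  · rw [sub_eq_add_neg]
    refine monic_X_pow_add ?_
    rw [degree_neg]
    refine (degree_sum_le _ _).trans_lt ((Finset.sup_lt_iff (WithBot.bot_lt_coe _)).2 fun k _ => ?_)
    refine (degree_C_mul_X_pow_le _ _).trans_lt ?_
    exact_mod_cast Nat.pow_lt_pow_right Fintype.one_lt_card (Finset.mem_range.1 k.2)
  · have h3 := congrArg (Subtype.val) hc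
    rw [AddSubmonoidClass.coe_finsetSum] at h3
    rw [← aeval_def, map_sub, map_sum, map_pow, aeval_X, sub_eq_zero]
    refine h3.symm.trans ?_
    refine Finset.sum_congr rfl fun k _ => ?_
    simp [y, Algebra.smul_def]

end Solution

section Core

variable {K : Type*} [Field K] [Fintype K] {ι : Type*} [Fintype ι] (M : Matrix ι ι K)

/-- The `K[X]`-algebra generated by the entries of the solution matrix. -/
abbrev solAlgebra : Subalgebra K[X] (PowerSeries K) :=
  Algebra.adjoin K[X] (Set.range fun ij : ι × ι => sol M ij.1 ij.2)

theorem sol_mem (i j : ι) : sol M i j ∈ solAlgebra M := Algebra.subset_adjoin ⟨(i, j), rfl⟩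

instance : Module.Finite K[X] (solAlgebra M) :=
  Module.Finite.iff_fg.2 (fg_adjoin_of_finite (Set.finite_range _) (by
    rintro _ ⟨ij, rfl⟩
    exact isIntegral_sol M _ _))

theorem algebraMap_powerSeries_injective : Function.Injective (algebraMap K[X] (PowerSeries K)) := by
  intro a c h
  rw [PowerSeries.algebraMap_apply', PowerSeries.algebraMap_apply'] at h
  ext n
  simpa using congrArg (PowerSeries.coeff n) h

instance : FaithfulSMul K[X] (PowerSeries K) :=
  (faithfulSMul_iff_algebraMap_injective _ _).2 algebraMap_powerSeries_injective

instance : Module.Free K[X] (solAlgebra M) := Module.free_of_finite_type_torsion_free'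

/-- The entries of the solution matrix, inside the algebra they generate. -/
def solIn : Matrix ι ι (solAlgebra M) := Matrix.of fun i j => ⟨sol M i j, sol_mem M i j⟩

/-- Evaluation of polynomials at the translate `g Z` of the solution. -/
def evalAt (g : Matrix ι ι K) : MvPolynomial (ι × ι) K[X] →ₐ[K[X]] solAlgebra M :=
  MvPolynomial.aeval fun ij => ((algebraMap K[X] (solAlgebra M)).mapMatrix (g.map C) * solIn M) ij.1 ij.2

theorem evalAt_one_surjective : Function.Surjective (evalAt M 1) := by
  rintro ⟨w, hw⟩
  rw [solAlgebra, Algebra.adjoin_range_eq_range_aeval] at hw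
  obtain ⟨β, rfl⟩ := hw
  refine ⟨β, Subtype.ext ?_⟩
  change (solAlgebra M).val (evalAt M 1 β) = _
  rw [← AlgHom.comp_apply]
  congr 1
  apply MvPolynomial.algHom_ext
  intro ij
  simp [evalAt, solIn, Matrix.map_one]

/-- The matrices `g` for which `Z ↦ g Z` extends to an algebra endomorphism. -/
def symmetries : Submonoid (Matrix ι ι K) where
  carrier := {g | ∃ σ : solAlgebra M →ₐ[K[X]] solAlgebra M,
    σ.mapMatrix (solIn M) = (algebraMap K[X] (solAlgebra M)).mapMatrix (g.map C) * solIn M}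
  one_mem' := ⟨AlgHom.id _ _, by
    ext1 i j
    simp [Matrix.map_one]⟩
  mul_mem' := by
    rintro g h ⟨σ, hσ⟩ ⟨τ, hτ⟩
    refine ⟨τ.comp σ, ?_⟩
    have h1 : (τ.comp σ).mapMatrix (solIn M) = τ.mapMatrix (σ.mapMatrix (solIn M)) := rfl
    have h2 : (g * h).map (C : K →+* K[X]) = g.map C * h.map C := Matrix.map_mul
    rw [h1, hσ, map_mul, hτ, h2, map_mul, mul_assoc]
    congr 1
    ext1 i j
    simp

theorem mem_symmetries_of_forall {g : Matrix ι ι K}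
    (h : ∀ β, evalAt M 1 β = 0 → evalAt M g β = 0) : g ∈ symmetries M := by
  refine ⟨AlgHom.liftOfSurjective (evalAt M 1) (evalAt_one_surjective M) (evalAt M g) h, ?_⟩
  ext1 i j
  have h1 : solIn M i j = evalAt M 1 (MvPolynomial.X (i, j)) := by
    simp [evalAt, Matrix.map_one]
  rw [AlgHom.mapMatrix_apply, Matrix.map_apply, h1]
  refine (AlgHom.liftOfSurjective_apply _ _ _ _ _).trans ?_
  simp [evalAt]

theorem det_solIn_ne_zero : (solIn M).det ≠ 0 := by
  intro h
  apply det_sol_ne_zero M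
  have := congrArg (solAlgebra M).val h
  rw [AlgHom.map_det, map_zero] at this
  exact this

theorem det_ne_zero_of_mem_symmetries {g : Matrix ι ι K} (hg : g ∈ symmetries M) : g.det ≠ 0 := by
  obtain ⟨σ, hσ⟩ := hg
  have hinj : Function.Injective σ := by
    rw [injective_iff_map_eq_zero]
    intro w hw
    by_contra hne
    have h1 := map_dvd σ (dvd_algebraMap_norm (Module.finBasis K[X] (solAlgebra M)) w)
    rw [hw, zero_dvd_iff, AlgHom.commutes] at h1
    have h2 : Algebra.norm K[X] w = 0 :=
      (FaithfulSMul.algebraMap_injective K[X] (solAlgebra M)) (by rw [h1, map_zero])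
    exact hne (Algebra.norm_eq_zero_iff.1 h2)
  intro h
  have h1 := congrArg Matrix.det hσ
  rw [Matrix.det_mul, ← AlgHom.map_det, ← RingHom.map_det,
    show (g.map (C : K →+* K[X])).det = C g.det from (RingHom.map_det C g).symm, h, map_zero,
    map_zero, zero_mul] at h1
  exact det_solIn_ne_zero M (hinj (by rw [h1, map_zero]))

theorem card_symmetries_le : Nat.card (symmetries M) ≤ Module.finrank K[X] (solAlgebra M) := by
  refine le_trans ?_ (card_algHom_le_finrank K[X] (solAlgebra M) (solAlgebra M))
  refine Nat.card_le_card_of_injective (fun g => g.2.choose) fun g h hgh => ?_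
  have h1 := g.2.choose_spec
  have h2 := h.2.choose_spec
  simp only at hgh
  rw [hgh, h2] at h1
  have h3 := congrArg (· * (solIn M).adjugate) h1
  simp only [mul_assoc, Matrix.mul_adjugate, mul_smul_comm, mul_one] at h3
  apply Subtype.ext
  ext i j
  have h4 := congrFun (congrFun h3 i) j
  simp only [Matrix.smul_apply, smul_eq_mul] at h4
  have h5 := mul_left_cancel₀ (det_solIn_ne_zero M) h4
  exact (C_injective (FaithfulSMul.algebraMap_injective K[X] (solAlgebra M) h5)).symm

theorem X_pow_sub_X_dvd_pow_sub {K : Type*} [Field K] [Fintype K] (n : ℕ) (r : K[X]) :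
    X ^ (Fintype.card K ^ n) - X ∣ r ^ (Fintype.card K ^ n) - r := by
  induction r using Polynomial.induction_on' with
  | add a c ha hc =>
    have := sum_pow_card_pow (C : K →+* K[X]) n Finset.univ ![a, c]
    simp only [Fin.sum_univ_two, Matrix.cons_val_zero, Matrix.cons_val_one] at this
    rw [this]
    convert ha.add hc using 1
    ring
  | monomial k a =>
    rw [← C_mul_X_pow_eq_monomial, mul_pow, ← C_pow, FiniteField.pow_card_pow, ← mul_sub,
      ← pow_mul, mul_comm k, pow_mul]
    exact (sub_dvd_pow_sub_pow _ _ _).mul_left _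

theorem dvd_pow_sub_evalAt {n : ℕ} {P : K[X]} (hP : P ∣ X ^ (Fintype.card K ^ n) - X)
    {g : Matrix ι ι K}
    (hg : ∀ i j, algebraMap K[X] (solAlgebra M) P ∣ solIn M i j ^ (Fintype.card K ^ n) -
      ((algebraMap K[X] (solAlgebra M)).mapMatrix (g.map C) * solIn M) i j)
    (β : MvPolynomial (ι × ι) K[X]) :
    algebraMap K[X] (solAlgebra M) P ∣ evalAt M 1 β ^ (Fintype.card K ^ n) - evalAt M g β := by
  induction β using MvPolynomial.induction_on with
  | C r =>
    simp only [evalAt, MvPolynomial.algHom_C]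
    rw [← map_pow, ← map_sub]
    refine map_dvd _ ?_
    exact hP.trans (X_pow_sub_X_dvd_pow_sub n r)
  | add a c ha hc =>
    have := sum_pow_card_pow ((algebraMap K[X] (solAlgebra M)).comp C) n Finset.univ
      ![evalAt M 1 a, evalAt M 1 c]
    simp only [Fin.sum_univ_two, Matrix.cons_val_zero, Matrix.cons_val_one] at this
    rw [map_add, map_add, this]
    convert ha.add hc using 1
    ring
  | mul_X a ij ha =>
    rw [map_mul, map_mul, mul_pow]
    have h1 := hg ij.1 ij.2
    have h2 : evalAt M 1 (MvPolynomial.X ij) = solIn M ij.1 ij.2 := by simp [evalAt, Matrix.map_one]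
    have h3 : evalAt M g (MvPolynomial.X ij) =
      ((algebraMap K[X] (solAlgebra M)).mapMatrix (g.map C) * solIn M) ij.1 ij.2 := by simp [evalAt]
    rw [h2, h3]
    convert (ha.mul_right (solIn M ij.1 ij.2 ^ Fintype.card K ^ n)).add
      (h1.mul_left (evalAt M g a)) using 1
    ring

theorem dvd_solIn_pow_sub {n : ℕ} {P : K[X]} {g : Matrix ι ι K}
    (hg : ∀ i j, P ∣ frobStep M n i j - C (g i j)) (i j : ι) :
    algebraMap K[X] (solAlgebra M) P ∣ solIn M i j ^ (Fintype.card K ^ n) -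
      ((algebraMap K[X] (solAlgebra M)).mapMatrix (g.map C) * solIn M) i j := by
  have h1 : solIn M i j ^ (Fintype.card K ^ n) =
      ((algebraMap K[X] (solAlgebra M)).mapMatrix (frobStep M n) * solIn M) i j := by
    apply Subtype.ext
    have := congrFun (congrFun (sol_pow_card_pow M n) i) j
    rw [Matrix.map_apply] at this
    change (sol M i j) ^ (Fintype.card K ^ n) = (solAlgebra M).val _
    rw [this, Matrix.mul_apply, Matrix.mul_apply, map_sum]
    rfl
  rw [h1, Matrix.mul_apply, Matrix.mul_apply, ← Finset.sum_sub_distrib]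
  refine Finset.dvd_sum fun l _ => ?_
  rw [← sub_mul]
  refine Dvd.dvd.mul_right ?_ _
  simp only [RingHom.mapMatrix_apply, Matrix.map_apply]
  rw [← map_sub]
  exact map_dvd _ (hg i l)

/-- If `g` has finite order then `A / P` is reduced. -/
theorem dvd_of_dvd_pow {n : ℕ} (hn : n ≠ 0) {P : K[X]} (hP : P ∣ X ^ (Fintype.card K ^ n) - X)
    {g : Matrix ι ι K} (hdet : g.det ≠ 0) (hg : ∀ i j, P ∣ frobStep M n i j - C (g i j))
    (w : solAlgebra M) (k : ℕ) (hk : algebraMap K[X] (solAlgebra M) P ∣ w ^ k) :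
    algebraMap K[X] (solAlgebra M) P ∣ w := by
  set φ := algebraMap K[X] (solAlgebra M) with hφ
  set q := Fintype.card K with hq
  have hXpow : ∀ j, P ∣ X ^ (q ^ (n * j)) - X := by
    intro j
    induction j with
    | zero => simp
    | succ j ih =>
      have h1 : P ∣ (X ^ (q ^ (n * j)) : K[X]) ^ (q ^ n) - X ^ (q ^ (n * j)) :=
        hP.trans (X_pow_sub_X_dvd_pow_sub n _)
      rw [← pow_mul, ← pow_add] at h1
      convert h1.add ih using 1
      rw [mul_add, mul_one]; ring
  have hpow : ∀ j i l, φ P ∣ solIn M i l ^ (q ^ (n * j)) -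
      (φ.mapMatrix ((g ^ j).map C) * solIn M) i l := by
    intro j
    induction j with
    | zero => intro i l; simp [Matrix.map_one]
    | succ j ih =>
      intro i l
      have h1 : ∀ i l, φ P ∣ solIn M i l ^ (q ^ n) - (φ.mapMatrix (g.map C) * solIn M) i l :=
        dvd_solIn_pow_sub M hg
      have h2 := dvd_pow_sub_evalAt M (hXpow j) ih
        (∑ t, MvPolynomial.C (C (g i t)) * MvPolynomial.X (t, l))
      have e1 : evalAt M 1 (∑ t, MvPolynomial.C (C (g i t)) * MvPolynomial.X (t, l)) =
          (φ.mapMatrix (g.map C) * solIn M) i l := by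
        have hX : ∀ t, evalAt M 1 (MvPolynomial.X (t, l)) = solIn M t l := fun t => by
          simp [evalAt, Matrix.map_one]
        have hC : ∀ r, evalAt M 1 (MvPolynomial.C r) = φ r := fun r => by
          simp [evalAt, MvPolynomial.algHom_C, hφ]
        simp only [map_sum, map_mul, hX, hC, Matrix.mul_apply, RingHom.mapMatrix_apply,
          Matrix.map_apply]
      have e2 : evalAt M (g ^ j) (∑ t, MvPolynomial.C (C (g i t)) * MvPolynomial.X (t, l)) =
          (φ.mapMatrix ((g ^ (j + 1)).map C) * solIn M) i l := by
        have : (g ^ (j + 1)).map (C : K →+* K[X]) = g.map C * (g ^ j).map C := by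
          rw [pow_succ']; exact Matrix.map_mul
        rw [this, map_mul, mul_assoc, Matrix.mul_apply]
        simp [evalAt, MvPolynomial.algHom_C, hφ]
      rw [e1, e2] at h2
      have h3 := (h1 i l).trans (sub_dvd_pow_sub_pow _ _ (q ^ (n * j)))
      rw [← pow_mul, ← pow_add] at h3
      convert h3.add h2 using 1
      rw [show n * (j + 1) = n + n * j by ring]
      ring
  obtain ⟨o, ho, hgo⟩ : ∃ o, 0 < o ∧ g ^ o = 1 := by
    obtain ⟨u, hu⟩ := (Matrix.isUnit_iff_isUnit_det g).2 (isUnit_iff_ne_zero.2 hdet)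
    refine ⟨orderOf u, orderOf_pos u, ?_⟩
    rw [← hu, ← Units.val_pow_eq_pow_val, pow_orderOf_eq_one, Units.val_one]
  have hw : ∀ w, φ P ∣ w ^ (q ^ (n * (o * (k + 1)))) - w := by
    intro w
    obtain ⟨β, rfl⟩ := evalAt_one_surjective M w
    have := dvd_pow_sub_evalAt M (hXpow (o * (k + 1))) (hpow (o * (k + 1))) β
    rwa [pow_mul g, hgo, one_pow] at this
  have hle : k ≤ q ^ (n * (o * (k + 1))) := by
    have h1 : k + 1 ≤ n * (o * (k + 1)) := by
      rw [← mul_assoc]; exact Nat.le_mul_of_pos_left _ (by positivity)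
    have h2 := Nat.lt_pow_self (n := n * (o * (k + 1))) (Fintype.one_lt_card (α := K))
    rw [← hq] at h2
    omega
  have h1 := (hk.trans (pow_dvd_pow w hle)).sub (hw w)
  rwa [sub_sub_cancel] at h1

theorem dvd_of_dvd_neg {R : Type*} [CommRing R] {a b : R} (h : a ∣ -b) : a ∣ b :=
  (dvd_neg).1 h

theorem exists_bounds : ∃ (d C₁ : ℕ), 0 < d ∧ Nat.card (symmetries M) ≤ d ∧
    (∀ (n : ℕ) (P : K[X]) (g : Matrix ι ι K), P ∣ X ^ (Fintype.card K ^ n) - X →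
      (∀ i j, P ∣ frobStep M n i j - C (g i j)) → g ∉ symmetries M → P.natDegree ≤ C₁) ∧
    (∀ (m : ℕ) (P : K[X]) (g : Matrix ι ι K), m ≠ 0 → P ∣ X ^ (Fintype.card K ^ (2 * m)) - X →
      (∀ i j, P ∣ frobStep M (2 * m) i j - C (g i j)) → g ∈ symmetries M →
      d * P.natDegree ≤ Fintype.card K ^ (2 * m) + C₁ * Fintype.card K ^ m) := by
  set b := Module.finBasis K[X] (solAlgebra M)
  have hd : 0 < Module.finrank K[X] (solAlgebra M) := Module.finrank_pos
  choose β hβ using fun j => evalAt_one_surjective M (b j)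
  obtain ⟨C₂, hC₂⟩ := exists_natDegree_bound b hd (solAlgebra M).val Subtype.val_injective
    (fun (g : Matrix ι ι K) j => evalAt M g (β j))
  have hex : ∀ g : {g : Matrix ι ι K // g ∉ symmetries M},
      ∃ γ, evalAt M 1 γ = 0 ∧ evalAt M g γ ≠ 0 := by
    rintro ⟨g, hg⟩
    by_contra! hc
    exact hg (mem_symmetries_of_forall M hc)
  choose γ hγ0 hγ using hex
  obtain ⟨C₃, hC₃⟩ := (Set.finite_range fun g : {g : Matrix ι ι K // g ∉ symmetries M} =>
    coordDegree b (evalAt M g (γ g))).bddAbove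
  refine ⟨_, C₂ + C₃, hd, card_symmetries_le M, ?_, ?_⟩
  · intro n P g hP hcong hg
    have h1 := dvd_pow_sub_evalAt M hP (dvd_solIn_pow_sub M hcong) (γ ⟨g, hg⟩)
    rw [hγ0, zero_pow (pow_ne_zero _ Fintype.card_ne_zero), zero_sub] at h1
    replace h1 := dvd_of_dvd_neg h1
    have h2 := natDegree_le_coordDegree b (hγ ⟨g, hg⟩) h1
    have h3 : coordDegree b (evalAt M g (γ ⟨g, hg⟩)) ≤ C₃ := hC₃ ⟨⟨g, hg⟩, rfl⟩
    exact (h2.trans h3).trans (Nat.le_add_left _ _)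
  · intro m P g hm hP hcong hg
    refine (hC₂ m P g hm hP (fun j => ?_) ?_).trans (by gcongr; omega)
    · rw [← hβ]
      exact dvd_pow_sub_evalAt M hP (dvd_solIn_pow_sub M hcong) (β j)
    · exact dvd_of_dvd_pow M (by omega) hP (det_ne_zero_of_mem_symmetries M hg) hcong

end Core

section Count

/-- Counts that are bounded off `S`, almost at most `Q ^ 2 / #S` on `S` and of total `Q ^ 2` are
equidistributed on `S`. -/
theorem norm_sum_le_of_counts {W : Type*} [Fintype W] (S : Finset W) {d C₁ : ℕ}
    (hS : S.card ≤ d) (N : W → ℕ) {Q : ℕ} (hQ : 0 < Q) (htot : ∑ w, N w = Q ^ 2)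
    (hout : ∀ w ∉ S, N w ≤ C₁) (hin : ∀ w ∈ S, d * N w ≤ Q ^ 2 + C₁ * Q) (f : W → ℂ)
    (hf : ∀ w, ‖f w‖ ≤ 1) :
    (∑ w ∈ S, f w = 0 → ‖∑ w, f w * N w‖ ≤ (S.card + 2) * (S.card + Fintype.card W + 2) * C₁ * Q) ∧
    ((∀ w ∈ S, f w = 1) → ‖∑ w, f w * N w - (Q : ℂ) ^ 2‖ ≤ 2 * Fintype.card W * C₁) := by
  have hsplit : ∀ g : W → ℂ, ∑ w, g w = ∑ w ∈ S, g w + ∑ w ∈ Sᶜ, g w := fun g =>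
    (Finset.sum_add_sum_compl S g).symm
  have hW : ((Sᶜ).card : ℝ) ≤ Fintype.card W := by exact_mod_cast Finset.card_le_univ _
  have hout' : ‖∑ w ∈ Sᶜ, f w * (N w : ℂ)‖ ≤ Fintype.card W * C₁ := by
    calc ‖∑ w ∈ Sᶜ, f w * (N w : ℂ)‖ ≤ ∑ w ∈ Sᶜ, (C₁ : ℝ) := by
          refine norm_sum_le_of_le _ fun w hw => ?_
          rw [norm_mul, Complex.norm_natCast]
          have h1 : (N w : ℝ) ≤ C₁ := by exact_mod_cast hout w (Finset.mem_compl.1 hw)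
          calc ‖f w‖ * N w ≤ 1 * C₁ := by gcongr; exact hf w
            _ = C₁ := one_mul _
      _ = (Sᶜ).card * C₁ := by rw [Finset.sum_const, nsmul_eq_mul]
      _ ≤ _ := by gcongr
  have hout1 : (∑ w ∈ Sᶜ, (N w : ℝ)) ≤ Fintype.card W * C₁ := by
    calc (∑ w ∈ Sᶜ, (N w : ℝ)) ≤ ∑ w ∈ Sᶜ, (C₁ : ℝ) := Finset.sum_le_sum fun w hw => by
          exact_mod_cast hout w (Finset.mem_compl.1 hw)
      _ = (Sᶜ).card * C₁ := by rw [Finset.sum_const, nsmul_eq_mul]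
      _ ≤ _ := by gcongr
  have htotR : ∑ w ∈ S, (N w : ℝ) + ∑ w ∈ Sᶜ, (N w : ℝ) = (Q : ℝ) ^ 2 := by
    rw [Finset.sum_add_sum_compl]; exact_mod_cast htot
  have hW0 : (0 : ℝ) ≤ Fintype.card W * C₁ := by positivity
  have hQ1 : (1 : ℝ) ≤ Q := by exact_mod_cast hQ
  constructor
  · intro h0
    rcases S.eq_empty_or_nonempty with rfl | hne
    · rw [hsplit, Finset.sum_empty, zero_add]
      refine hout'.trans ?_
      simp only [Finset.card_empty, Nat.cast_zero, zero_add]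
      have : (0 : ℝ) ≤ C₁ := by positivity
      nlinarith [mul_le_mul_of_nonneg_left hQ1 hW0]
    set h : ℝ := (S.card : ℝ) with hh
    have hpos : 0 < h := by rw [hh]; exact_mod_cast hne.card_pos
    have hhd : h ≤ d := by rw [hh]; exact_mod_cast hS
    have hup : ∀ w ∈ S, (N w : ℝ) ≤ Q ^ 2 / h + C₁ * Q := by
      intro w hw
      have h1 : (d : ℝ) * N w ≤ Q ^ 2 + C₁ * Q := by exact_mod_cast hin w hw
      have h2 : h * N w ≤ Q ^ 2 + C₁ * Q := le_trans (by gcongr) h1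
      have h3 : (1 : ℝ) ≤ h := by rw [hh]; exact_mod_cast hne.card_pos
      rw [div_add' _ _ _ hpos.ne', le_div_iff₀ hpos]
      have h4 : (0 : ℝ) ≤ C₁ * Q := by positivity
      nlinarith
    have hlow : ∀ w ∈ S, (Q : ℝ) ^ 2 / h - h * (C₁ * Q) - Fintype.card W * C₁ ≤ N w := by
      intro w hw
      have h1 : ∑ v ∈ S.erase w, (N v : ℝ) ≤ ∑ v ∈ S.erase w, ((Q : ℝ) ^ 2 / h + C₁ * Q) :=
        Finset.sum_le_sum fun v hv => hup v (Finset.mem_of_mem_erase hv)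
      have h2 := Finset.add_sum_erase S (fun v => (N v : ℝ)) hw
      have h3 := Finset.add_sum_erase S (fun _ => (Q : ℝ) ^ 2 / h + C₁ * Q) hw
      have h4 : ∑ v ∈ S, ((Q : ℝ) ^ 2 / h + C₁ * Q) = Q ^ 2 + h * (C₁ * Q) := by
        rw [Finset.sum_const, nsmul_eq_mul, ← hh]
        field_simp
      have h5 : (0 : ℝ) ≤ C₁ * Q := by positivity
      linarith
    have hdev : ‖∑ w ∈ S, f w * (N w : ℂ)‖ ≤ h * ((h + 1) * (C₁ * Q) + Fintype.card W * C₁) := by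
      have e : ∑ w ∈ S, f w * (N w : ℂ) = ∑ w ∈ S, f w * ((N w : ℝ) - Q ^ 2 / h : ℝ) := by
        have : ∑ w ∈ S, f w * ((N w : ℝ) - Q ^ 2 / h : ℝ) =
            ∑ w ∈ S, f w * (N w : ℂ) - (∑ w ∈ S, f w) * ((Q : ℝ) ^ 2 / h : ℝ) := by
          rw [Finset.sum_mul, ← Finset.sum_sub_distrib]
          refine Finset.sum_congr rfl fun w _ => ?_
          push_cast
          ring
        rw [this, h0, zero_mul, sub_zero]
      rw [e]
      calc _ ≤ ∑ w ∈ S, ((h + 1) * (C₁ * Q) + Fintype.card W * C₁ : ℝ) := by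
            refine norm_sum_le_of_le _ fun w hw => ?_
            rw [norm_mul, Complex.norm_real, Real.norm_eq_abs]
            have h5 : (0 : ℝ) ≤ C₁ * Q := by positivity
            have h1 : |(N w : ℝ) - Q ^ 2 / h| ≤ (h + 1) * (C₁ * Q) + Fintype.card W * C₁ := by
              rw [abs_le]
              have := hup w hw
              have := hlow w hw
              have : 0 ≤ h * (C₁ * Q) := by positivity
              constructor <;> linarith
            calc ‖f w‖ * |(N w : ℝ) - Q ^ 2 / h| ≤ 1 * |(N w : ℝ) - Q ^ 2 / h| := by
                  gcongr; exact hf w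
              _ ≤ _ := by rwa [one_mul]
        _ = _ := by rw [Finset.sum_const, nsmul_eq_mul]
    rw [hsplit]
    refine (norm_add_le _ _).trans ((add_le_add hdev hout').trans ?_)
    have e1 : (Fintype.card W : ℝ) * C₁ ≤ Fintype.card W * C₁ * Q :=
      le_mul_of_one_le_right hW0 hQ1
    have e2 : h * ((Fintype.card W : ℝ) * C₁) ≤ h * (Fintype.card W * C₁ * Q) := by gcongr
    have e3 : (0 : ℝ) ≤ C₁ * Q := by positivity
    have e4 : (0 : ℝ) ≤ h * (C₁ * Q) := by positivity
    have e5 : (0 : ℝ) ≤ Fintype.card W * C₁ * Q := by positivity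
    nlinarith
  · intro h1
    rw [hsplit, Finset.sum_congr rfl fun w hw => by rw [h1 w hw, one_mul]]
    have e : ∑ w ∈ S, (N w : ℂ) = (Q : ℂ) ^ 2 - ((∑ w ∈ Sᶜ, (N w : ℝ) : ℝ) : ℂ) := by
      rw [eq_sub_iff_add_eq]
      have := congrArg (fun r : ℝ => (r : ℂ)) htotR
      push_cast at this ⊢
      exact this
    rw [e, show ∀ a b c : ℂ, a - b + c - a = c - b by intros; ring]
    refine (norm_sub_le _ _).trans ?_
    rw [Complex.norm_real, Real.norm_of_nonneg (Finset.sum_nonneg fun _ _ => by positivity)]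
    linarith

theorem sum_monoidHom_eq_zero {W : Type*} [Monoid W] (S : Finset W) (χ : W →* ℂ) (u : W)
    (hmul : ∀ w ∈ S, u * w ∈ S) (hunit : IsUnit u) (hχ : χ u ≠ 1) :
    ∑ w ∈ S, χ w = 0 := by
  have hinj : Function.Injective (u * ·) := hunit.mul_right_injective
  have himg : S.image (u * ·) = S := by
    refine Finset.eq_of_subset_of_card_le (fun v hv => ?_) ?_
    · obtain ⟨w, hw, rfl⟩ := Finset.mem_image.1 hv
      exact hmul w hw
    · rw [Finset.card_image_of_injective _ hinj]
  have h1 : ∑ w ∈ S, χ w = χ u * ∑ w ∈ S, χ w := by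
    conv_lhs => rw [← himg, Finset.sum_image fun _ _ _ _ h => hinj h]
    simp only [map_mul, Finset.mul_sum]
  have h2 : (χ u - 1) * ∑ w ∈ S, χ w = 0 := by linear_combination -h1
  exact (mul_eq_zero.1 h2).resolve_left (sub_ne_zero.2 hχ)

end Count

section FixedPoints

variable (K L : Type*) [Field K] [Fintype K] [Field L] [Algebra K L]

theorem mem_range_algebraMap_of_pow_card {x : L} (hx : x ^ Fintype.card K = x) :
    ∃ a, algebraMap K L a = x := by
  have h1 : (X ^ Fintype.card K - X : K[X]) ≠ 0 :=
    FiniteField.X_pow_card_sub_X_ne_zero K Fintype.one_lt_card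
  have h2 : (X ^ Fintype.card K - X : K[X]).roots.map (algebraMap K L) =
      ((X ^ Fintype.card K - X : K[X]).map (algebraMap K L)).roots := by
    refine roots_map_of_injective_of_card_eq_natDegree (algebraMap K L).injective ?_
    rw [FiniteField.roots_X_pow_card_sub_X, FiniteField.X_pow_card_sub_X_natDegree_eq K
      Fintype.one_lt_card]
    simp
  have h3 : x ∈ ((X ^ Fintype.card K - X : K[X]).map (algebraMap K L)).roots := by
    rw [mem_roots ((Polynomial.map_ne_zero_iff (algebraMap K L).injective).2 h1)]
    simp [hx]
  rw [← h2, Multiset.mem_map] at h3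
  obtain ⟨a, -, ha⟩ := h3
  exact ⟨a, ha⟩

/-- The elements of `L` fixed by the `n`-th power of the Frobenius of `K`. -/
def fixedPts (n : ℕ) : Finset L := (X ^ Fintype.card K ^ n - X : L[X]).roots.toFinset

theorem mem_fixedPts {n : ℕ} (hn : n ≠ 0) {x : L} :
    x ∈ fixedPts K L n ↔ x ^ Fintype.card K ^ n = x := by
  rw [fixedPts, Multiset.mem_toFinset, mem_roots, IsRoot.def]
  · simp [sub_eq_zero]
  · exact FiniteField.X_pow_card_sub_X_ne_zero L (Nat.one_lt_pow hn Fintype.one_lt_card)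

theorem card_fixedPts [IsAlgClosed L] {n : ℕ} (hn : n ≠ 0) :
    (fixedPts K L n).card = Fintype.card K ^ n := by
  obtain ⟨p, hp⟩ := CharP.exists K
  have : CharP L p := charP_of_injective_algebraMap' K p
  have hsep : (X ^ Fintype.card K ^ n - X : L[X]).Separable :=
    galois_poly_separable p _ (by
      obtain ⟨k, _, hk⟩ := FiniteField.card K p
      rw [hk]
      exact (dvd_pow_self p k.ne_zero).trans (dvd_pow_self _ hn))
  rw [fixedPts, Multiset.toFinset_card_of_nodup (nodup_roots hsep),
    IsAlgClosed.card_roots_eq_natDegree,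
    FiniteField.X_pow_card_sub_X_natDegree_eq L (Nat.one_lt_pow hn Fintype.one_lt_card)]

end FixedPoints

section Descent

/-- A `K`-algebra `R` and its scalar extension `E` to `L`, with the Frobenius of `L` acting on
`E` through the first factor. -/
structure ScalarExt (K L R E ι : Type*) [Field K] [Fintype K] [Field L] [Algebra K L]
    [CommRing R] [Algebra K R] [CommRing E] [Algebra L E] where
  toExt : R →+* E
  frob : E →+* E
  basis : Module.Basis ι K R
  basisExt : Module.Basis ι L E
  basisExt_apply : ∀ i, basisExt i = toExt (basis i)
  toExt_algebraMap : ∀ a, toExt (algebraMap K R a) = algebraMap L E (algebraMap K L a)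
  frob_toExt : ∀ r, frob (toExt r) = toExt r
  frob_algebraMap : ∀ x, frob (algebraMap L E x) = algebraMap L E (x ^ Fintype.card K)

namespace ScalarExt

variable {K L R E ι : Type*} [Field K] [Fintype K] [Field L] [Algebra K L]
    [CommRing R] [Algebra K R] [CommRing E] [Algebra L E] [Fintype ι] (D : ScalarExt K L R E ι)

theorem repr_toExt (r : R) (i : ι) :
    D.basisExt.repr (D.toExt r) i = algebraMap K L (D.basis.repr r i) := by
  have h : D.toExt r = ∑ i, algebraMap K L (D.basis.repr r i) • D.basisExt i := by
    conv_lhs => rw [← D.basis.sum_repr r]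
    rw [map_sum]
    refine Finset.sum_congr rfl fun i _ => ?_
    rw [Algebra.smul_def, map_mul, D.toExt_algebraMap, ← D.basisExt_apply, Algebra.smul_def]
  rw [h, D.basisExt.repr_sum_self]

theorem toExt_injective : Function.Injective D.toExt := by
  intro r s h
  refine D.basis.ext_elem fun i => (algebraMap K L).injective ?_
  rw [← D.repr_toExt, ← D.repr_toExt, h]

theorem exists_of_frob_eq {e : E} (he : D.frob e = e) : ∃ r, D.toExt r = e := by
  have h1 : D.frob e = ∑ i, (D.basisExt.repr e i) ^ Fintype.card K • D.basisExt i := by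
    conv_lhs => rw [← D.basisExt.sum_repr e]
    rw [map_sum]
    refine Finset.sum_congr rfl fun i _ => ?_
    rw [Algebra.smul_def, map_mul, D.frob_algebraMap, D.basisExt_apply, D.frob_toExt,
      Algebra.smul_def]
  have h2 : ∀ i, ∃ a, algebraMap K L a = D.basisExt.repr e i := by
    intro i
    refine mem_range_algebraMap_of_pow_card K L ?_
    conv_rhs => rw [← he, h1, D.basisExt.repr_sum_self]
  choose a ha using h2
  refine ⟨∑ i, a i • D.basis i, D.basisExt.ext_elem fun i => ?_⟩
  rw [D.repr_toExt, D.basis.repr_sum_self, ha]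

/-- The product over the first `n` Frobenius conjugates of `A - x B`. -/
def conjProd (A B : R) (n : ℕ) (x : L) : E :=
  ∏ j ∈ Finset.range n, (D.toExt A - algebraMap L E (x ^ Fintype.card K ^ j) * D.toExt B)

theorem frob_conjProd (A B : R) (n : ℕ) (x : L) :
    D.frob (D.conjProd A B n x) = D.conjProd A B n (x ^ Fintype.card K) := by
  rw [conjProd, conjProd, map_prod]
  refine Finset.prod_congr rfl fun j _ => ?_
  rw [map_sub, map_mul, D.frob_toExt, D.frob_toExt, D.frob_algebraMap, ← pow_mul, ← pow_mul,
    mul_comm (Fintype.card K)]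

theorem conjProd_succ (A B : R) (n : ℕ) (x : L) :
    D.conjProd A B (n + 1) x = D.conjProd A B n (x ^ Fintype.card K) *
      (D.toExt A - algebraMap L E x * D.toExt B) := by
  rw [conjProd, conjProd, Finset.prod_range_succ', pow_zero, pow_one]
  congr 1
  refine Finset.prod_congr rfl fun j _ => ?_
  rw [← pow_mul, pow_succ']

theorem conjProd_pow_card (A B : R) (n : ℕ) {x : L} (hx : x ^ Fintype.card K ^ n = x) :
    D.conjProd A B n (x ^ Fintype.card K) = D.conjProd A B n x := by
  cases n with
  | zero => simp [conjProd]
  | succ n =>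
    rw [D.conjProd_succ A B n x, conjProd, Finset.prod_range_succ, ← pow_mul, ← pow_succ', hx]
    congr 1

theorem exists_toExt_eq_conjProd (A B : R) (n : ℕ) {x : L} (hx : x ^ Fintype.card K ^ n = x) :
    ∃ r, D.toExt r = D.conjProd A B n x :=
  D.exists_of_frob_eq (by rw [frob_conjProd, conjProd_pow_card _ _ _ _ hx])

/-- The element of `R` descending `conjProd A B n x`. -/
def value (A B : R) (n : ℕ) (x : L) : R :=
  if h : ∃ r, D.toExt r = D.conjProd A B n x then h.choose else 0

theorem toExt_value (A B : R) (n : ℕ) {x : L} (hx : x ^ Fintype.card K ^ n = x) :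
    D.toExt (D.value A B n x) = D.conjProd A B n x := by
  have h := D.exists_toExt_eq_conjProd A B n hx
  rw [value, dif_pos h]
  exact h.choose_spec

theorem leftMulMatrix_toExt (r : R) :
    Algebra.leftMulMatrix D.basisExt (D.toExt r) =
      (Algebra.leftMulMatrix D.basis r).map (algebraMap K L) := by
  ext i k
  rw [Matrix.map_apply, Algebra.leftMulMatrix_eq_repr_mul, Algebra.leftMulMatrix_eq_repr_mul,
    D.basisExt_apply, ← map_mul, D.repr_toExt]

theorem leftMulMatrix_conjProd (c : R) (n : ℕ) (x : L) :
    Algebra.leftMulMatrix D.basisExt (D.conjProd 1 c n x) =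
      (frobStep (Algebra.leftMulMatrix D.basis c) n).map (aeval x) := by
  induction n generalizing x with
  | zero => simp [conjProd, frobStep, Matrix.map_one]
  | succ n ih =>
    have h1 : ∀ f : K[X], aeval x (FiniteField.frobeniusAlgHom K K[X] f) =
        aeval (x ^ Fintype.card K) f := by
      intro f
      have : FiniteField.frobeniusAlgHom K K[X] f = f ^ Fintype.card K := rfl
      rw [this, ← FiniteField.expand_card, expand_aeval]
    have h2 : ((FiniteField.frobeniusAlgHom K K[X]).mapMatrix
        (frobStep (Algebra.leftMulMatrix D.basis c) n)).map (aeval x) =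
        (frobStep (Algebra.leftMulMatrix D.basis c) n).map (aeval (x ^ Fintype.card K)) := by
      ext i k
      simp only [AlgHom.mapMatrix_apply, Matrix.map_apply]
      exact h1 _
    rw [conjProd_succ, map_mul, ih, frobStep, Matrix.map_mul, h2]
    congr 1
    ext i k
    rw [map_sub, map_one, map_one, map_mul, AlgHom.commutes, D.leftMulMatrix_toExt]
    simp only [Matrix.sub_apply, Matrix.map_apply, Matrix.smul_apply, map_sub, smul_eq_mul,
      map_mul, aeval_X, aeval_C, Algebra.algebraMap_eq_smul_one, smul_mul_assoc, one_mul]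
    congr 1
    by_cases h : i = k <;> simp [Matrix.one_apply, h]

theorem value_eq_iff (c : R) (n : ℕ) {x : L} (hx : x ^ Fintype.card K ^ n = x) (w : R) :
    D.value 1 c n x = w ↔ ∀ i k, aeval x (frobStep (Algebra.leftMulMatrix D.basis c) n i k -
      C (Algebra.leftMulMatrix D.basis w i k)) = 0 := by
  rw [← D.toExt_injective.eq_iff, D.toExt_value _ _ _ hx,
    ← (Algebra.leftMulMatrix_injective D.basisExt).eq_iff, D.leftMulMatrix_conjProd,
    D.leftMulMatrix_toExt, ← Matrix.ext_iff]
  simp [sub_eq_zero]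

theorem card_filter_value_le (c : R) {n : ℕ} (hn : n ≠ 0) (w : R) :
    ∃ P : K[X], P ∣ X ^ (Fintype.card K ^ n) - X ∧
      (∀ i k, P ∣ frobStep (Algebra.leftMulMatrix D.basis c) n i k -
        C (Algebra.leftMulMatrix D.basis w i k)) ∧
      ((fixedPts K L n).filter fun x => D.value 1 c n x = w).card ≤ P.natDegree := by
  set I : Ideal K[X] := Ideal.span (insert (X ^ (Fintype.card K ^ n) - X)
    (Set.range fun ik : ι × ι => frobStep (Algebra.leftMulMatrix D.basis c) n ik.1 ik.2 -
        C (Algebra.leftMulMatrix D.basis w ik.1 ik.2))) with hI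
  obtain ⟨P, hP⟩ := (IsPrincipalIdealRing.principal I).principal
  have hdvd : ∀ f ∈ I, P ∣ f := fun f hf => by
    rw [hP] at hf
    exact Ideal.mem_span_singleton.1 hf
  have hPX : P ∣ X ^ (Fintype.card K ^ n) - X :=
    hdvd _ (Ideal.subset_span (Set.mem_insert _ _))
  have hP0 : P ≠ 0 := by
    rintro rfl
    exact FiniteField.X_pow_card_sub_X_ne_zero K (Nat.one_lt_pow hn Fintype.one_lt_card)
      (zero_dvd_iff.1 hPX)
  refine ⟨P, hPX, fun i k => hdvd _ (Ideal.subset_span (Set.mem_insert_of_mem _ ⟨(i, k), rfl⟩)), ?_⟩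
  have hsub : ((fixedPts K L n).filter fun x => D.value 1 c n x = w) ⊆
      (P.map (algebraMap K L)).roots.toFinset := by
    intro x hx
    rw [Finset.mem_filter, mem_fixedPts K L hn] at hx
    rw [Multiset.mem_toFinset,
      mem_roots ((Polynomial.map_ne_zero_iff (algebraMap K L).injective).2 hP0), IsRoot.def,
      ← eval₂_eq_eval_map, ← aeval_def]
    have hker : I ≤ RingHom.ker (aeval x : K[X] →ₐ[K] L) := by
      rw [hI, Ideal.span_le]
      rintro f (rfl | ⟨ik, rfl⟩)
      · exact (RingHom.mem_ker).2 (by simp [hx.1])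
      · exact (D.value_eq_iff c n hx.1 w).1 hx.2 ik.1 ik.2
    exact hker (hP ▸ Ideal.mem_span_singleton_self P)
  calc _ ≤ (P.map (algebraMap K L)).roots.toFinset.card := Finset.card_le_card hsub
    _ ≤ (P.map (algebraMap K L)).roots.card := Multiset.toFinset_card_le _
    _ ≤ (P.map (algebraMap K L)).natDegree := card_roots' _
    _ ≤ P.natDegree := natDegree_map_le

theorem sum_value_dichotomy [IsAlgClosed L] [Finite R] (c : R) (χ : R →* ℂ)
    (hχ : ∀ w, ‖χ w‖ ≤ 1) : ∃ B : ℝ,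
    (∀ m ≠ 0, ‖∑ x ∈ fixedPts K L (2 * m), χ (D.value 1 c (2 * m) x)‖ ≤
      B * (Fintype.card K : ℝ) ^ m) ∨
    (∀ m ≠ 0, ‖∑ x ∈ fixedPts K L (2 * m), χ (D.value 1 c (2 * m) x) -
      (Fintype.card K : ℂ) ^ (2 * m)‖ ≤ B) := by
  have := Fintype.ofFinite R
  set M := Algebra.leftMulMatrix D.basis c
  obtain ⟨d, C₁, -, hcard, hout, hin⟩ := exists_bounds M
  set S : Finset R := Finset.univ.filter fun w => Algebra.leftMulMatrix D.basis w ∈ symmetries M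
  have hmemS : ∀ w, w ∈ S ↔ Algebra.leftMulMatrix D.basis w ∈ symmetries M := by simp [S]
  have hS : S.card ≤ d := by
    refine le_trans ?_ hcard
    rw [Nat.card_eq_fintype_card, ← Finset.card_univ]
    refine Finset.card_le_card_of_injOn
      (fun w => if h : Algebra.leftMulMatrix D.basis w ∈ symmetries M then ⟨_, h⟩ else 1)
      (fun _ _ => Finset.mem_univ _) ?_
    intro v hv w hw hvw
    have hv' := (hmemS v).1 hv
    have hw' := (hmemS w).1 hw
    simp only [hv', hw', dif_pos] at hvw
    exact Algebra.leftMulMatrix_injective D.basis (Subtype.ext_iff.1 hvw)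
  have key : ∀ m ≠ 0, _ := fun (m : ℕ) hm => norm_sum_le_of_counts S hS
    (fun w => ((fixedPts K L (2 * m)).filter fun x => D.value 1 c (2 * m) x = w).card)
    (Q := Fintype.card K ^ m) (by positivity)
    (by
      rw [← pow_mul, mul_comm m, ← card_fixedPts K L (n := 2 * m) (by omega)]
      exact (Finset.card_eq_sum_card_fiberwise fun _ _ => Finset.mem_coe.2 (Finset.mem_univ _)).symm)
    (fun w hw => by
      obtain ⟨P, h1, h2, h3⟩ := D.card_filter_value_le (L := L) c (n := 2 * m) (by omega) w
      exact h3.trans (hout _ P _ h1 h2 (fun h => hw ((hmemS w).2 h))))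
    (fun w hw => by
      obtain ⟨P, h1, h2, h3⟩ := D.card_filter_value_le (L := L) c (n := 2 * m) (by omega) w
      refine (Nat.mul_le_mul_left d h3).trans ?_
      rw [← pow_mul, mul_comm m]
      exact hin m P _ hm h1 h2 ((hmemS w).1 hw)) χ hχ
  have hsum : ∀ m, ∑ w, χ w *
      (((fixedPts K L (2 * m)).filter fun x => D.value 1 c (2 * m) x = w).card : ℂ) =
      ∑ x ∈ fixedPts K L (2 * m), χ (D.value 1 c (2 * m) x) := by
    intro m
    rw [← Finset.sum_fiberwise_of_maps_to (s := fixedPts K L (2 * m))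
      (t := Finset.univ) (g := D.value 1 c (2 * m)) (fun _ _ => Finset.mem_univ _)]
    refine Finset.sum_congr rfl fun w _ => ?_
    rw [Finset.sum_congr rfl fun x hx => by rw [(Finset.mem_filter.1 hx).2], Finset.sum_const,
      nsmul_eq_mul, mul_comm]
  by_cases htriv : ∀ w ∈ S, χ w = 1
  · refine ⟨2 * Fintype.card R * C₁, Or.inr fun m hm => ?_⟩
    have := (key m hm).2 htriv
    rw [hsum] at this
    push_cast at this
    rwa [← pow_mul, mul_comm m] at this
  · push Not at htriv
    obtain ⟨u, hu, hχu⟩ := htriv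
    have hunit : IsUnit u := by
      have h1 := det_ne_zero_of_mem_symmetries M ((hmemS u).1 hu)
      have h2 : Function.Injective (u * ·) := by
        refine (injective_iff_map_eq_zero (AddMonoidHom.mulLeft u)).2 ?_
        intro v hv
        have h3 : Algebra.leftMulMatrix D.basis u * Algebra.leftMulMatrix D.basis v = 0 := by
          rw [← map_mul, show u * v = 0 from hv, map_zero]
        have h4 : Algebra.leftMulMatrix D.basis v = 0 := by
          have := (Matrix.isUnit_iff_isUnit_det _).2 (isUnit_iff_ne_zero.2 h1)
          exact this.mul_right_eq_zero.1 h3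
        exact Algebra.leftMulMatrix_injective D.basis (h4.trans (map_zero _).symm)
      obtain ⟨v, hv⟩ := (Finite.injective_iff_surjective.1 h2) 1
      exact IsUnit.of_mul_eq_one v hv
    have h0 := sum_monoidHom_eq_zero S χ u (fun w hw => by
      rw [hmemS, map_mul]
      exact mul_mem ((hmemS u).1 hu) ((hmemS w).1 hw)) hunit hχu
    refine ⟨(S.card + 2) * (S.card + Fintype.card R + 2) * C₁, Or.inl fun m hm => ?_⟩
    have := (key m hm).1 h0
    rw [hsum] at this
    push_cast at this
    exact this

end ScalarExt

end Descent

section BaseChange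

open scoped TensorProduct

variable {F L R ι : Type*} [Field F] [Fintype F] [Field L] [Algebra F L] [CommRing R] [Algebra F R]

/-- The scalar extension of an `F`-algebra to `L`. -/
def ScalarExt.base (b : Module.Basis ι F R) : ScalarExt F L R (L ⊗[F] R) ι where
  toExt := (Algebra.TensorProduct.includeRight : R →ₐ[F] L ⊗[F] R).toRingHom
  frob := (Algebra.TensorProduct.map (FiniteField.frobeniusAlgHom F L)
    (AlgHom.id F R)).toRingHom
  basis := b
  basisExt := Algebra.TensorProduct.basis L b
  basisExt_apply i := Algebra.TensorProduct.basis_apply b i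
  toExt_algebraMap a := by
    rw [Algebra.TensorProduct.algebraMap_apply]
    simp [Algebra.algebraMap_eq_smul_one, TensorProduct.smul_tmul]
  frob_toExt r := by simp
  frob_algebraMap x := by
    rw [Algebra.TensorProduct.algebraMap_apply, Algebra.TensorProduct.algebraMap_apply]
    simp

/-- The scalar extension of `K ⊗ R` to `L`, for an intermediate field `K`. -/
def ScalarExt.intermediate (K : Type*) [Field K] [Fintype K] [Algebra F K] [Algebra K L]
    [IsScalarTower F K L] (b : Module.Basis ι F R) :
    ScalarExt K L (K ⊗[F] R) (L ⊗[F] R) ι where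
  toExt := (Algebra.TensorProduct.map (IsScalarTower.toAlgHom F K L) (AlgHom.id F R)).toRingHom
  frob := (Algebra.TensorProduct.map ((FiniteField.frobeniusAlgHom K L).restrictScalars F)
    (AlgHom.id F R)).toRingHom
  basis := Algebra.TensorProduct.basis K b
  basisExt := Algebra.TensorProduct.basis L b
  basisExt_apply i := by
    rw [Algebra.TensorProduct.basis_apply, Algebra.TensorProduct.basis_apply]
    simp
  toExt_algebraMap a := by
    rw [Algebra.TensorProduct.algebraMap_apply, Algebra.TensorProduct.algebraMap_apply]
    simp
  frob_toExt r := by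
    have : ((Algebra.TensorProduct.map ((FiniteField.frobeniusAlgHom K L).restrictScalars F)
        (AlgHom.id F R)).comp
          (Algebra.TensorProduct.map (IsScalarTower.toAlgHom F K L) (AlgHom.id F R))) =
        (Algebra.TensorProduct.map (IsScalarTower.toAlgHom F K L) (AlgHom.id F R)) := by
      ext x
      · simp
      · simp
    exact DFunLike.congr_fun this r
  frob_algebraMap x := by
    rw [Algebra.TensorProduct.algebraMap_apply, Algebra.TensorProduct.algebraMap_apply]
    simp

theorem ScalarExt.conjProd_eq_of_isUnit {K E : Type*} [Field K] [Fintype K] [Algebra K L]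
    [CommRing E] [Algebra L E] [Algebra K R] (D : ScalarExt K L R E ι) (A B : R) (a : K) {c : R}
    (hc : (A - algebraMap K R a * B) * c = B) (n : ℕ) (x : L) :
    D.conjProd A B n x = D.toExt ((A - algebraMap K R a * B) ^ n) *
      D.conjProd 1 c n (x - algebraMap K L a) := by
  obtain ⟨p, hp⟩ := CharP.exists K
  have : CharP L p := charP_of_injective_algebraMap' K p
  obtain ⟨k, hpr, hk⟩ := FiniteField.card K p
  have : Fact p.Prime := ⟨hpr⟩
  set u := A - algebraMap K R a * B
  have hpow : D.toExt u ^ n = ∏ _j ∈ Finset.range n, D.toExt u := by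
    rw [Finset.prod_const, Finset.card_range]
  rw [ScalarExt.conjProd, ScalarExt.conjProd, map_pow, hpow, ← Finset.prod_mul_distrib]
  refine Finset.prod_congr rfl fun j _ => ?_
  have h1 : (x - algebraMap K L a) ^ Fintype.card K ^ j =
      x ^ Fintype.card K ^ j - algebraMap K L a := by
    conv_rhs => rw [← FiniteField.pow_card_pow j a, map_pow]
    rw [hk, ← pow_mul, sub_pow_char_pow]
  have h2 : D.toExt u = D.toExt A - algebraMap L E (algebraMap K L a) * D.toExt B := by
    rw [map_sub, map_mul, D.toExt_algebraMap]
  have h3 : D.toExt B = D.toExt u * D.toExt c := by rw [← map_mul, hc]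
  rw [h1]
  simp only [map_sub, map_one]
  linear_combination -(algebraMap L E (x ^ Fintype.card K ^ j) -
    algebraMap L E (algebraMap K L a)) * h3 - h2

theorem prod_range_mul_eq {M : Type*} [CommMonoid M] (f : ℕ → M) (b n : ℕ) :
    ∏ k ∈ Finset.range (b * n), f k =
      ∏ i ∈ Finset.range b, ∏ j ∈ Finset.range n, f (b * j + i) := by
  induction n with
  | zero => simp
  | succ n ih =>
    rw [mul_add_one, Finset.prod_range_add, ih, ← Finset.prod_mul_distrib]
    exact Finset.prod_congr rfl fun i _ => (Finset.prod_range_succ _ _).symm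

variable [Fintype ι] (K : Type*) [Field K] [Fintype K] [Algebra F K] [Algebra K L]
    [IsScalarTower F K L] (b : Module.Basis ι F R)

theorem frob_iterate_eq :
    ⇑(ScalarExt.intermediate (L := L) K b).frob =
      (ScalarExt.base (L := L) b).frob^[Module.finrank F K] := by
  have hcard : Fintype.card K = Fintype.card F ^ Module.finrank F K :=
    Module.card_eq_pow_finrank
  have h1 : ∀ k : ℕ, ∀ (x : L) (r : R), (ScalarExt.base (L := L) b).frob^[k] (x ⊗ₜ r) =
      (x ^ Fintype.card F ^ k) ⊗ₜ r := by
    intro k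
    induction k with
    | zero => simp
    | succ k ih =>
      intro x r
      rw [Function.iterate_succ_apply', ih]
      simp [ScalarExt.base, ← pow_mul, pow_succ]
  have h2 : (ScalarExt.intermediate (L := L) K b).frob =
      (ScalarExt.base (L := L) b).frob ^ Module.finrank F K := by
    refine RingHom.ext fun e => ?_
    induction e using TensorProduct.induction_on with
    | zero => simp
    | add x y hx hy => rw [map_add, map_add, hx, hy]
    | tmul x r =>
      rw [RingHom.coe_pow, h1, ← hcard]
      simp [ScalarExt.intermediate]
  rw [h2, RingHom.coe_pow]

/-- The product of the conjugates of an element of `K ⊗ R`, computed in `L ⊗ R`. -/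
def extNorm : K ⊗[F] R →* L ⊗[F] R where
  toFun w := ∏ i ∈ Finset.range (Module.finrank F K),
    (ScalarExt.base (L := L) b).frob^[i] ((ScalarExt.intermediate (L := L) K b).toExt w)
  map_one' := by simp
  map_mul' v w := by
    rw [← Finset.prod_mul_distrib]
    exact Finset.prod_congr rfl fun i _ => by rw [map_mul, iterate_map_mul]

theorem frob_extNorm (w : K ⊗[F] R) :
    (ScalarExt.base (L := L) b).frob (extNorm K b w) = extNorm (L := L) K b w := by
  have h0 := congrFun (frob_iterate_eq (L := L) K b)
    ((ScalarExt.intermediate (L := L) K b).toExt w)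
  rw [ScalarExt.frob_toExt] at h0
  simp only [extNorm, MonoidHom.coe_mk, OneHom.coe_mk, map_prod, ← Function.iterate_succ_apply']
  cases hn : Module.finrank F K with
  | zero => simp
  | succ n =>
    rw [Finset.prod_range_succ, Finset.prod_range_succ', Function.iterate_zero_apply,
      Nat.succ_eq_add_one, ← hn, ← h0]

theorem exists_toExt_eq_extNorm (w : K ⊗[F] R) :
    ∃ r, (ScalarExt.base (L := L) b).toExt r = extNorm K b w :=
  (ScalarExt.base (L := L) b).exists_of_frob_eq (frob_extNorm K b w)

/-- The norm from `K ⊗ R` to `R`. -/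
def descNorm : K ⊗[F] R →* R where
  toFun w := (exists_toExt_eq_extNorm (L := L) K b w).choose
  map_one' := (ScalarExt.base (L := L) b).toExt_injective <| by
    rw [(exists_toExt_eq_extNorm (L := L) K b _).choose_spec, map_one, map_one]
  map_mul' v w := (ScalarExt.base (L := L) b).toExt_injective <| by
    rw [(exists_toExt_eq_extNorm (L := L) K b _).choose_spec, map_mul, map_mul,
      (exists_toExt_eq_extNorm (L := L) K b _).choose_spec,
      (exists_toExt_eq_extNorm (L := L) K b _).choose_spec]

theorem toExt_descNorm (w : K ⊗[F] R) :
    (ScalarExt.base (L := L) b).toExt (descNorm (L := L) K b w) = extNorm K b w :=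
  (exists_toExt_eq_extNorm (L := L) K b w).choose_spec

theorem extNorm_eq_conjProd {A B : R} {w : K ⊗[F] R} {n : ℕ} {x : L}
    (hw : (ScalarExt.intermediate (L := L) K b).toExt w =
      (ScalarExt.intermediate (L := L) K b).conjProd (1 ⊗ₜ A) (1 ⊗ₜ B) n x) :
    extNorm K b w = (ScalarExt.base (L := L) b).conjProd A B (Module.finrank F K * n) x := by
  have hcard : Fintype.card K = Fintype.card F ^ Module.finrank F K :=
    Module.card_eq_pow_finrank
  have hJ : ∀ r : R, (ScalarExt.intermediate (L := L) K b).toExt (1 ⊗ₜ r) =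
      (ScalarExt.base (L := L) b).toExt r := fun r => by
    simp [ScalarExt.intermediate, ScalarExt.base]
  have hfr : ∀ (i : ℕ) (x : L) (A B : R), (ScalarExt.base (L := L) b).frob^[i]
      ((ScalarExt.base (L := L) b).toExt A - algebraMap L _ x *
        (ScalarExt.base (L := L) b).toExt B) = (ScalarExt.base (L := L) b).toExt A -
        algebraMap L _ (x ^ Fintype.card F ^ i) * (ScalarExt.base (L := L) b).toExt B := by
    intro i x A B
    induction i with
    | zero => simp
    | succ i ih =>
      rw [Function.iterate_succ_apply', ih, map_sub, map_mul, ScalarExt.frob_toExt,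
        ScalarExt.frob_toExt, ScalarExt.frob_algebraMap, ← pow_mul, ← pow_succ]
  rw [ScalarExt.conjProd, prod_range_mul_eq]
  simp only [extNorm, MonoidHom.coe_mk, OneHom.coe_mk, hw]
  refine Finset.prod_congr rfl fun i _ => ?_
  rw [ScalarExt.conjProd, ← RingHom.coe_pow, map_prod]
  refine Finset.prod_congr rfl fun j _ => ?_
  rw [RingHom.coe_pow, hJ, hJ, hfr, hcard, ← pow_mul, ← pow_mul, ← pow_add]

theorem isUnit_of_isUnit_toExt {K E : Type*} [Field K] [Fintype K] [Algebra K L]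
    [CommRing E] [Algebra L E] [Algebra K R] [Finite R] (D : ScalarExt K L R E ι) {r : R}
    (hr : IsUnit (D.toExt r)) : IsUnit r := by
  have h2 : Function.Injective (r * ·) := by
    intro v w hvw
    refine D.toExt_injective (hr.mul_left_cancel ?_)
    rw [← map_mul, ← map_mul]
    exact congrArg _ hvw
  obtain ⟨v, hv⟩ := (Finite.injective_iff_surjective.1 h2) 1
  exact IsUnit.of_mul_eq_one v hv

variable {K}

theorem sum_value_base_dichotomy [IsAlgClosed L] [Algebra.IsAlgebraic F L] [Finite R]
    (b : Module.Basis ι F R) (A B : R) {n : ℕ} (hn : n ≠ 0) {a : L}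
    (ha : a ^ Fintype.card F ^ n = a)
    (hunit : IsUnit ((ScalarExt.base (L := L) b).value A B n a)) (χ : R →* ℂ)
    (hχ : ∀ w, ‖χ w‖ ≤ 1) : ∃ e : ℕ, 0 < e ∧ ∃ C : ℝ,
    (∀ m ≠ 0, ‖∑ x ∈ fixedPts F L (e * (2 * m)),
      χ ((ScalarExt.base (L := L) b).value A B (e * (2 * m)) x)‖ ≤
        C * (Fintype.card F : ℝ) ^ (e * m)) ∨
    ∃ z : ℂ, ‖z‖ = 1 ∧ ∀ m ≠ 0, ‖∑ x ∈ fixedPts F L (e * (2 * m)),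
      χ ((ScalarExt.base (L := L) b).value A B (e * (2 * m)) x) -
        z ^ m * (Fintype.card F : ℂ) ^ (e * (2 * m))‖ ≤ C := by
  set D := ScalarExt.base (L := L) b
  let K := IntermediateField.adjoin F {a}
  have hfin : FiniteDimensional F K :=
    IntermediateField.adjoin.finiteDimensional (Algebra.IsIntegral.isIntegral a)
  have : Finite K := Module.finite_of_finite F
  have := Fintype.ofFinite K
  set D' := ScalarExt.intermediate (L := L) K b
  set e := Module.finrank F K
  have hcard : Fintype.card K = Fintype.card F ^ e := Module.card_eq_pow_finrank
  have hfix : ∀ k, fixedPts F L (e * k) = fixedPts K L k := by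
    intro k
    rw [fixedPts, fixedPts, hcard, ← pow_mul]
  have hfinKR : Finite (K ⊗[F] R) := by
    have : Module.Finite F R := Module.Finite.of_basis b
    exact Module.finite_of_finite F
  set α : K := IntermediateField.AdjoinSimple.gen F a
  have hα : algebraMap K L α = a := IntermediateField.AdjoinSimple.algebraMap_gen F a
  let αR : K ⊗[F] R := @algebraMap K (K ⊗[F] R) _ Algebra.TensorProduct.instCommRing.toSemiring
    Algebra.TensorProduct.leftAlgebra α
  set u : K ⊗[F] R := (1 : K) ⊗ₜ[F] A - αR * (1 : K) ⊗ₜ[F] B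
  have hu : IsUnit u := by
    refine isUnit_of_isUnit_toExt D' ?_
    have h1 := hunit.map D.toExt
    rw [D.toExt_value _ _ _ ha, ScalarExt.conjProd, IsUnit.prod_iff] at h1
    have h2 := h1 0 (Finset.mem_range.2 (Nat.pos_of_ne_zero hn))
    rw [pow_zero, pow_one] at h2
    have hJ : ∀ r : R, D'.toExt ((1 : K) ⊗ₜ[F] r) = D.toExt r := fun r => by
      simp [D', D, ScalarExt.intermediate, ScalarExt.base]
    have h3 : D'.toExt u = D.toExt A - algebraMap L (L ⊗[F] R) a * D.toExt B := by
      rw [map_sub, map_mul, D'.toExt_algebraMap, hα, hJ, hJ]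
    rw [h3]
    exact h2
  obtain ⟨v, hv⟩ := hu.exists_right_inv
  set c : K ⊗[F] R := v * (1 : K) ⊗ₜ[F] B
  have hc : u * c = (1 : K) ⊗ₜ[F] B := by rw [← mul_assoc, hv, one_mul]
  set χ' : K ⊗[F] R →* ℂ := χ.comp (descNorm (L := L) K b)
  have hval : ∀ k ≠ 0, ∀ x ∈ fixedPts K L k,
      χ (D.value A B (e * k) x) = χ' u ^ k * χ' (D'.value 1 c k (x - a)) := by
    intro k hk x hx
    have hx' := (mem_fixedPts K L hk).1 hx
    have hxF : x ^ Fintype.card F ^ (e * k) = x := by rwa [hcard, ← pow_mul] at hx'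
    have hxa : (x - a) ^ Fintype.card K ^ k = x - a := by
      obtain ⟨p, hp⟩ := CharP.exists K
      have : CharP L p := charP_of_injective_algebraMap' K p
      obtain ⟨i, hpr, hi⟩ := FiniteField.card K p
      have : Fact p.Prime := ⟨hpr⟩
      have h1 : a ^ Fintype.card K ^ k = a := by rw [← hα, ← map_pow, FiniteField.pow_card_pow]
      rw [hi, ← pow_mul] at h1 hx' ⊢
      rw [sub_pow_char_pow, h1, hx']
    have h1 : D'.toExt (u ^ k * D'.value 1 c k (x - a)) = D'.conjProd (1 ⊗ₜ A) (1 ⊗ₜ B) k x := by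
      rw [map_mul, D'.toExt_value _ _ _ hxa, ScalarExt.conjProd_eq_of_isUnit D' _ _ α hc, hα]
    have h2 : D.value A B (e * k) x = descNorm (L := L) K b (u ^ k * D'.value 1 c k (x - a)) := by
      refine D.toExt_injective ?_
      rw [D.toExt_value _ _ _ hxF, toExt_descNorm, extNorm_eq_conjProd K b h1]
    rw [h2, map_mul, map_mul, map_pow, map_pow]
    rfl
  have hsum : ∀ k ≠ 0, ∑ x ∈ fixedPts F L (e * k), χ (D.value A B (e * k) x) =
      χ' u ^ k * ∑ x ∈ fixedPts K L k, χ' (D'.value 1 c k x) := by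
    intro k hk
    have hshift : ∀ x y : L, x ^ Fintype.card K ^ k = x → y ^ Fintype.card K ^ k = y →
        (x - y) ^ Fintype.card K ^ k = x - y := by
      obtain ⟨p, hp⟩ := CharP.exists K
      have : CharP L p := charP_of_injective_algebraMap' K p
      obtain ⟨i, hpr, hi⟩ := FiniteField.card K p
      have : Fact p.Prime := ⟨hpr⟩
      intro x y hx hy
      rw [hi, ← pow_mul] at hx hy ⊢
      rw [sub_pow_char_pow, hx, hy]
    have ha' : a ^ Fintype.card K ^ k = a := by rw [← hα, ← map_pow, FiniteField.pow_card_pow]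
    have hna : (-a) ^ Fintype.card K ^ k = -a := by
      rw [← hα, ← map_neg, ← map_pow, FiniteField.pow_card_pow]
    rw [hfix, Finset.sum_congr rfl (hval k hk), ← Finset.mul_sum]
    congr 1
    refine Finset.sum_nbij' (· - a) (· + a) ?_ ?_ ?_ ?_ ?_
    · intro x hx
      rw [mem_fixedPts K L hk] at hx ⊢
      exact hshift _ _ hx ha'
    · intro x hx
      rw [mem_fixedPts K L hk] at hx ⊢
      have := hshift _ _ hx hna
      rwa [sub_neg_eq_add] at this
    · intro x _; simp
    · intro x _; simp
    · intro x _; rfl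
  have hχ' : ∀ w, ‖χ' w‖ ≤ 1 := fun w => hχ _
  have hχu : ‖χ' u‖ = 1 := by
    refine le_antisymm (hχ' u) ?_
    have h1 : ‖χ' u‖ * ‖χ' v‖ = 1 := by rw [← norm_mul, ← map_mul, hv, map_one, norm_one]
    nlinarith [hχ' v, norm_nonneg (χ' u)]
  refine ⟨e, Module.finrank_pos, ?_⟩
  obtain ⟨C, h | h⟩ := D'.sum_value_dichotomy c χ' hχ'
  · refine ⟨C, Or.inl fun m hm => ?_⟩
    rw [hsum _ (by omega), norm_mul, norm_pow, hχu, one_pow, one_mul, pow_mul]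
    have := h m hm
    rw [hcard] at this
    exact_mod_cast this
  · refine ⟨C, Or.inr ⟨χ' u ^ 2, by rw [norm_pow, hχu, one_pow], fun m hm => ?_⟩⟩
    rw [hsum _ (by omega), pow_mul (χ' u), pow_mul _ e, ← mul_sub, norm_mul, norm_pow, norm_pow,
      hχu, one_pow, one_pow, one_mul]
    have := h m hm
    rw [hcard] at this
    exact_mod_cast this

end BaseChange

section Counting

variable (F : Type*) [Field F] [Fintype F]

/-- The polynomials of degree less than `n`. -/
def polysLT (n : ℕ) : Finset F[X] :=
  (Set.toFinite (Set.range fun v : Fin n → F => ((degreeLTEquiv F n).symm v : F[X]))).toFinset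

variable {F}

@[simp] theorem mem_polysLT {n : ℕ} {f : F[X]} : f ∈ polysLT F n ↔ f.degree < n := by
  rw [polysLT, Set.Finite.mem_toFinset, Set.mem_range, ← mem_degreeLT]
  constructor
  · rintro ⟨v, rfl⟩
    exact Subtype.coe_prop _
  · intro h
    exact ⟨degreeLTEquiv F n ⟨f, h⟩, by simp⟩

theorem card_polysLT (n : ℕ) : (polysLT F n).card = Fintype.card F ^ n := by
  have : polysLT F n = Finset.univ.image
      (fun v : Fin n → F => ((degreeLTEquiv F n).symm v : F[X])) := by
    ext f
    simp [polysLT]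
  rw [this, Finset.card_image_of_injective]
  · simp
  · exact Subtype.val_injective.comp (degreeLTEquiv F n).symm.injective

variable (F)

/-- The monic polynomials of degree `n`. -/
def monics (n : ℕ) : Finset F[X] :=
  (polysLT F (n + 1)).filter fun f => f.Monic ∧ f.natDegree = n

/-- The monic irreducible polynomials of degree at most `n`. -/
def primesLE (n : ℕ) : Finset F[X] :=
  (polysLT F (n + 1)).filter fun f => f.Monic ∧ Irreducible f

variable {F}

@[simp] theorem mem_monics {n : ℕ} {f : F[X]} :
    f ∈ monics F n ↔ f.Monic ∧ f.natDegree = n := by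
  rw [monics, Finset.mem_filter, mem_polysLT, and_iff_right_iff_imp]
  rintro ⟨h, rfl⟩
  exact degree_le_natDegree.trans_lt (by exact_mod_cast Nat.lt_succ_self _)

theorem degree_lt_succ_iff {n : ℕ} {f : F[X]} :
    f.degree < ((n + 1 : ℕ) : WithBot ℕ) ↔ f.natDegree ≤ n := by
  rw [natDegree_le_iff_degree_le, Nat.cast_succ, ← Nat.cast_succ, degree_lt_iff_coeff_zero,
    degree_le_iff_coeff_zero]
  simp only [Nat.cast_lt, Nat.succ_le_iff]

@[simp] theorem mem_primesLE {n : ℕ} {f : F[X]} :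
    f ∈ primesLE F n ↔ f.Monic ∧ Irreducible f ∧ f.natDegree ≤ n := by
  rw [primesLE, Finset.mem_filter, mem_polysLT, degree_lt_succ_iff]
  tauto

variable {L : Type*} [Field L] [Algebra F L] [IsAlgClosed L]

theorem isIntegral_of_pow {n : ℕ} (hn : n ≠ 0) {x : L} (hx : x ^ Fintype.card F ^ n = x) :
    IsIntegral F x := by
  refine ⟨X ^ Fintype.card F ^ n - X, ?_, ?_⟩
  · refine monic_X_pow_sub ?_
    rw [degree_X]
    exact_mod_cast Nat.one_lt_pow hn Fintype.one_lt_card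
  · simp [hx]

theorem minpoly_natDegree_dvd {n : ℕ} {x : L} (hx : x ^ Fintype.card F ^ n = x) :
    (minpoly F x).natDegree ∣ n := by
  rcases eq_or_ne n 0 with rfl | hn
  · simp
  refine (minpoly.irreducible (isIntegral_of_pow hn hx)).natDegree_dvd_of_dvd_X_pow_card_pow_sub_X ?_
  apply minpoly.dvd
  simp [hx]

theorem pow_card_of_minpoly_natDegree_dvd {n : ℕ} {x : L} (hi : IsIntegral F x)
    (h : (minpoly F x).natDegree ∣ n) : x ^ Fintype.card F ^ n = x := by
  have h1 := (minpoly.irreducible hi).natDegree_dvd_iff_dvd_X_pow_card_pow_sub_X.1 h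
  have h2 := (minpoly.dvd_iff.1 (dvd_refl (minpoly F x)))
  have h3 := aeval_eq_zero_of_dvd_aeval_eq_zero h1 h2
  simpa [sub_eq_zero] using h3

theorem card_filter_minpoly_eq {n : ℕ} (hn : n ≠ 0) {P : F[X]} (hm : P.Monic) (hP : Irreducible P)
    (hd : P.natDegree ∣ n) :
    ((fixedPts F L n).filter fun x => minpoly F x = P).card = P.natDegree := by
  have h1 : ((fixedPts F L n).filter fun x => minpoly F x = P) =
      (P.rootSet L).toFinset := by
    ext x
    rw [Finset.mem_filter, mem_fixedPts F L hn, Set.mem_toFinset, mem_rootSet_of_ne hP.ne_zero]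
    constructor
    · rintro ⟨-, rfl⟩
      exact minpoly.aeval F x
    · intro hx
      have := minpoly.eq_of_irreducible_of_monic hP hx hm
      refine ⟨pow_card_of_minpoly_natDegree_dvd ⟨P, hm, hx⟩ (this ▸ hd), this.symm⟩
  rw [h1, Set.toFinset_card]
  have := card_rootSet_eq_natDegree (K := L) (PerfectField.separable_of_irreducible hP)
    (IsAlgClosed.splits _)
  convert this

/-- Summing over the points with coordinates in the extension of degree `n` of a finite field
amounts to summing over the closed points of degree dividing `n`. -/
theorem sum_fixedPts_minpoly {n : ℕ} (hn : n ≠ 0) (g : F[X] → ℂ) :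
    ∑ x ∈ fixedPts F L n, g (minpoly F x) =
      ∑ P ∈ primesLE F n, if P.natDegree ∣ n then (P.natDegree : ℂ) * g P else 0 := by
  rw [← Finset.sum_fiberwise_of_maps_to (s := fixedPts F L n) (t := primesLE F n)
    (g := fun x => minpoly F x)]
  · refine Finset.sum_congr rfl fun P hP => ?_
    rw [mem_primesLE] at hP
    rw [Finset.sum_congr rfl (g := fun _ => g P) fun x hx => by rw [(Finset.mem_filter.1 hx).2],
      Finset.sum_const, nsmul_eq_mul]
    split_ifs with hd
    · rw [card_filter_minpoly_eq hn hP.1 hP.2.1 hd]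
    · rw [Finset.filter_false_of_mem, Finset.card_empty, Nat.cast_zero, zero_mul]
      rintro x hx rfl
      exact hd (minpoly_natDegree_dvd ((mem_fixedPts F L hn).1 hx))
  · intro x hx
    have hx' := (mem_fixedPts F L hn).1 hx
    have hi := isIntegral_of_pow hn hx'
    exact mem_primesLE.2 ⟨minpoly.monic hi, minpoly.irreducible hi,
      Nat.le_of_dvd (Nat.pos_of_ne_zero hn) (minpoly_natDegree_dvd hx')⟩

theorem minpoly_map_eq_prod {x : L} (hi : IsIntegral F x) :
    (minpoly F x).map (algebraMap F L) =
      ∏ j ∈ Finset.range (minpoly F x).natDegree, (X - C (x ^ Fintype.card F ^ j)) := by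
  obtain ⟨p, hp⟩ := CharP.exists F
  have : CharP L p := charP_of_injective_algebraMap' F p
  obtain ⟨k, hpr, hk⟩ := FiniteField.card F p
  have : Fact p.Prime := ⟨hpr⟩
  set d := (minpoly F x).natDegree with hd
  have hinj : Set.InjOn (fun j => x ^ Fintype.card F ^ j) (Finset.range d : Finset ℕ) := by
    have key : ∀ i j, i < j → j < d → x ^ Fintype.card F ^ i ≠ x ^ Fintype.card F ^ j := by
      intro i j hij hj h
      have h1 : (x ^ Fintype.card F ^ (j - i)) ^ Fintype.card F ^ i = x ^ Fintype.card F ^ i := by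
        rw [← pow_mul, ← pow_add, Nat.sub_add_cancel hij.le, h]
      rw [hk, ← pow_mul p _ i, ← iterateFrobenius_def p (k * i),
        ← iterateFrobenius_def p (k * i)] at h1
      have h2 := iterateFrobenius_inj L p _ h1
      rw [← hk] at h2
      have := Nat.le_of_dvd (by omega) (minpoly_natDegree_dvd h2)
      omega
    intro i hi j hj h
    simp only [Finset.coe_range, Set.mem_Iio] at hi hj
    rcases lt_trichotomy i j with hij | hij | hij
    · exact absurd h (key i j hij hj)
    · exact hij
    · exact absurd h.symm (key j i hij hi)
  symm
  have hmon : ((minpoly F x).map (algebraMap F L)).Monic := (minpoly.monic hi).map _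
  have h := Multiset.prod_X_sub_C_dvd_iff_le_roots hmon.ne_zero
    ((Finset.range d).val.map fun j => x ^ Fintype.card F ^ j)
  have hle : ((Finset.range d).val.map fun j => x ^ Fintype.card F ^ j) ≤
      ((minpoly F x).map (algebraMap F L)).roots := by
    rw [Multiset.le_iff_subset]
    · intro y hy
      rw [Multiset.mem_map] at hy
      obtain ⟨j, -, rfl⟩ := hy
      rw [mem_roots hmon.ne_zero, IsRoot, eval_map_algebraMap]
      have h3 := congrArg (FiniteField.frobeniusAlgHom F L ^ j) (minpoly.aeval F x)
      rw [← aeval_algHom_apply, map_zero] at h3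
      have h2 : (FiniteField.frobeniusAlgHom F L ^ j) x = x ^ Fintype.card F ^ j := by
        clear h3
        induction j with
        | zero => simp
        | succ j ih =>
          rw [pow_succ', AlgHom.mul_apply, ih, pow_succ, pow_mul]
          · simp
      rwa [h2] at h3
    · exact Multiset.Nodup.map_on (fun i hi j hj h => hinj (by simpa using hi) (by simpa using hj) h)
        (Finset.range d).nodup
  have hdvd := h.2 hle
  rw [Multiset.map_map] at hdvd
  refine (eq_of_monic_of_dvd_of_natDegree_le ?_ hmon hdvd ?_).symm
  · exact monic_prod_of_monic _ _ fun j _ => monic_X_sub_C (x ^ Fintype.card F ^ j)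
  · refine (natDegree_map _).le.trans (Eq.ge ?_)
    refine (natDegree_prod_of_monic _ _ fun j _ => monic_X_sub_C (x ^ Fintype.card F ^ j)).trans ?_
    simp only [natDegree_X_sub_C, Finset.sum_const, Finset.card_range, smul_eq_mul, mul_one, hd]

end Counting

section Hev

open scoped TensorProduct

variable {F : Type*} [Field F] {R : Type*} [CommRing R] [Algebra F R]

/-- The homogeneous evaluation `∑ aᵢ Aⁱ Bⁿ⁻ⁱ` of a polynomial of degree at most `n`. -/
def hev (A B : R) (n : ℕ) (f : F[X]) : R := MvPolynomial.aeval ![A, B] (f.homogenize n)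

theorem hev_mul (A B : R) {m n : ℕ} {f g : F[X]} (hf : f.natDegree ≤ m) (hg : g.natDegree ≤ n) :
    hev A B (m + n) (f * g) = hev A B m f * hev A B n g := by
  rw [hev, homogenize_mul _ _ hf hg, map_mul]; rfl

theorem hev_add (A B : R) (n : ℕ) (f g : F[X]) : hev A B n (f + g) = hev A B n f + hev A B n g := by
  simp [hev]

theorem hev_smul (A B : R) (n : ℕ) (c : F) (f : F[X]) :
    hev A B n (c • f) = c • hev A B n f := by
  simp [hev]

theorem hev_one (A B : R) : hev A B 0 (1 : F[X]) = 1 := by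
  simp [hev]

theorem hev_X_sub_C (A B : R) (y : F) : hev A B 1 (X - C y) = A - algebraMap F R y * B := by
  simp [hev]

theorem hev_prod {ι : Type*} (A B : R) (s : Finset ι) (f : ι → F[X]) (n : ι → ℕ)
    (h : ∀ i ∈ s, (f i).natDegree ≤ n i) :
    hev A B (∑ i ∈ s, n i) (∏ i ∈ s, f i) = ∏ i ∈ s, hev A B (n i) (f i) := by
  rw [hev, homogenize_finsetProd h, map_prod]; rfl

variable {L ι : Type*} [Fintype F] [Field L] [Algebra F L] [Fintype ι]

theorem base_toExt_hev (b : Module.Basis ι F R) (A B : R) (n : ℕ) (f : F[X]) :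
    (ScalarExt.base (L := L) b).toExt (hev A B n f) =
      hev ((ScalarExt.base (L := L) b).toExt A) ((ScalarExt.base (L := L) b).toExt B) n
        (f.map (algebraMap F L)) := by
  set D := ScalarExt.base (L := L) b
  have h1 : D.toExt = (Algebra.TensorProduct.includeRight : R →ₐ[F] L ⊗[F] R).toRingHom := rfl
  rw [hev, hev, homogenize_map, h1]
  have h2 := MvPolynomial.comp_aeval_apply ![A, B]
    (Algebra.TensorProduct.includeRight : R →ₐ[F] L ⊗[F] R) (f.homogenize n)
  refine h2.trans ?_
  rw [MvPolynomial.aeval_map_algebraMap]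
  congr 2
  funext i
  fin_cases i <;> rfl

theorem value_eq_hev_minpoly [IsAlgClosed L] (b : Module.Basis ι F R) (A B : R) {n : ℕ}
    (hn : n ≠ 0) {x : L} (hx : x ^ Fintype.card F ^ n = x) :
    (ScalarExt.base (L := L) b).value A B n x =
      hev A B (minpoly F x).natDegree (minpoly F x) ^ (n / (minpoly F x).natDegree) := by
  set D := ScalarExt.base (L := L) b
  have hi := isIntegral_of_pow hn hx
  have hdvd := minpoly_natDegree_dvd hx
  have hxd := pow_card_of_minpoly_natDegree_dvd hi dvd_rfl
  set d := (minpoly F x).natDegree with hd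
  obtain ⟨k, rfl⟩ := hdvd
  have hd0 : 0 < d := minpoly.natDegree_pos hi
  apply D.toExt_injective
  rw [D.toExt_value A B _ hx, ScalarExt.conjProd, prod_range_mul_eq, map_pow, base_toExt_hev,
    minpoly_map_eq_prod hi, Nat.mul_div_cancel_left k hd0]
  have h1 : hev (D.toExt A) (D.toExt B) d
      (∏ j ∈ Finset.range d, (X - C (x ^ Fintype.card F ^ j))) =
      ∏ j ∈ Finset.range d, (D.toExt A - algebraMap L _ (x ^ Fintype.card F ^ j) * D.toExt B) := by
    have h2 := hev_prod (D.toExt A) (D.toExt B) (Finset.range d)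
      (fun j => X - C (x ^ Fintype.card F ^ j)) (fun _ => 1) (fun i _ => natDegree_X_sub_C_le _)
    rw [Finset.sum_const, Finset.card_range, smul_eq_mul, mul_one] at h2
    rw [h2]
    exact Finset.prod_congr rfl fun j _ => hev_X_sub_C _ _ _
  rw [← hd]
  refine Eq.trans ?_ (congrArg (· ^ k) h1).symm
  simp only [← Finset.prod_pow]
  refine Finset.prod_congr rfl fun i _ => ?_
  have h2 : ∀ j, x ^ Fintype.card F ^ (d * j) = x := fun j =>
    pow_card_of_minpoly_natDegree_dvd hi (dvd_mul_right _ _)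
  refine (Finset.prod_congr rfl fun j _ => ?_).trans
    (by rw [Finset.prod_const, Finset.card_range])
  rw [pow_add, pow_mul, h2]

end Hev

section Newton

variable {F : Type*} [Field F] [Fintype F]

/-- The von Mangoldt type sum `∑ deg P · c(P)^(n / deg P)` over monic irreducibles `P` of degree
dividing `n`. -/
def psi (c : F[X] → ℂ) (n : ℕ) : ℂ :=
  ∑ P ∈ primesLE F n, if P.natDegree ∣ n then (P.natDegree : ℂ) * c P ^ (n / P.natDegree) else 0

theorem psi_one {n : ℕ} (hn : n ≠ 0) : psi (fun _ : F[X] => 1) n = (Fintype.card F : ℂ) ^ n := by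
  have h := sum_fixedPts_minpoly (F := F) (L := AlgebraicClosure F) hn (fun _ => 1)
  simp only [Finset.sum_const, card_fixedPts F _ hn, nsmul_eq_mul, mul_one] at h
  simp only [psi, one_pow, mul_one]
  rw [← h]
  push_cast
  rfl

theorem psi_hev {L R ι : Type*} [CommRing R] [Algebra F R] [Field L] [Algebra F L] [IsAlgClosed L]
    [Fintype ι] (b : Module.Basis ι F R) (A B : R) (χ : R →* ℂ) {n : ℕ} (hn : n ≠ 0) :
    psi (fun f : F[X] => χ (hev A B f.natDegree f)) n =
      ∑ x ∈ fixedPts F L n, χ ((ScalarExt.base (L := L) b).value A B n x) := by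
  have h := sum_fixedPts_minpoly (F := F) (L := L) hn
    (fun f : F[X] => χ (hev A B f.natDegree f) ^ (n / f.natDegree))
  rw [psi, ← h]
  refine Finset.sum_congr rfl fun x hx => ?_
  rw [value_eq_hev_minpoly b A B hn ((mem_fixedPts F L hn).1 hx), map_pow]

theorem natDegree_eq_sum_primesLE {f : F[X]} (hf : f.Monic) :
    f.natDegree = ∑ P ∈ primesLE F f.natDegree, ∑ j ∈ Finset.Icc 1 f.natDegree,
      if P ^ j ∣ f then P.natDegree else 0 := by
  set S := UniqueFactorizationMonoid.normalizedFactors f with hS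
  have hmem : ∀ P, P ∈ S ↔ P.Monic ∧ Irreducible P ∧ P ∣ f := by
    intro P
    rw [hS, UniqueFactorizationMonoid.mem_normalizedFactors_iff' hf.ne_zero]
    constructor
    · rintro ⟨h1, h2, h3⟩
      exact ⟨h2 ▸ monic_normalize h1.ne_zero, h1, h3⟩
    · rintro ⟨h1, h2, h3⟩
      exact ⟨h2, h1.normalize_eq_self, h3⟩
  have hprod : S.prod = f := by
    rw [UniqueFactorizationMonoid.prod_normalizedFactors_eq hf.ne_zero, hf.normalize_eq_self]
  have hdeg : f.natDegree = ∑ P ∈ S.toFinset, S.count P * P.natDegree := by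
    conv_lhs => rw [← hprod, natDegree_multiset_prod_of_monic _ fun P hP => ((hmem P).1 hP).1]
    rw [Finset.sum_multiset_map_count]
    simp
  have hsub : S.toFinset ⊆ primesLE F f.natDegree := by
    intro P hP
    rw [Multiset.mem_toFinset, hmem] at hP
    exact mem_primesLE.2 ⟨hP.1, hP.2.1, natDegree_le_of_dvd hP.2.2 hf.ne_zero⟩
  have hterm : ∀ P ∈ primesLE F f.natDegree, (∑ j ∈ Finset.Icc 1 f.natDegree,
      if P ^ j ∣ f then P.natDegree else 0) = S.count P * P.natDegree := by
    intro P hP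
    rw [mem_primesLE] at hP
    have hdvd : ∀ j, P ^ j ∣ f ↔ j ≤ S.count P := by
      intro j
      rw [pow_dvd_iff_le_emultiplicity,
        UniqueFactorizationMonoid.emultiplicity_eq_count_normalizedFactors hP.2.1 hf.ne_zero,
        hP.1.normalize_eq_self, Nat.cast_le]
    have hle : S.count P ≤ f.natDegree := by
      have h1 := natDegree_le_of_dvd ((hdvd _).2 le_rfl) hf.ne_zero
      rw [natDegree_pow] at h1
      exact (Nat.le_mul_of_pos_right _ hP.2.1.natDegree_pos).trans h1
    simp only [hdvd]
    rw [← Finset.sum_filter, Finset.sum_const, smul_eq_mul]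
    congr 1
    have : (Finset.Icc 1 f.natDegree).filter (fun j => j ≤ S.count P) =
        Finset.Icc 1 (S.count P) := by
      ext j
      simp only [Finset.mem_filter, Finset.mem_Icc]
      omega
    rw [this, Nat.card_Icc, Nat.add_sub_cancel]
  rw [Finset.sum_congr rfl hterm]
  conv_lhs => rw [hdeg]
  refine Finset.sum_subset hsub fun P _ hP => ?_
  rw [Multiset.mem_toFinset] at hP
  rw [Multiset.count_eq_zero_of_notMem hP, zero_mul]

/-- The coefficients of the `L`-function attached to `c`. -/
def lcoeff (c : F[X] → ℂ) (n : ℕ) : ℂ := ∑ f ∈ monics F n, c f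

theorem sum_monics_dvd (c : F[X] → ℂ) (hcm : ∀ f g : F[X], f.Monic → g.Monic → c (f * g) = c f * c g)
    {n : ℕ} {Q : F[X]} (hQ : Q.Monic) :
    (∑ f ∈ monics F n, if Q ∣ f then c f else 0) =
      if Q.natDegree ≤ n then c Q * lcoeff c (n - Q.natDegree) else 0 := by
  split_ifs with h
  · rw [← Finset.sum_filter, lcoeff, Finset.mul_sum]
    symm
    refine Finset.sum_bij (fun g _ => Q * g) ?_ ?_ ?_ ?_
    · intro g hg
      rw [mem_monics] at hg
      rw [Finset.mem_filter, mem_monics]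
      refine ⟨⟨hQ.mul hg.1, ?_⟩, dvd_mul_right _ _⟩
      rw [hQ.natDegree_mul hg.1]
      omega
    · intro g _ g' _ hgg
      exact mul_left_cancel₀ hQ.ne_zero hgg
    · intro f hf
      rw [Finset.mem_filter, mem_monics] at hf
      obtain ⟨⟨h1, h2⟩, g, rfl⟩ := hf
      have hg := hQ.of_mul_monic_left h1
      refine ⟨g, mem_monics.2 ⟨hg, ?_⟩, rfl⟩
      rw [hQ.natDegree_mul hg] at h2
      omega
    · intro g hg
      rw [hcm _ _ hQ (mem_monics.1 hg).1]
  · refine Finset.sum_eq_zero fun f hf => if_neg fun hd => h ?_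
    rw [mem_monics] at hf
    exact hf.2 ▸ natDegree_le_of_dvd hd hf.1.ne_zero

theorem newton (c : F[X] → ℂ) (hc1 : c 1 = 1)
    (hcm : ∀ f g : F[X], f.Monic → g.Monic → c (f * g) = c f * c g) (n : ℕ) :
    (n : ℂ) * lcoeff c n = ∑ k ∈ Finset.Icc 1 n, psi c k * lcoeff c (n - k) := by
  have hpow : ∀ (P : F[X]) (j : ℕ), P.Monic → c (P ^ j) = c P ^ j := by
    intro P j hP
    induction j with
    | zero => simpa using hc1
    | succ j ih => rw [pow_succ, hcm _ _ (hP.pow j) hP, ih, pow_succ]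
  have h1 : (n : ℂ) * lcoeff c n = ∑ P ∈ primesLE F n, ∑ j ∈ Finset.Icc 1 n,
      (P.natDegree : ℂ) * ∑ f ∈ monics F n, if P ^ j ∣ f then c f else 0 := by
    rw [lcoeff, Finset.mul_sum]
    have : ∀ f ∈ monics F n, (n : ℂ) * c f = ∑ P ∈ primesLE F n, ∑ j ∈ Finset.Icc 1 n,
        (P.natDegree : ℂ) * if P ^ j ∣ f then c f else 0 := by
      intro f hf
      rw [mem_monics] at hf
      have h := natDegree_eq_sum_primesLE hf.1
      rw [hf.2] at h
      conv_lhs => rw [h]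
      push_cast
      simp only [Finset.sum_mul, ite_mul, mul_ite, zero_mul, mul_zero]
    rw [Finset.sum_congr rfl this, Finset.sum_comm]
    refine Finset.sum_congr rfl fun P _ => ?_
    rw [Finset.sum_comm]
    simp only [Finset.mul_sum]
  rw [h1]
  have h2 : ∀ P ∈ primesLE F n, (∑ j ∈ Finset.Icc 1 n,
      (P.natDegree : ℂ) * ∑ f ∈ monics F n, if P ^ j ∣ f then c f else 0) =
      ∑ k ∈ Finset.Icc 1 n, (if P.natDegree ∣ k then
        (P.natDegree : ℂ) * c P ^ (k / P.natDegree) else 0) * lcoeff c (n - k) := by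
    intro P hP
    rw [mem_primesLE] at hP
    have hd := hP.2.1.natDegree_pos
    simp only [sum_monics_dvd c hcm (hP.1.pow _), hpow P _ hP.1, natDegree_pow, mul_ite, mul_zero,
      ite_mul, zero_mul]
    rw [← Finset.sum_filter, ← Finset.sum_filter]
    refine Finset.sum_bij (fun j _ => j * P.natDegree) ?_ ?_ ?_ ?_
    · intro j hj
      simp only [Finset.mem_filter, Finset.mem_Icc] at hj ⊢
      exact ⟨⟨Nat.mul_pos hj.1.1 hd, hj.2⟩, dvd_mul_left _ _⟩
    · intro i _ j _ hij
      exact Nat.eq_of_mul_eq_mul_right hd hij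
    · intro k hk
      simp only [Finset.mem_filter, Finset.mem_Icc] at hk
      obtain ⟨⟨hk1, hkn⟩, j, rfl⟩ := hk
      have hj : 0 < j := Nat.pos_of_ne_zero (by rintro rfl; simp at hk1)
      refine ⟨j, ?_, mul_comm _ _⟩
      simp only [Finset.mem_filter, Finset.mem_Icc]
      refine ⟨⟨hj, (Nat.le_mul_of_pos_left _ hd).trans hkn⟩, by rwa [mul_comm]⟩
    · intro j _
      rw [Nat.mul_div_cancel _ hd, mul_assoc]
  rw [Finset.sum_congr rfl h2, Finset.sum_comm]
  refine Finset.sum_congr rfl fun k hk => ?_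
  rw [Finset.mem_Icc] at hk
  rw [← Finset.sum_mul, psi]
  congr 1
  symm
  refine Finset.sum_subset (fun P hP => ?_) fun P hP hP' => if_neg fun hd => hP' ?_
  · rw [mem_primesLE] at hP ⊢
    exact ⟨hP.1, hP.2.1, hP.2.2.trans hk.2⟩
  · rw [mem_primesLE] at hP ⊢
    exact ⟨hP.1, hP.2.1, Nat.le_of_dvd (by omega) hd⟩

end Newton

section PowerSums

/-- A finite sequence of coefficients with constant term `1` is governed by power sums of complex
numbers through Newton's identities. -/
theorem exists_powerSum (a s : ℕ → ℂ) {n₀ : ℕ} (ha0 : a 0 = 1) (ha : ∀ n, n₀ < n → a n = 0)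
    (hN : ∀ n : ℕ, (n : ℂ) * a n = ∑ k ∈ Finset.Icc 1 n, s k * a (n - k)) :
    ∃ x : Fin n₀ → ℂ, ∀ m ≠ 0, s m = -∑ i, x i ^ m := by
  set Q : ℂ[X] := ∑ k ∈ Finset.range (n₀ + 1), C (a k) * X ^ (n₀ - k) with hQ
  have hcoeff : ∀ k ≤ n₀, Q.coeff (n₀ - k) = a k := by
    intro k hk
    rw [hQ, finsetSum_coeff, Finset.sum_eq_single k]
    · simp
    · intro j hj hjk
      rw [Finset.mem_range] at hj
      rw [coeff_C_mul_X_pow, if_neg (by omega)]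
    · intro h
      exact absurd (Finset.mem_range.2 (by omega)) h
  have hle : Q.natDegree ≤ n₀ := natDegree_sum_le_of_forall_le _ _ fun k _ =>
    (natDegree_C_mul_X_pow_le _ _).trans (Nat.sub_le _ _)
  have htop : Q.coeff n₀ = 1 := by simpa [ha0] using hcoeff 0 (Nat.zero_le _)
  have hmon : Q.Monic := monic_of_natDegree_le_of_coeff_eq_one n₀ hle htop
  have hdeg : Q.natDegree = n₀ := le_antisymm hle (le_natDegree_of_ne_zero (by simp [htop]))
  have hcard : Q.roots.card = n₀ := by
    rw [← hdeg]
    exact (splits_iff_card_roots.1 (IsAlgClosed.splits Q))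
  obtain ⟨x, hx⟩ : ∃ x : Fin n₀ → ℂ, Finset.univ.val.map x = Q.roots := by
    obtain ⟨l, hl⟩ := Quot.exists_rep Q.roots
    have hl' : (l : Multiset ℂ) = Q.roots := hl
    rw [← hl', Multiset.coe_card] at hcard
    subst hcard
    refine ⟨l.get, ?_⟩
    rw [← hl', Fin.univ_val_map, List.ofFn_get]
  have hesymm : ∀ k, a k = (-1) ^ k * MvPolynomial.aeval x (MvPolynomial.esymm (Fin n₀) ℂ k) := by
    intro k
    rw [MvPolynomial.aeval_esymm_eq_multiset_esymm, hx]
    rcases le_or_gt k n₀ with hk | hk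
    · rw [← hcoeff k hk, coeff_eq_esymm_roots_of_card (hcard.trans hdeg.symm) (by omega), hmon,
        hdeg, Nat.sub_sub_self hk, one_mul]
    · rw [ha k hk, Multiset.esymm, Multiset.powersetCard_eq_empty _ (by omega)]
      simp
  have hnewton : ∀ n : ℕ, (n : ℂ) * a n = ∑ k ∈ Finset.Icc 1 n, -(∑ i, x i ^ k) * a (n - k) := by
    intro n
    have h := congrArg (MvPolynomial.aeval x) (MvPolynomial.mul_esymm_eq_sum (Fin n₀) ℂ n)
    simp only [map_mul, map_natCast, map_pow, map_neg, map_one, map_sum, MvPolynomial.psum,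
      MvPolynomial.aeval_X] at h
    rw [hesymm, mul_left_comm, h, ← mul_assoc, ← pow_add,
      show n + (n + 1) = 2 * n + 1 by ring, pow_succ, pow_mul]
    simp only [even_two, Even.neg_pow, one_pow, one_mul, neg_mul, Finset.sum_neg_distrib, neg_inj]
    refine Finset.sum_bij' (fun b _ => b.2) (fun k _ => (n - k, k)) ?_ ?_ ?_ ?_ ?_
    · intro b hb
      simp only [Finset.mem_filter, Finset.HasAntidiagonal.mem_antidiagonal, Finset.mem_Icc] at hb ⊢
      omega
    · intro k hk
      simp only [Finset.mem_filter, Finset.HasAntidiagonal.mem_antidiagonal, Finset.mem_Icc] at hk ⊢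
      omega
    · intro b hb
      simp only [Finset.mem_filter, Finset.HasAntidiagonal.mem_antidiagonal] at hb
      ext <;> simp <;> omega
    · intro k _
      rfl
    · intro b hb
      simp only [Finset.mem_filter, Finset.HasAntidiagonal.mem_antidiagonal] at hb
      rw [hesymm, show n - b.2 = b.1 by omega]
      ring
  refine ⟨x, fun m => ?_⟩
  induction m using Nat.strong_induction_on with
  | _ m ih =>
    intro hm
    have h := (hN m).symm.trans (hnewton m)
    have hmem : m ∈ Finset.Icc 1 m := by simp; omega
    rw [← Finset.sum_erase_add _ _ hmem, ← Finset.sum_erase_add _ _ hmem, Nat.sub_self, ha0,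
      mul_one, mul_one] at h
    rw [Finset.sum_congr rfl fun k hk => ?_] at h
    · exact add_left_cancel h
    · rw [Finset.mem_erase, Finset.mem_Icc] at hk
      rw [ih k (by omega) (by omega)]

end PowerSums

section PowerBound

/-- Complex numbers whose power sums are `O(ρ ^ m)` have absolute value at most `ρ`. -/
theorem norm_le_of_powerSum_le {ι : Type*} [Fintype ι] (x : ι → ℂ) {C ρ : ℝ} (hρ : 0 < ρ)
    (h : ∀ m ≠ 0, ‖∑ i, x i ^ m‖ ≤ C * ρ ^ m) (i : ι) : ‖x i‖ ≤ ρ := by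
  by_contra! hi
  have hex : ∀ z : ℂ, ∃ w : Circle, z = ‖z‖ * w := by
    intro z
    exact ⟨Circle.exp z.arg, by rw [Circle.coe_exp, Complex.norm_mul_exp_arg_mul_I]⟩
  choose w hw using hex
  have hclus := mapClusterPt_one_atTop_pow (fun i => w (x i))
  have hnhds : {v : ι → Circle | ∀ i, (1 / 2 : ℝ) < ((v i : Circle) : ℂ).re} ∈
      nhds (1 : ι → Circle) := by
    rw [Set.ofPred_forall]
    refine (isOpen_iInter_of_finite fun i => ?_).mem_nhds ?_
    · exact isOpen_lt continuous_const (Complex.continuous_re.comp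
        (Continuous.comp continuous_subtype_val (continuous_apply i)))
    · simp only [Set.mem_iInter, Set.mem_ofPred_eq, Pi.one_apply, Circle.coe_one, Complex.one_re]
      norm_num
  have hfreq := hclus.frequently hnhds
  have htend : Filter.Tendsto (fun m : ℕ => (‖x i‖ / ρ) ^ m) Filter.atTop Filter.atTop :=
    tendsto_pow_atTop_atTop_of_one_lt ((one_lt_div hρ).2 hi)
  obtain ⟨m, hm, hm1, hm0⟩ := (hfreq.and_eventually
    ((htend.eventually_gt_atTop (2 * C)).and (Filter.eventually_gt_atTop 0))).exists
  have h1 := (Complex.re_le_norm _).trans (h m hm0.ne')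
  rw [Complex.re_sum] at h1
  have h2 : ∀ j, ‖x j‖ ^ m * (1 / 2) ≤ (x j ^ m).re := by
    intro j
    have h3 : x j ^ m = ((‖x j‖ ^ m : ℝ) : ℂ) * ((w (x j) ^ m : Circle) : ℂ) := by
      conv_lhs => rw [hw (x j)]
      rw [mul_pow]
      push_cast
      rfl
    rw [h3, Complex.re_ofReal_mul]
    exact mul_le_mul_of_nonneg_left (hm j).le (by positivity)
  have h3 : ‖x i‖ ^ m * (1 / 2) ≤ ∑ j, (x j ^ m).re :=
    (h2 i).trans (Finset.single_le_sum (f := fun j => (x j ^ m).re)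
      (fun j _ => le_trans (by positivity) (h2 j)) (Finset.mem_univ i))
  rw [div_pow, lt_div_iff₀ (by positivity)] at hm1
  linarith

end PowerBound

section RiemannHypothesis

variable {F R ι : Type*} [Field F] [Fintype F] [CommRing R] [Algebra F R] [Finite R] [Fintype ι]

/-- The Riemann hypothesis for the `L`-functions of a multiplicative character of a finite
algebra. -/
theorem norm_psi_hev_le (b : Module.Basis ι F R) (A B : R) (χ : R →* ℂ) (hχ : ∀ w, ‖χ w‖ ≤ 1)
    {P : F[X]} (hPm : P.Monic) (hP : Irreducible P) (hunit : IsUnit (hev A B P.natDegree P)) {n₀ : ℕ}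
    (hvan : ∀ n, n₀ < n → lcoeff (fun f : F[X] => χ (hev A B f.natDegree f)) n = 0)
    {n : ℕ} (hn : n ≠ 0) :
    ‖psi (fun f : F[X] => χ (hev A B f.natDegree f)) n‖ ≤ n₀ * √(Fintype.card F) ^ n := by
  set L := AlgebraicClosure F
  set c := fun f : F[X] => χ (hev A B f.natDegree f) with hc
  have hc1 : c 1 = 1 := by simp [hc, hev_one]
  have hcm : ∀ f g : F[X], f.Monic → g.Monic → c (f * g) = c f * c g := by
    intro f g hf hg
    simp only [hc]
    rw [hf.natDegree_mul hg, hev_mul A B le_rfl le_rfl, map_mul]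
  have ha0 : lcoeff c 0 = 1 := by
    have : monics F 0 = {1} := by
      ext f
      rw [mem_monics, Finset.mem_singleton]
      exact ⟨fun h => h.1.natDegree_eq_zero.1 h.2, fun h => by simp [h]⟩
    rw [lcoeff, this, Finset.sum_singleton, hc1]
  obtain ⟨x, hx⟩ := exists_powerSum _ _ ha0 hvan (newton c hc1 hcm)
  have hq0 : (0 : ℝ) < Fintype.card F := by exact_mod_cast Fintype.card_pos
  have hq1 : (1 : ℝ) < Fintype.card F := by exact_mod_cast Fintype.one_lt_card
  have hroot : ∀ i, ‖x i‖ ≤ √(Fintype.card F) := by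
    obtain ⟨a, ha⟩ := IsAlgClosed.exists_aeval_eq_zero L P (by
      rw [degree_eq_natDegree hPm.ne_zero]; exact_mod_cast hP.natDegree_pos.ne')
    have hmin := minpoly.eq_of_irreducible_of_monic hP ha hPm
    have hint : IsIntegral F a := ⟨P, hPm, ha⟩
    have hd0 : P.natDegree ≠ 0 := hP.natDegree_pos.ne'
    have hapow : a ^ Fintype.card F ^ P.natDegree = a :=
      pow_card_of_minpoly_natDegree_dvd hint (by rw [← hmin])
    have hu : IsUnit ((ScalarExt.base (L := L) b).value A B P.natDegree a) := by
      rw [value_eq_hev_minpoly b A B hd0 hapow, ← hmin]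
      exact hunit.pow _
    obtain ⟨e, he, C, h⟩ := sum_value_base_dichotomy b A B hd0 hapow hu χ hχ
    have hpts : ∀ m ≠ 0, ∑ y ∈ fixedPts F L (e * (2 * m)),
        χ ((ScalarExt.base (L := L) b).value A B (e * (2 * m)) y) =
        -∑ i, (x i ^ (2 * e)) ^ m := by
      intro m hm
      rw [← psi_hev b A B χ (by positivity), hx _ (by positivity)]
      simp only [← pow_mul]
      congr! 3
      ring
    rcases h with h | ⟨z, hz, h⟩
    · intro i
      have h1 := norm_le_of_powerSum_le (fun i => x i ^ (2 * e)) (C := C)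
        (ρ := (Fintype.card F : ℝ) ^ e) (by positivity) (fun m hm => by
          rw [← norm_neg, ← hpts m hm, ← pow_mul]
          exact h m hm) i
      rw [norm_pow, pow_mul] at h1
      exact Real.le_sqrt_of_sq_le (le_of_pow_le_pow_left₀ he.ne' hq0.le h1)
    · exfalso
      have h1 := norm_le_of_powerSum_le
        (fun i : Option (Fin n₀) => i.elim (z * (Fintype.card F : ℂ) ^ (2 * e))
          fun i => x i ^ (2 * e)) (C := C) one_pos (fun m hm => by
          rw [Fintype.sum_option, one_pow, mul_one]
          have h2 := h m hm
          rw [hpts m hm, ← norm_neg] at h2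
          refine (congrArg norm ?_).trans_le h2
          change (z * (Fintype.card F : ℂ) ^ (2 * e)) ^ m + ∑ i, (x i ^ (2 * e)) ^ m = _
          rw [mul_pow, ← pow_mul, show 2 * e * m = e * (2 * m) by ring]
          ring) none
      simp only [Option.elim, norm_mul, norm_pow, hz, one_mul, Complex.norm_natCast] at h1
      exact absurd (one_lt_pow₀ hq1 (by omega)) (not_lt.2 h1)
  rw [hx n hn, norm_neg]
  refine (norm_sum_le _ _).trans ((Finset.sum_le_sum fun i _ => ?_).trans_eq
    (by rw [Finset.sum_const, Finset.card_univ, Fintype.card_fin, nsmul_eq_mul]))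
  rw [norm_pow]
  exact pow_le_pow_left₀ (norm_nonneg _) (hroot i) n

end RiemannHypothesis

section Primes

variable {F : Type*} [Field F] [Fintype F]

variable (F) in
/-- The monic irreducible polynomials of degree `n`. -/
def primesEQ (n : ℕ) : Finset F[X] := (monics F n).filter Irreducible

@[simp] theorem mem_primesEQ {n : ℕ} {f : F[X]} :
    f ∈ primesEQ F n ↔ f.Monic ∧ f.natDegree = n ∧ Irreducible f := by
  rw [primesEQ, Finset.mem_filter, mem_monics, and_assoc]

theorem sum_primesLE_natDegree {n : ℕ} (hn : n ≠ 0) :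
    (∑ P ∈ primesLE F n, if P.natDegree ∣ n then P.natDegree else 0) = Fintype.card F ^ n := by
  have h := psi_one (F := F) hn
  simp only [psi, one_pow, mul_one] at h
  exact_mod_cast h

theorem primesEQ_eq_filter (n : ℕ) :
    primesEQ F n = (primesLE F n).filter fun P => P.natDegree = n := by
  ext P
  rw [mem_primesEQ, Finset.mem_filter, mem_primesLE]
  constructor
  · rintro ⟨h1, h2, h3⟩
    exact ⟨⟨h1, h3, h2.le⟩, h2⟩
  · rintro ⟨⟨h1, h2, -⟩, h3⟩
    exact ⟨h1, h3, h2⟩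

theorem mul_card_primesEQ_le {n : ℕ} (hn : n ≠ 0) :
    n * (primesEQ F n).card ≤ Fintype.card F ^ n := by
  rw [← sum_primesLE_natDegree hn, mul_comm, ← smul_eq_mul, ← Finset.sum_const, primesEQ_eq_filter,
    Finset.sum_filter]
  refine Finset.sum_le_sum fun P _ => ?_
  split_ifs with h1 h2
  · exact h1.ge
  · exact absurd (h1 ▸ dvd_rfl) h2
  · exact Nat.zero_le _
  · exact Nat.zero_le _

theorem sum_primesLE_le (n : ℕ) :
    ∑ P ∈ primesLE F n, P.natDegree ≤ 2 * Fintype.card F ^ n := by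
  have hq : 2 ≤ Fintype.card F := Fintype.one_lt_card
  induction n with
  | zero =>
    rw [Finset.sum_eq_zero]
    · simp
    · intro P hP
      exact Nat.le_zero.1 (mem_primesLE.1 hP).2.2
  | succ n ih =>
    rw [← Finset.sum_filter_add_sum_filter_not _ fun P => P.natDegree = n + 1,
      ← primesEQ_eq_filter]
    have h1 : ∑ P ∈ primesEQ F (n + 1), P.natDegree ≤ Fintype.card F ^ (n + 1) := by
      refine le_trans (Eq.le ?_) (mul_card_primesEQ_le n.succ_ne_zero)
      rw [Finset.sum_congr rfl fun P hP => (mem_primesEQ.1 hP).2.1, Finset.sum_const, smul_eq_mul,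
        mul_comm]
    have h2 : ∑ P ∈ (primesLE F (n + 1)).filter (fun P => ¬ P.natDegree = n + 1), P.natDegree ≤
        ∑ P ∈ primesLE F n, P.natDegree := by
      refine Finset.sum_le_sum_of_subset fun P hP => ?_
      rw [Finset.mem_filter, mem_primesLE] at hP
      exact mem_primesLE.2 ⟨hP.1.1, hP.1.2.1, by omega⟩
    have h3 : 2 * Fintype.card F ^ n ≤ Fintype.card F ^ (n + 1) := by
      rw [pow_succ, mul_comm]
      exact Nat.mul_le_mul_left _ hq
    omega

theorem norm_psi_sub_le (c : F[X] → ℂ) (hc : ∀ f, ‖c f‖ ≤ 1) {n : ℕ} (hn : n ≠ 0) :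
    ‖psi c n - n * ∑ P ∈ primesEQ F n, c P‖ ≤ 2 * √(Fintype.card F) ^ n := by
  have h1 : psi c n - n * ∑ P ∈ primesEQ F n, c P = ∑ P ∈ primesLE F n,
      if P.natDegree ∣ n ∧ P.natDegree ≠ n then (P.natDegree : ℂ) * c P ^ (n / P.natDegree)
      else 0 := by
    rw [psi, primesEQ_eq_filter, Finset.mul_sum, Finset.sum_filter, ← Finset.sum_sub_distrib]
    refine Finset.sum_congr rfl fun P _ => ?_
    by_cases h2 : P.natDegree = n
    · simp [h2, Nat.div_self (Nat.pos_of_ne_zero hn)]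
    · simp [h2]
  have h2 : ‖psi c n - n * ∑ P ∈ primesEQ F n, c P‖ ≤
      ((∑ P ∈ primesLE F (n / 2), P.natDegree : ℕ) : ℝ) := by
    rw [h1]
    push_cast
    refine (norm_sum_le _ _).trans ?_
    have h3 : ∀ P ∈ primesLE F n, ‖if P.natDegree ∣ n ∧ P.natDegree ≠ n then
        (P.natDegree : ℂ) * c P ^ (n / P.natDegree) else 0‖ ≤
        if P.natDegree ∣ n ∧ P.natDegree ≠ n then (P.natDegree : ℝ) else 0 := by
      intro P _
      split_ifs
      · rw [norm_mul, Complex.norm_natCast, norm_pow]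
        exact mul_le_of_le_one_right (Nat.cast_nonneg _) (pow_le_one₀ (norm_nonneg _) (hc P))
      · simp
    refine (Finset.sum_le_sum h3).trans ?_
    rw [← Finset.sum_filter]
    refine Finset.sum_le_sum_of_subset_of_nonneg (fun P hP => ?_) fun _ _ _ => Nat.cast_nonneg _
    rw [Finset.mem_filter, mem_primesLE] at hP
    obtain ⟨⟨h4, h5, h6⟩, ⟨k, hk⟩, h8⟩ := hP
    refine mem_primesLE.2 ⟨h4, h5, ?_⟩
    have : 2 ≤ k := by
      rcases k with _ | _ | k
      · omega
      · omega
      · omega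
    rw [Nat.le_div_iff_mul_le two_pos]
    calc P.natDegree * 2 ≤ P.natDegree * k := Nat.mul_le_mul_left _ this
      _ = n := hk.symm
  refine h2.trans ?_
  have h3 : ((∑ P ∈ primesLE F (n / 2), P.natDegree : ℕ) : ℝ) ≤
      2 * (Fintype.card F : ℝ) ^ (n / 2) := by
    exact_mod_cast sum_primesLE_le (n / 2)
  refine h3.trans (mul_le_mul_of_nonneg_left ?_ two_pos.le)
  have hq1 : (1 : ℝ) ≤ √(Fintype.card F) :=
    Real.one_le_sqrt.2 (by exact_mod_cast Fintype.card_pos)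
  calc (Fintype.card F : ℝ) ^ (n / 2) = √(Fintype.card F) ^ (2 * (n / 2)) := by
        rw [pow_mul, Real.sq_sqrt (Nat.cast_nonneg _)]
    _ ≤ √(Fintype.card F) ^ n := pow_le_pow_right₀ hq1 (Nat.mul_div_le n 2)

end Primes

section Fourier

open scoped ComplexConjugate

variable {R : Type*} [CommRing R] [Fintype R]

instance : Fintype (MulChar R ℂ) := Fintype.ofFinite _

theorem sum_mulChar_units (u : Rˣ) :
    ∑ χ : MulChar R ℂ, χ u = if u = 1 then (Fintype.card Rˣ : ℂ) else 0 := by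
  split_ifs with h
  · have h1 := MulChar.card_eq_card_units_of_hasEnoughRootsOfUnity R ℂ
    rw [Nat.card_eq_fintype_card, Nat.card_eq_fintype_card] at h1
    simp [h, h1]
  · obtain ⟨χ, hχ⟩ := MulChar.exists_apply_ne_one_of_hasEnoughRootsOfUnity R ℂ
      (a := (u : R)) (by simpa using h)
    refine eq_zero_of_mul_eq_self_left hχ ?_
    simp only [Finset.mul_sum, ← MulChar.mul_apply]
    exact Fintype.sum_bijective _ (Group.mulLeft_bijective χ) _ _ fun χ' => rfl

theorem sum_mulChar_units_eq_zero {χ : MulChar R ℂ} (hχ : χ ≠ 1) : ∑ u : Rˣ, χ u = 0 := by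
  obtain ⟨b, hb⟩ := MulChar.ne_one_iff.1 hχ
  refine eq_zero_of_mul_eq_self_left hb ?_
  simp only [Finset.mul_sum, ← map_mul, ← Units.val_mul]
  exact Fintype.sum_bijective _ (Group.mulLeft_bijective b) _ _ fun _ => rfl

theorem norm_mulChar_units (χ : MulChar R ℂ) (u : Rˣ) : ‖χ u‖ = 1 := by
  have h : χ u ^ Fintype.card Rˣ = 1 := by
    rw [← map_pow, ← Units.val_pow_eq_pow_val, pow_card_eq_one, Units.val_one, map_one]
  exact Complex.norm_eq_one_of_pow_eq_one h Fintype.card_ne_zero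

theorem norm_mulChar_le (χ : MulChar R ℂ) (w : R) : ‖χ w‖ ≤ 1 := by
  by_cases h : IsUnit w
  · obtain ⟨u, rfl⟩ := h
    exact (norm_mulChar_units χ u).le
  · rw [χ.map_nonunit h, norm_zero]
    exact zero_le_one

theorem sum_norm_fourier_sq (ψ : Rˣ → ℂ) :
    ∑ χ : MulChar R ℂ, ‖∑ u, ψ u * χ u‖ ^ 2 = Fintype.card Rˣ * ∑ u, ‖ψ u‖ ^ 2 := by
  have h : ∀ z : ℂ, ((‖z‖ ^ 2 : ℝ) : ℂ) = z * conj z := fun z => by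
    rw [Complex.mul_conj, Complex.normSq_eq_norm_sq]
  have hconj : ∀ (χ : MulChar R ℂ) (u : Rˣ), conj (χ u) = χ ((u⁻¹ : Rˣ) : R) := by
    intro χ u
    have h1 : χ u * χ ((u⁻¹ : Rˣ) : R) = 1 := by
      rw [← map_mul, ← Units.val_mul, mul_inv_cancel, Units.val_one, map_one]
    have h2 : χ u * conj (χ u) = 1 := by
      rw [← h, norm_mulChar_units]
      simp
    have h3 : χ u ≠ 0 := left_ne_zero_of_mul_eq_one h1
    exact mul_left_cancel₀ h3 (h2.trans h1.symm)
  apply Complex.ofReal_injective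
  push_cast
  simp only [← Complex.ofReal_pow, h]
  have h4 : ∀ χ : MulChar R ℂ, (∑ u, ψ u * χ u) * conj (∑ u, ψ u * χ u) =
      ∑ u, ∑ v, ψ u * conj (ψ v) * χ ((u * v⁻¹ : Rˣ) : R) := by
    intro χ
    rw [map_sum, Finset.sum_mul_sum]
    refine Finset.sum_congr rfl fun u _ => Finset.sum_congr rfl fun v _ => ?_
    rw [map_mul, hconj, Units.val_mul, map_mul]
    ring
  rw [Finset.sum_congr rfl fun χ _ => h4 χ, Finset.sum_comm, Finset.mul_sum]
  refine Finset.sum_congr rfl fun u _ => ?_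
  rw [Finset.sum_comm]
  simp only [← Finset.mul_sum, sum_mulChar_units, mul_inv_eq_one]
  rw [Finset.sum_eq_single u]
  · simp only [if_true]
    ring
  · intro v _ hv
    rw [if_neg hv.symm, mul_zero]
  · simp

/-- If all nontrivial Fourier coefficients of `θ` are small, then `θ` is nearly constant in the
`L²` sense, hence its correlation with a bounded function is nearly the expected one. -/
theorem norm_sum_mul_sub_le (E θ : Rˣ → ℂ) (hE : ∀ u, ‖E u‖ ≤ 1) {M : ℝ}
    (hM : ∀ χ : MulChar R ℂ, χ ≠ 1 → ‖∑ u, θ u * χ u‖ ≤ M) (hM0 : 0 ≤ M) :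
    ‖∑ u, E u * θ u - (∑ u, E u) * (∑ u, θ u) / Fintype.card Rˣ‖ ≤
      √(Fintype.card Rˣ) * M := by
  set c : ℂ := (∑ u, θ u) / Fintype.card Rˣ with hc
  set ψ : Rˣ → ℂ := fun u => θ u - c with hψ
  have hcard : (Fintype.card Rˣ : ℂ) ≠ 0 := by exact_mod_cast Fintype.card_ne_zero
  have hcard' : (0 : ℝ) < Fintype.card Rˣ := by exact_mod_cast Fintype.card_pos
  have h1 : ∑ u, E u * θ u - (∑ u, E u) * (∑ u, θ u) / Fintype.card Rˣ = ∑ u, E u * ψ u := by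
    simp only [hψ, mul_sub, Finset.sum_sub_distrib, ← Finset.sum_mul]
    rw [hc, mul_div_assoc]
  have h2 : ∀ χ : MulChar R ℂ, ‖∑ u, ψ u * χ u‖ ≤ M := by
    intro χ
    simp only [hψ, sub_mul, Finset.sum_sub_distrib, ← Finset.mul_sum]
    by_cases hχ : χ = 1
    · subst hχ
      have : ∀ u : Rˣ, (1 : MulChar R ℂ) u = 1 := fun u => MulChar.one_apply_coe u
      simp only [this, mul_one, Finset.sum_const, Finset.card_univ, nsmul_eq_mul]
      rw [hc, div_mul_cancel₀ _ hcard, sub_self, norm_zero]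
      exact hM0
    · rw [sum_mulChar_units_eq_zero hχ, mul_zero, sub_zero]
      exact hM χ hχ
  have h3 : ∑ u, ‖ψ u‖ ^ 2 ≤ M ^ 2 := by
    have h4 := sum_norm_fourier_sq ψ
    have h5 : ∑ χ : MulChar R ℂ, ‖∑ u, ψ u * χ u‖ ^ 2 ≤ Fintype.card Rˣ * M ^ 2 := by
      refine (Finset.sum_le_sum fun χ _ => pow_le_pow_left₀ (norm_nonneg _) (h2 χ) 2).trans ?_
      have h6 := MulChar.card_eq_card_units_of_hasEnoughRootsOfUnity R ℂ
      rw [Nat.card_eq_fintype_card, Nat.card_eq_fintype_card] at h6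
      rw [Finset.sum_const, Finset.card_univ, h6, nsmul_eq_mul]
    rw [h4] at h5
    exact le_of_mul_le_mul_left h5 hcard'
  rw [h1]
  have h7 : ‖∑ u, E u * ψ u‖ ≤ ∑ u, 1 * ‖ψ u‖ :=
    (norm_sum_le _ _).trans (Finset.sum_le_sum fun u _ => by
      rw [norm_mul]
      exact mul_le_mul_of_nonneg_right (hE u) (norm_nonneg _))
  refine h7.trans (abs_le_of_sq_le_sq' ?_ (by positivity)).2
  refine (Finset.sum_mul_sq_le_sq_mul_sq _ _ _).trans ?_
  rw [mul_pow, Real.sq_sqrt hcard'.le]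
  simp only [one_pow, Finset.sum_const, Finset.card_univ, nsmul_eq_mul, mul_one]
  exact mul_le_mul_of_nonneg_left h3 hcard'.le

end Fourier

section ClassRing

variable {F : Type*} [Field F]

theorem isUnit_adjoinRoot_mk_iff {s f : F[X]} : IsUnit (AdjoinRoot.mk s f) ↔ IsCoprime f s := by
  constructor
  · intro h
    obtain ⟨w, hw⟩ := h.exists_right_inv
    obtain ⟨g, rfl⟩ := AdjoinRoot.mk_surjective w
    rw [← map_mul, ← map_one (AdjoinRoot.mk s), AdjoinRoot.mk_eq_mk] at hw
    obtain ⟨k, hk⟩ := hw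
    exact ⟨g, -k, by linear_combination hk⟩
  · rintro ⟨a, b, h⟩
    refine IsUnit.of_mul_eq_one (AdjoinRoot.mk s a) ?_
    rw [← map_mul, ← map_one (AdjoinRoot.mk s), AdjoinRoot.mk_eq_mk]
    exact ⟨-b, by linear_combination h⟩

/-- Residue classes modulo `s` together with the first `l + 1` leading coefficients. -/
abbrev ClassRing (s : F[X]) (l : ℕ) := AdjoinRoot s × AdjoinRoot (X ^ (l + 1) : F[X])

variable (s : F[X]) (l : ℕ)

/-- The class of a polynomial of degree at most `n`. -/
def cls (n : ℕ) (f : F[X]) : ClassRing s l :=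
  hev ((AdjoinRoot.root s, 1) : ClassRing s l) (1, AdjoinRoot.root _) n f

variable {s l}

theorem cls_eq {n : ℕ} {f : F[X]} (hf : f.natDegree ≤ n) :
    cls s l n f = (AdjoinRoot.mk s f, AdjoinRoot.mk _ (reflect n f)) := by
  refine induction_with_natDegree_le (fun f => cls s l n f =
    (AdjoinRoot.mk s f, AdjoinRoot.mk (X ^ (l + 1)) (reflect n f))) n ?_ ?_ ?_ f hf
  · simp [cls, hev]
    rfl
  · intro m r _ hm
    rw [cls, hev, homogenize_C_mul, homogenize_X_pow hm, reflect_C_mul_X_pow, revAt_le hm]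
    ext
    · simp [AdjoinRoot.algebraMap_eq]
    · simp [AdjoinRoot.algebraMap_eq]
  · intro f g _ _ hf hg
    rw [cls, hev_add]
    rw [cls] at hf hg
    rw [hf, hg, reflect_add]
    simp

theorem cls_eq_cls_iff {n : ℕ} (hl : l ≤ n) {f g : F[X]} (hf : f.natDegree ≤ n) (hg : g.natDegree ≤ n) :
    cls s l n f = cls s l n g ↔ s ∣ f - g ∧ (f - g).degree < ((n - l : ℕ) : WithBot ℕ) := by
  rw [cls_eq hf, cls_eq hg, Prod.mk.injEq, AdjoinRoot.mk_eq_mk, AdjoinRoot.mk_eq_mk,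
    ← reflect_sub, X_pow_dvd_iff, degree_lt_iff_coeff_zero]
  refine and_congr_right fun _ => ?_
  have hfg : (f - g).natDegree ≤ n := (natDegree_sub_le _ _).trans (max_le hf hg)
  simp only [coeff_reflect]
  constructor
  · intro h m hm
    rcases le_or_gt m n with hmn | hmn
    · have := h (n - m) (by omega)
      rwa [revAt_le (by omega), Nat.sub_sub_self hmn] at this
    · exact coeff_eq_zero_of_natDegree_lt (hfg.trans_lt hmn)
  · intro h d hd
    rw [revAt_le (by omega)]
    exact h _ (by omega)

theorem isUnit_cls_iff {n : ℕ} {f : F[X]} (hf : f.natDegree ≤ n) :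
    IsUnit (cls s l n f) ↔ IsCoprime f s ∧ f.coeff n ≠ 0 := by
  rw [cls_eq hf, Prod.isUnit_iff, isUnit_adjoinRoot_mk_iff, isUnit_adjoinRoot_mk_iff]
  refine and_congr_right fun _ => ?_
  rw [IsCoprime.pow_right_iff l.succ_pos, isCoprime_comm, (prime_X (R := F)).irreducible.coprime_iff_not_dvd,
    X_dvd_iff, coeff_reflect, revAt_le (Nat.zero_le n), Nat.sub_zero]

variable [Fintype F]

instance : Module.Finite F (AdjoinRoot (X ^ (l + 1) : F[X])) :=
  (AdjoinRoot.powerBasis' (monic_X_pow (R := F) (l + 1))).finite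

theorem card_adjoinRoot {s : F[X]} (hs : s.Monic) :
    Nat.card (AdjoinRoot s) = Fintype.card F ^ s.natDegree := by
  have := (AdjoinRoot.powerBasis' hs).finite
  rw [Module.natCard_eq_pow_finrank (K := F), (AdjoinRoot.powerBasis' hs).finrank,
    AdjoinRoot.powerBasis'_dim, Nat.card_eq_fintype_card]

theorem card_classRing (hs : s.Monic) :
    Nat.card (ClassRing s l) = Fintype.card F ^ (s.natDegree + l + 1) := by
  rw [Nat.card_prod, card_adjoinRoot hs, card_adjoinRoot (monic_X_pow _), natDegree_X_pow, ← pow_add,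
    add_assoc]

theorem finite_classRing (hs : s.Monic) : Finite (ClassRing s l) :=
  Nat.finite_of_card_ne_zero (by rw [card_classRing hs]; exact pow_ne_zero _ Fintype.card_ne_zero)

theorem card_cls_fiber (hs : s.Monic) {n : ℕ} (hn : l + s.natDegree ≤ n) (w : ClassRing s l) :
    ((polysLT F (n + 1)).filter fun f => cls s l n f = w).card =
      Fintype.card F ^ (n - l - s.natDegree) := by
  have := finite_classRing (l := l) hs
  have := Fintype.ofFinite (ClassRing s l)
  have hle : ∀ w ∈ (Finset.univ : Finset (ClassRing s l)),
      ((polysLT F (n + 1)).filter fun f => cls s l n f = w).card ≤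
      Fintype.card F ^ (n - l - s.natDegree) := by
    intro w _
    rcases ((polysLT F (n + 1)).filter fun f => cls s l n f = w).eq_empty_or_nonempty with h | ⟨f₀, h⟩
    · rw [h, Finset.card_empty]
      exact Nat.zero_le _
    · rw [Finset.mem_filter, mem_polysLT, degree_lt_succ_iff] at h
      rw [← card_polysLT]
      refine (Finset.card_le_card (t := (polysLT F (n - l - s.natDegree)).image
        fun g => f₀ + s * g) fun f hf => ?_).trans Finset.card_image_le
      rw [Finset.mem_filter, mem_polysLT, degree_lt_succ_iff, ← h.2,
        cls_eq_cls_iff (by omega) hf.1 h.1] at hf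
      obtain ⟨_, ⟨k, hk⟩, hlt⟩ := hf
      refine Finset.mem_image.2 ⟨k, ?_, by rw [← hk]; ring⟩
      rw [mem_polysLT]
      rcases eq_or_ne k 0 with rfl | hk0
      · simp
      rw [hk, mul_comm, degree_mul, degree_eq_natDegree hk0, degree_eq_natDegree hs.ne_zero] at hlt
      rw [degree_eq_natDegree hk0]
      norm_cast at hlt ⊢
      omega
  have htot : ∑ w : ClassRing s l, ((polysLT F (n + 1)).filter fun f => cls s l n f = w).card =
      ∑ _w : ClassRing s l, Fintype.card F ^ (n - l - s.natDegree) := by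
    rw [← Finset.card_eq_sum_card_fiberwise (fun _ _ => Finset.mem_univ _), card_polysLT,
      Finset.sum_const, Finset.card_univ, ← Nat.card_eq_fintype_card (α := ClassRing s l), card_classRing hs, smul_eq_mul,
      ← pow_add]
    congr 1
    omega
  exact (Finset.sum_eq_sum_iff_of_le hle).1 htot w (Finset.mem_univ _)

theorem sum_cls (hs : s.Monic) [Fintype (ClassRing s l)] {n : ℕ} (hn : l + s.natDegree ≤ n)
    (h : ClassRing s l → ℂ) :
    ∑ f ∈ polysLT F (n + 1), h (cls s l n f) =
      (Fintype.card F : ℂ) ^ (n - l - s.natDegree) * ∑ w, h w := by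
  rw [← Finset.sum_fiberwise_of_maps_to (t := Finset.univ) (g := cls s l n)
    (fun _ _ => Finset.mem_univ _), Finset.mul_sum]
  refine Finset.sum_congr rfl fun w _ => ?_
  rw [Finset.sum_congr rfl (g := fun _ => h w) fun f hf => by rw [(Finset.mem_filter.1 hf).2],
    Finset.sum_const, card_cls_fiber hs hn, nsmul_eq_mul, Nat.cast_pow]

end ClassRing

section PrimeSums

theorem norm_sum_mul_sub_le_fintype {R : Type*} [CommRing R] [Fintype R] [i : Fintype Rˣ]
    (E θ : Rˣ → ℂ) (hE : ∀ u, ‖E u‖ ≤ 1) {M : ℝ}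
    (hM : ∀ χ : MulChar R ℂ, χ ≠ 1 → ‖∑ u, θ u * χ u‖ ≤ M) (hM0 : 0 ≤ M) :
    ‖∑ u, E u * θ u - (∑ u, E u) * (∑ u, θ u) / Fintype.card Rˣ‖ ≤ √(Fintype.card Rˣ) * M := by
  convert norm_sum_mul_sub_le E θ hE (M := M) ?_ hM0
  convert hM

variable {F : Type*} [Field F] [Fintype F]

/-- The modified von Mangoldt function. -/
def lam (f : F[X]) : ℝ := if Irreducible f then (f.natDegree : ℝ) else 0

theorem sum_polysLT_coeff_ne_zero (n : ℕ) (h : F[X] → ℂ) :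
    ∑ f ∈ (polysLT F (n + 1)).filter (fun f => f.coeff n ≠ 0), h f =
      ∑ a : Fˣ, ∑ g ∈ monics F n, h (C (a : F) * g) := by
  rw [← Finset.sum_product']
  symm
  refine Finset.sum_bij' (fun x _ => C (x.1 : F) * x.2)
    (fun f _ => if hf : f.leadingCoeff ≠ 0 then
      (Units.mk0 f.leadingCoeff hf, C f.leadingCoeff⁻¹ * f) else (1, f)) ?_ ?_ ?_ ?_ ?_
  · rintro ⟨a, g⟩ hg
    obtain ⟨hm, hn⟩ := mem_monics.1 (Finset.mem_product.1 hg).2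
    rw [Finset.mem_filter, mem_polysLT, degree_lt_succ_iff]
    refine ⟨(natDegree_C_mul_le _ _).trans hn.le, ?_⟩
    have h1 : g.coeff n = 1 := by rw [← hn]; exact hm
    simp only [coeff_C_mul, h1, mul_one]
    exact a.ne_zero
  · intro f hf
    rw [Finset.mem_filter, mem_polysLT, degree_lt_succ_iff] at hf
    have hn : f.natDegree = n := le_antisymm hf.1 (le_natDegree_of_ne_zero hf.2)
    have h0 : f.leadingCoeff ≠ 0 := by rw [leadingCoeff, hn]; exact hf.2
    simp only [dif_pos h0, Finset.mem_product, Finset.mem_univ, true_and, mem_monics]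
    refine ⟨?_, ?_⟩
    · rw [Monic, leadingCoeff_mul, leadingCoeff_C, inv_mul_cancel₀ h0]
    · rw [natDegree_C_mul (inv_ne_zero h0), hn]
  · rintro ⟨a, g⟩ hg
    obtain ⟨hm, hn⟩ := mem_monics.1 (Finset.mem_product.1 hg).2
    have h1 : (C (a : F) * g).leadingCoeff = a := by
      rw [leadingCoeff_mul, leadingCoeff_C, hm.leadingCoeff, mul_one]
    have h0 : (C (a : F) * g).leadingCoeff ≠ 0 := by rw [h1]; exact a.ne_zero
    simp only [dif_pos h0]
    refine Prod.ext (Units.ext (by simp [h1])) ?_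
    simp only [h1]
    rw [← mul_assoc, ← C_mul, inv_mul_cancel₀ a.ne_zero, C_1, one_mul]
  · intro f hf
    rw [Finset.mem_filter, mem_polysLT, degree_lt_succ_iff] at hf
    have hn : f.natDegree = n := le_antisymm hf.1 (le_natDegree_of_ne_zero hf.2)
    have h0 : f.leadingCoeff ≠ 0 := by rw [leadingCoeff, hn]; exact hf.2
    simp only [dif_pos h0, Units.val_mk0]
    rw [← mul_assoc, ← C_mul, mul_inv_cancel₀ h0, C_1, one_mul]
  · intro _ _
    rfl

theorem lam_C_mul (a : Fˣ) (g : F[X]) : lam (C (a : F) * g) = lam g := by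
  have h : Irreducible (C (a : F) * g) ↔ Irreducible g := by
    rw [mul_comm]
    exact irreducible_mul_isUnit (isUnit_C.2 a.isUnit)
  rw [lam, lam, natDegree_C_mul a.ne_zero]
  simp only [h]

variable {s : F[X]} {l : ℕ}

theorem cls_C_mul (n : ℕ) (a : F) (g : F[X]) :
    cls s l n (C a * g) = algebraMap F _ a * cls s l n g := by
  rw [cls, C_mul', hev_smul, Algebra.smul_def]
  rfl

theorem exists_irreducible_coprime (hs : s ≠ 0) :
    ∃ P : F[X], P.Monic ∧ Irreducible P ∧ IsCoprime P s := by
  have hnu : ¬ IsUnit (1 + s * X) := by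
    intro hu
    have h1 := natDegree_eq_zero_of_isUnit hu
    have h2 : (s * X).natDegree = s.natDegree + 1 := natDegree_mul_X hs
    rw [natDegree_add_eq_right_of_natDegree_lt (by simp [h2]), h2] at h1
    omega
  obtain ⟨P, hPm, hP, k, hk⟩ := exists_monic_irreducible_factor _ hnu
  exact ⟨P, hPm, hP, k, -X, by linear_combination -hk⟩

theorem norm_sum_lam_mulChar_le (hs : s.Monic) {n : ℕ} (hn0 : n ≠ 0)
    (χ : MulChar (ClassRing s l) ℂ) (hχ : χ ≠ 1) :
    ‖∑ f ∈ (polysLT F (n + 1)).filter (fun f => f.coeff n ≠ 0), (lam f : ℂ) * χ (cls s l n f)‖ ≤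
      Fintype.card F * ((l + s.natDegree + 2 : ℕ) * √(Fintype.card F) ^ n) := by
  have := finite_classRing (l := l) hs
  have := Fintype.ofFinite (ClassRing s l)
  have hχ1 := norm_mulChar_le χ
  set κ : ℂ := ∑ a : Fˣ, χ (algebraMap F _ (a : F)) with hκ
  have hκle : ‖κ‖ ≤ Fintype.card F := by
    refine (norm_sum_le_of_le _ fun a _ => hχ1 _).trans ?_
    rw [Finset.sum_const, nsmul_eq_mul, mul_one, Finset.card_univ]
    exact_mod_cast Fintype.card_le_of_injective (fun a : Fˣ => (a : F)) Units.val_injective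
  set c : F[X] → ℂ := fun f => χ (cls s l f.natDegree f) with hc
  have hsum : ∑ f ∈ (polysLT F (n + 1)).filter (fun f => f.coeff n ≠ 0),
      (lam f : ℂ) * χ (cls s l n f) = κ * (n * ∑ P ∈ primesEQ F n, c P) := by
    rw [sum_polysLT_coeff_ne_zero, hκ, Finset.sum_mul]
    refine Finset.sum_congr rfl fun a _ => ?_
    have : primesEQ F n = (monics F n).filter Irreducible := by
      ext P
      rw [mem_primesEQ, Finset.mem_filter, mem_monics, and_assoc]
    rw [this, Finset.sum_filter, Finset.mul_sum, Finset.mul_sum]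
    refine Finset.sum_congr rfl fun g hg => ?_
    rw [lam_C_mul, cls_C_mul, map_mul, lam, hc]
    split_ifs
    · simp only [(mem_monics.1 hg).2]
      push_cast
      ring
    · simp
  have hvan : ∀ m, l + s.natDegree < m → κ * lcoeff c m = 0 := by
    intro m hm
    have h1 := sum_cls hs hm.le (fun w => χ w)
    rw [MulChar.sum_eq_zero_of_ne_one hχ, mul_zero, ← Finset.sum_filter_of_ne
      (p := fun f => f.coeff m ≠ 0), sum_polysLT_coeff_ne_zero] at h1
    · rw [← h1, hκ, Finset.sum_mul]
      refine Finset.sum_congr rfl fun a _ => ?_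
      rw [lcoeff, Finset.mul_sum]
      refine Finset.sum_congr rfl fun g hg => ?_
      rw [cls_C_mul, map_mul, hc]
      simp only [(mem_monics.1 hg).2]
    · intro f hf hne h0
      refine hne (χ.map_nonunit fun hu => ?_)
      rw [mem_polysLT, degree_lt_succ_iff] at hf
      exact ((isUnit_cls_iff hf).1 hu).2 h0
  rw [hsum]
  rcases eq_or_ne κ 0 with h0 | h0
  · rw [h0, zero_mul, norm_zero]
    positivity
  obtain ⟨P, hPm, hP, hPs⟩ := exists_irreducible_coprime hs.ne_zero
  have hpsi : ‖psi c n‖ ≤ (l + s.natDegree : ℕ) * √(Fintype.card F) ^ n := by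
    have := (AdjoinRoot.powerBasis' hs).finite
    have := (AdjoinRoot.powerBasis' hs).basis
    have : Module.Free F (AdjoinRoot s) := Module.Free.of_divisionRing F _
    have : Module.Free F (AdjoinRoot (X ^ (l + 1) : F[X])) := Module.Free.of_divisionRing F _
    exact norm_psi_hev_le (Module.finBasis F (ClassRing s l)) _ _ χ.toMonoidHom hχ1 hPm hP
      ((isUnit_cls_iff le_rfl).2 ⟨hPs, by rw [coeff_natDegree, hPm]; exact one_ne_zero⟩)
      (fun m hm => (mul_eq_zero.1 (hvan m hm)).resolve_left h0) hn0
  have hsub := norm_psi_sub_le c (fun f => hχ1 _) hn0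
  rw [norm_mul]
  refine mul_le_mul hκle ?_ (norm_nonneg _) (Nat.cast_nonneg _)
  have := norm_sub_norm_le (↑n * ∑ P ∈ primesEQ F n, c P) (psi c n)
  rw [norm_sub_rev] at this
  push_cast at hpsi ⊢
  linarith

/-- Primes in residue classes, with a weight depending on the class only. -/
theorem norm_sum_lam_sub_le (hs : s.Monic) {n : ℕ} (hn0 : n ≠ 0) (hn : l + s.natDegree ≤ n)
    (e : F[X] → ℂ) (he : ∀ f, ‖e f‖ ≤ 1)
    (hconst : ∀ f g : F[X], s ∣ f - g → (f - g).degree < ((n - l : ℕ) : WithBot ℕ) → e f = e g)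
    (U : Finset F[X]) (hU : ∀ f, f ∈ U ↔ f.natDegree ≤ n ∧ IsCoprime f s ∧ f.coeff n ≠ 0) :
    ‖∑ f ∈ U, (lam f : ℂ) * e f - (∑ f ∈ U, (lam f : ℂ)) * (∑ f ∈ U, e f) / U.card‖ ≤
      √(Fintype.card F ^ (s.natDegree + l + 1) : ℝ) *
        (Fintype.card F * ((l + s.natDegree + 2 : ℕ) * √(Fintype.card F) ^ n)) := by
  have := finite_classRing (l := l) hs
  have := Fintype.ofFinite (ClassRing s l)
  set M : ℝ := Fintype.card F * ((l + s.natDegree + 2 : ℕ) * √(Fintype.card F) ^ n) with hMdef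
  have hUeq : U = (polysLT F (n + 1)).filter fun f => IsUnit (cls s l n f) := by
    ext f
    rw [hU, Finset.mem_filter, mem_polysLT, degree_lt_succ_iff]
    refine and_congr_right fun h => ?_
    rw [isUnit_cls_iff h]
  have hsumU : ∀ h : F[X] → ℂ, ∑ f ∈ U, h f =
      ∑ u : (ClassRing s l)ˣ, ∑ f ∈ (polysLT F (n + 1)).filter (fun f => cls s l n f = u), h f := by
    intro h
    rw [← Finset.sum_fiberwise_of_maps_to (t := Finset.univ)
      (g := fun f => if hu : IsUnit (cls s l n f) then hu.unit else 1)
      (fun _ _ => Finset.mem_univ _)]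
    refine Finset.sum_congr rfl fun u _ => Finset.sum_congr ?_ fun _ _ => rfl
    ext f
    rw [hUeq, Finset.mem_filter, Finset.mem_filter, Finset.mem_filter]
    constructor
    · rintro ⟨⟨h1, h2⟩, h3⟩
      rw [dif_pos h2] at h3
      exact ⟨h1, by rw [← h3]; rfl⟩
    · rintro ⟨h1, h2⟩
      have h3 : IsUnit (cls s l n f) := h2 ▸ u.isUnit
      exact ⟨⟨h1, h3⟩, by rw [dif_pos h3]; exact Units.ext h2⟩
  have hfib : ∀ w : ClassRing s l, ∃ f : F[X], f.natDegree ≤ n ∧ cls s l n f = w := by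
    intro w
    have hcard := card_cls_fiber hs hn w
    have hpos : 0 < ((polysLT F (n + 1)).filter fun f => cls s l n f = w).card := by
      rw [hcard]
      exact pow_pos Fintype.card_pos _
    obtain ⟨f, hf⟩ := Finset.card_pos.1 hpos
    rw [Finset.mem_filter, mem_polysLT, degree_lt_succ_iff] at hf
    exact ⟨f, hf⟩
  choose rep hrep using hfib
  have herep : ∀ f : F[X], f.natDegree ≤ n → e f = e (rep (cls s l n f)) := by
    intro f hf
    have := (cls_eq_cls_iff (s := s) (by omega : l ≤ n) hf (hrep (cls s l n f)).1).1 (hrep _).2.symm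
    exact hconst _ _ this.1 this.2
  have hfibmem : ∀ {w : ClassRing s l} {f : F[X]},
      f ∈ (polysLT F (n + 1)).filter (fun f => cls s l n f = w) → e f = e (rep w) := by
    intro w f hf
    rw [Finset.mem_filter, mem_polysLT, degree_lt_succ_iff] at hf
    rw [herep f hf.1, hf.2]
  set θ : (ClassRing s l)ˣ → ℂ := fun u =>
    ∑ f ∈ (polysLT F (n + 1)).filter (fun f => cls s l n f = u), (lam f : ℂ) with hθ
  have key := norm_sum_mul_sub_le_fintype (fun u : (ClassRing s l)ˣ => e (rep u)) θ (fun u => he _)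
    (M := M) ?_ (by positivity)
  · have hE : ∑ f ∈ U, e f = (Fintype.card F : ℂ) ^ (n - l - s.natDegree) *
        ∑ u : (ClassRing s l)ˣ, e (rep u) := by
      rw [hsumU, Finset.mul_sum]
      refine Finset.sum_congr rfl fun u _ => ?_
      rw [Finset.sum_congr rfl fun f hf => hfibmem hf, Finset.sum_const, card_cls_fiber hs hn,
        nsmul_eq_mul, Nat.cast_pow]
    have hcard : (U.card : ℂ) = (Fintype.card F : ℂ) ^ (n - l - s.natDegree) *
        Fintype.card (ClassRing s l)ˣ := by
      have := hsumU fun _ => 1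
      rw [Finset.sum_const, nsmul_eq_mul, mul_one] at this
      rw [this, Finset.sum_congr rfl fun u _ => by
        rw [Finset.sum_const, card_cls_fiber hs hn, nsmul_eq_mul, mul_one]]
      rw [Finset.sum_const, Finset.card_univ, nsmul_eq_mul, Nat.cast_pow, mul_comm]
    have hq : (Fintype.card F : ℂ) ^ (n - l - s.natDegree) ≠ 0 :=
      pow_ne_zero _ (Nat.cast_ne_zero.2 Fintype.card_ne_zero)
    have h1 : ∑ f ∈ U, (lam f : ℂ) * e f = ∑ u : (ClassRing s l)ˣ, e (rep u) * θ u := by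
      rw [hsumU]
      refine Finset.sum_congr rfl fun u _ => ?_
      rw [hθ, Finset.mul_sum]
      refine Finset.sum_congr rfl fun f hf => ?_
      rw [hfibmem hf, mul_comm]
    have h2 : (∑ f ∈ U, (lam f : ℂ)) * (∑ f ∈ U, e f) / U.card =
        (∑ u : (ClassRing s l)ˣ, e (rep u)) * (∑ u, θ u) / Fintype.card (ClassRing s l)ˣ := by
      rw [hE, hcard, hsumU, hθ, mul_left_comm, mul_div_mul_left _ _ hq, mul_comm]
    rw [h1, h2]
    refine key.trans (mul_le_mul_of_nonneg_right (Real.sqrt_le_sqrt ?_) (by positivity))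
    have h3 : Fintype.card (ClassRing s l)ˣ ≤ Fintype.card (ClassRing s l) :=
      Fintype.card_le_of_injective _ Units.val_injective
    rw [← Nat.card_eq_fintype_card (α := ClassRing s l), card_classRing hs] at h3
    exact_mod_cast h3
  · intro χ hχ
    refine le_of_eq_of_le (congrArg norm ?_) (norm_sum_lam_mulChar_le hs hn0 χ hχ)
    have h1 : ∑ f ∈ U, (lam f : ℂ) * χ (cls s l n f) = ∑ u, θ u * χ u := by
      rw [hsumU]
      refine Finset.sum_congr rfl fun u _ => ?_
      rw [hθ, Finset.sum_mul]
      refine Finset.sum_congr rfl fun f hf => ?_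
      rw [(Finset.mem_filter.1 hf).2]
    rw [← h1]
    refine Finset.sum_subset (fun f hf => ?_) fun f hf hfU => ?_
    · rw [Finset.mem_filter, mem_polysLT, degree_lt_succ_iff]
      exact ⟨((hU f).1 hf).1, ((hU f).1 hf).2.2⟩
    · rw [Finset.mem_filter, mem_polysLT, degree_lt_succ_iff] at hf
      rw [χ.map_nonunit, mul_zero]
      rw [isUnit_cls_iff hf.1]
      exact fun h => hfU ((hU f).2 ⟨hf.1, h⟩)

end PrimeSums

section Additive

theorem eC_eq (x : LaurentSeries Fq) :
    eC p Fq x = ZMod.stdAddChar (Algebra.trace (ZMod p) Fq (x.coeff 1)) := by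
  rw [eC, ZMod.stdAddChar_apply, ZMod.toCircle_apply]

theorem eC_add (x y : LaurentSeries Fq) : eC p Fq (x + y) = eC p Fq x * eC p Fq y := by
  simp only [eC_eq, HahnSeries.coeff_add, map_add, AddChar.map_add_eq_mul]

theorem norm_eC (x : LaurentSeries Fq) : ‖eC p Fq x‖ = 1 := by
  rw [eC_eq, ZMod.stdAddChar_apply, Circle.norm_coe]

variable {Fq}

theorem eC_of_coeff_eq_zero {x : LaurentSeries Fq} (h : x.coeff 1 = 0) : eC p Fq x = 1 := by
  rw [eC_eq, h, map_zero, AddChar.map_zero_eq_one]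

theorem toK_monomial (n : ℕ) (a : Fq) :
    toK Fq (monomial n a) = HahnSeries.single (-n : ℤ) a := by
  have h : algebraMap Fq (LaurentSeries Fq) a = HahnSeries.single 0 a := by
    rw [HahnSeries.algebraMap_apply', PowerSeries.algebraMap_apply, Algebra.algebraMap_self_apply,
      HahnSeries.ofPowerSeries_C, HahnSeries.C_apply]
  rw [toK, aeval_monomial, Kt, HahnSeries.single_pow, h, HahnSeries.single_mul_single]
  simp

theorem toK_add (f g : Fq[X]) : toK Fq (f + g) = toK Fq f + toK Fq g := map_add _ _ _

theorem toK_sub (f g : Fq[X]) : toK Fq (f - g) = toK Fq f - toK Fq g := map_sub _ _ _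

theorem toK_mul (f g : Fq[X]) : toK Fq (f * g) = toK Fq f * toK Fq g := map_mul _ _ _

theorem coeff_toK_mul (f : Fq[X]) (y : LaurentSeries Fq) (k : ℤ) :
    (toK Fq f * y).coeff k = f.sum fun i a => a * y.coeff (k + i) := by
  conv_lhs => rw [f.as_sum_support]
  rw [toK, map_sum, Finset.sum_mul]
  rw [HahnSeries.coeff_sum, Polynomial.sum_def]
  refine Finset.sum_congr rfl fun i _ => ?_
  rw [← toK, toK_monomial, HahnSeries.coeff_single_mul, sub_neg_eq_add]

theorem coeff_toK (f : Fq[X]) (i : ℕ) : (toK Fq f).coeff (-i) = f.coeff i := by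
  rw [← mul_one (toK Fq f), coeff_toK_mul, Polynomial.sum_def]
  simp only [HahnSeries.coeff_one]
  rw [Finset.sum_eq_single i]
  · simp
  · intro b _ hb
    rw [if_neg (by omega), mul_zero]
  · intro h
    simpa using notMem_support_iff.1 h

theorem coeff_toK_of_pos (f : Fq[X]) {k : ℤ} (hk : 0 < k) : (toK Fq f).coeff k = 0 := by
  rw [← mul_one (toK Fq f), coeff_toK_mul, Polynomial.sum_def]
  simp only [HahnSeries.coeff_one]
  refine Finset.sum_eq_zero fun i _ => ?_
  rw [if_neg (by omega), mul_zero]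

theorem toK_ne_zero {f : Fq[X]} (hf : f ≠ 0) : toK Fq f ≠ 0 := by
  intro h
  refine leadingCoeff_ne_zero.2 hf ?_
  rw [leadingCoeff, ← coeff_toK, h, HahnSeries.coeff_zero]

theorem order_toK {f : Fq[X]} (hf : f ≠ 0) : (toK Fq f).order = -(f.natDegree : ℤ) := by
  refine le_antisymm (HahnSeries.order_le_of_coeff_ne_zero ?_) ?_
  · rw [coeff_toK]
    exact leadingCoeff_ne_zero.2 hf
  · by_contra! h
    refine HahnSeries.coeff_order_eq_zero.not.2 (toK_ne_zero hf) ?_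
    obtain ⟨i, hi⟩ : ∃ i : ℕ, (toK Fq f).order = -(i : ℤ) := ⟨(-(toK Fq f).order).toNat, by omega⟩
    rw [hi, coeff_toK]
    exact coeff_eq_zero_of_natDegree_lt (by omega)

/-- The additive character `f ↦ e(fy)` on polynomials. -/
def ev (y : LaurentSeries Fq) (f : Fq[X]) : ℂ := eC p Fq (toK Fq f * y)

variable {p}

theorem norm_ev (y : LaurentSeries Fq) (f : Fq[X]) : ‖ev p y f‖ = 1 := norm_eC p Fq _

theorem ev_add (y : LaurentSeries Fq) (f g : Fq[X]) : ev p y (f + g) = ev p y f * ev p y g := by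
  rw [ev, toK_add, add_mul, eC_add]
  rfl

theorem ev_add_left (y z : LaurentSeries Fq) (f : Fq[X]) : ev p (y + z) f = ev p y f * ev p z f := by
  rw [ev, mul_add, eC_add]
  rfl

theorem ev_mul (y : LaurentSeries Fq) (f g : Fq[X]) : ev p y (f * g) = ev p (toK Fq f * y) g := by
  rw [ev, ev, toK_mul]
  congr 1
  ring

theorem ev_toK (b f : Fq[X]) : ev p (toK Fq b) f = 1 := by
  rw [ev, ← toK_mul]
  exact eC_of_coeff_eq_zero p (coeff_toK_of_pos _ one_pos)

theorem ev_eq_one {n : ℕ} {y : LaurentSeries Fq} (hy : ∀ i : ℕ, 1 ≤ i → i ≤ n → y.coeff i = 0)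
    {f : Fq[X]} (hf : f.degree < n) : ev p y f = 1 := by
  refine eC_of_coeff_eq_zero p ?_
  rw [coeff_toK_mul, Polynomial.sum_def]
  refine Finset.sum_eq_zero fun i hi => ?_
  have h1 : i < n := by
    have := (le_degree_of_mem_supp i hi).trans_lt hf
    exact_mod_cast this
  have := hy (i + 1) (by omega) h1
  push_cast at this
  rw [add_comm, this, mul_zero]

theorem exists_ev_ne_one {y : LaurentSeries Fq} {i : ℕ} (hi : 1 ≤ i) (hy : y.coeff i ≠ 0) :
    ∃ f : Fq[X], f.degree < i ∧ ev p y f ≠ 1 := by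
  have htr := (traceForm_nondegenerate (ZMod p) Fq).1 (y.coeff i)
  simp_rw [Algebra.traceForm_apply] at htr
  obtain ⟨a, ha⟩ : ∃ a, Algebra.trace (ZMod p) Fq (y.coeff i * a) ≠ 0 := by
    by_contra! h
    exact hy (htr h)
  obtain ⟨j, rfl⟩ : ∃ j, i = j + 1 := ⟨i - 1, by omega⟩
  refine ⟨monomial j a, (degree_monomial_le _ _).trans_lt (by exact_mod_cast j.lt_succ_self), ?_⟩
  rw [ev, eC_eq, toK_monomial, HahnSeries.coeff_single_mul, sub_neg_eq_add, mul_comm a]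
  intro h
  rw [← AddChar.map_zero_eq_one (ZMod.stdAddChar (N := p))] at h
  refine ha ?_
  have := ZMod.injective_stdAddChar h
  rwa [add_comm] at this

theorem sum_ev_eq_zero {n : ℕ} {y : LaurentSeries Fq} {i : ℕ} (hi : 1 ≤ i) (hin : i ≤ n)
    (hy : y.coeff i ≠ 0) : ∑ f ∈ polysLT Fq n, ev p y f = 0 := by
  obtain ⟨g, hg, hne⟩ := exists_ev_ne_one (p := p) hi hy
  have hgn : g.degree < n := hg.trans_le (by exact_mod_cast hin)
  have h : ∑ f ∈ polysLT Fq n, ev p y f = ∑ f ∈ polysLT Fq n, ev p y (f + g) := by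
    symm
    refine Finset.sum_bij' (fun f _ => f + g) (fun f _ => f - g) ?_ ?_ ?_ ?_ ?_
    · intro f hf
      rw [mem_polysLT] at hf ⊢
      exact (degree_add_le _ _).trans_lt (max_lt hf hgn)
    · intro f hf
      rw [mem_polysLT] at hf ⊢
      exact (degree_sub_le _ _).trans_lt (max_lt hf hgn)
    · intros; ring
    · intros; ring
    · intros; rfl
  simp only [ev_add, ← Finset.sum_mul] at h
  have : (∑ f ∈ polysLT Fq n, ev p y f) * (ev p y g - 1) = 0 := by linear_combination -h
  exact (mul_eq_zero.1 this).resolve_right (sub_ne_zero.2 hne)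

theorem sum_ev_eq {n : ℕ} {y : LaurentSeries Fq} (hy : ∀ i : ℕ, 1 ≤ i → i ≤ n → y.coeff i = 0) :
    ∑ f ∈ polysLT Fq n, ev p y f = (Fintype.card Fq : ℂ) ^ n := by
  rw [Finset.sum_congr rfl fun f hf => ev_eq_one hy (mem_polysLT.1 hf), Finset.sum_const, card_polysLT]
  simp

end Additive

section Sieve

variable {Fq}

/-- The monic irreducible divisors of `s`. -/
def pdiv (s : Fq[X]) : Finset Fq[X] := (primesLE Fq s.natDegree).filter (· ∣ s)

theorem mem_pdiv {s P : Fq[X]} (hs : s ≠ 0) : P ∈ pdiv s ↔ P.Monic ∧ Irreducible P ∧ P ∣ s := by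
  rw [pdiv, Finset.mem_filter, mem_primesLE]
  constructor
  · rintro ⟨⟨h1, h2, _⟩, h3⟩
    exact ⟨h1, h2, h3⟩
  · rintro ⟨h1, h2, h3⟩
    exact ⟨⟨h1, h2, natDegree_le_of_dvd h3 hs⟩, h3⟩

theorem isCoprime_of_ne {P Q : Fq[X]} (hP : P.Monic ∧ Irreducible P) (hQ : Q.Monic ∧ Irreducible Q)
    (h : P ≠ Q) : IsCoprime P Q := by
  rw [hP.2.coprime_iff_not_dvd]
  intro hd
  exact h (eq_of_monic_of_associated hP.1 hQ.1 (hP.2.associated_of_dvd hQ.2 hd))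

theorem prod_dvd_iff {T : Finset Fq[X]} (hT : ∀ P ∈ T, P.Monic ∧ Irreducible P) {f : Fq[X]} :
    ∏ P ∈ T, P ∣ f ↔ ∀ P ∈ T, P ∣ f := by
  refine ⟨fun h P hP => (Finset.dvd_prod_of_mem _ hP).trans h, fun h => ?_⟩
  exact Finset.prod_dvd_of_coprime (fun P hP Q hQ hPQ => isCoprime_of_ne (hT P hP) (hT Q hQ) hPQ) h

theorem isCoprime_iff_pdiv {s : Fq[X]} (hs : s ≠ 0) (f : Fq[X]) :
    IsCoprime f s ↔ (pdiv s).filter (· ∣ f) = ∅ := by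
  rw [Finset.filter_eq_empty_iff]
  constructor
  · intro h P hP hPf
    rw [mem_pdiv hs] at hP
    exact hP.2.1.not_isUnit (h.isUnit_of_dvd' hPf hP.2.2)
  · intro h
    by_contra hc
    have hg : ¬ IsUnit (EuclideanDomain.gcd f s) := by
      rwa [EuclideanDomain.gcd_isUnit_iff]
    obtain ⟨P, hPm, hP, hPd⟩ := exists_monic_irreducible_factor _ hg
    exact h ((mem_pdiv hs).2 ⟨hPm, hP, hPd.trans (EuclideanDomain.gcd_dvd_right _ _)⟩)
      (hPd.trans (EuclideanDomain.gcd_dvd_left _ _))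

theorem indicator_isCoprime {s : Fq[X]} (hs : s ≠ 0) (f : Fq[X]) :
    (if IsCoprime f s then (1 : ℂ) else 0) =
      ∑ T ∈ (pdiv s).powerset, (-1) ^ T.card * if ∏ P ∈ T, P ∣ f then (1 : ℂ) else 0 := by
  have h := Finset.sum_powerset_neg_one_pow_card (x := (pdiv s).filter (· ∣ f))
  simp only [← isCoprime_iff_pdiv hs] at h
  have h' := congrArg (Int.cast : ℤ → ℂ) h
  push_cast at h'
  rw [← h']
  simp only [mul_ite, mul_one, mul_zero]
  rw [← Finset.sum_filter]
  refine Finset.sum_congr ?_ fun _ _ => rfl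
  ext T
  rw [Finset.mem_powerset, Finset.mem_filter, Finset.mem_powerset, Finset.subset_iff]
  simp only [Finset.mem_filter, forall_and]
  refine and_congr_right fun hT => ?_
  exact (prod_dvd_iff fun P hP =>
    ⟨((mem_pdiv hs).1 (hT P hP)).1, ((mem_pdiv hs).1 (hT P hP)).2.1⟩).symm

theorem sum_polysLT_dvd {d : Fq[X]} (hd : d.Monic) (n : ℕ) (h : Fq[X] → ℂ) :
    ∑ f ∈ (polysLT Fq n).filter (d ∣ ·), h f = ∑ g ∈ polysLT Fq (n - d.natDegree), h (d * g) := by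
  symm
  refine Finset.sum_bij (fun g _ => d * g) ?_ ?_ ?_ ?_
  · intro g hg
    rw [mem_polysLT] at hg
    rw [Finset.mem_filter, mem_polysLT]
    refine ⟨?_, dvd_mul_right _ _⟩
    rcases eq_or_ne g 0 with rfl | hg0
    · simp
    rw [mul_comm, degree_mul, degree_eq_natDegree hg0, degree_eq_natDegree hd.ne_zero]
    rw [degree_eq_natDegree hg0] at hg
    norm_cast at hg ⊢
    omega
  · intro a _ b _ hab
    exact mul_left_cancel₀ hd.ne_zero hab
  · rintro f hf
    rw [Finset.mem_filter, mem_polysLT] at hf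
    obtain ⟨hf, g, rfl⟩ := hf
    refine ⟨g, ?_, rfl⟩
    rw [mem_polysLT]
    rcases eq_or_ne g 0 with rfl | hg0
    · simp
    rw [mul_comm, degree_mul, degree_eq_natDegree hg0, degree_eq_natDegree hd.ne_zero] at hf
    rw [degree_eq_natDegree hg0]
    norm_cast at hf ⊢
    omega
  · intros; rfl

theorem monic_prod_of_subset {s : Fq[X]} (hs : s ≠ 0) {T : Finset Fq[X]} (hT : T ⊆ pdiv s) :
    (∏ P ∈ T, P).Monic ∧ ∏ P ∈ T, P ∣ s := by
  refine ⟨monic_prod_of_monic _ _ fun P hP => ((mem_pdiv hs).1 (hT hP)).1, ?_⟩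
  rw [prod_dvd_iff fun P hP => ⟨((mem_pdiv hs).1 (hT hP)).1, ((mem_pdiv hs).1 (hT hP)).2.1⟩]
  exact fun P hP => ((mem_pdiv hs).1 (hT hP)).2.2

theorem sum_isCoprime {s : Fq[X]} (hs : s ≠ 0) (n : ℕ) (h : Fq[X] → ℂ) :
    ∑ f ∈ (polysLT Fq n).filter (IsCoprime · s), h f =
      ∑ T ∈ (pdiv s).powerset, (-1) ^ T.card *
        ∑ g ∈ polysLT Fq (n - (∏ P ∈ T, P).natDegree), h ((∏ P ∈ T, P) * g) := by
  rw [Finset.sum_filter]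
  have : ∀ f : Fq[X], (if IsCoprime f s then h f else 0) = (if IsCoprime f s then 1 else 0) * h f := by
    intro f
    split_ifs <;> simp
  simp only [this]
  simp only [indicator_isCoprime hs, Finset.sum_mul]
  rw [Finset.sum_comm]
  refine Finset.sum_congr rfl fun T hT => ?_
  rw [← sum_polysLT_dvd (monic_prod_of_subset hs (Finset.mem_powerset.1 hT)).1, Finset.sum_filter,
    Finset.mul_sum]
  refine Finset.sum_congr rfl fun f _ => ?_
  split_ifs <;> simp

/-- The reduced residues modulo `s`. -/
def cop (s : Fq[X]) : Finset Fq[X] := (polysLT Fq s.natDegree).filter (IsCoprime · s)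

theorem card_isCoprime {s : Fq[X]} (hs : s ≠ 0) {n : ℕ} (hn : s.natDegree ≤ n) :
    ((polysLT Fq n).filter (IsCoprime · s)).card =
      Fintype.card Fq ^ (n - s.natDegree) * (cop s).card := by
  have h : ∀ n, s.natDegree ≤ n → (((polysLT Fq n).filter (IsCoprime · s)).card : ℂ) =
      ∑ T ∈ (pdiv s).powerset, (-1) ^ T.card *
        (Fintype.card Fq : ℂ) ^ (n - (∏ P ∈ T, P).natDegree) := by
    intro n hn
    have := sum_isCoprime hs n fun _ => 1
    rw [Finset.sum_const, nsmul_eq_mul, mul_one] at this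
    rw [this]
    refine Finset.sum_congr rfl fun T _ => ?_
    rw [Finset.sum_const, card_polysLT]
    simp
  have h2 : (((polysLT Fq n).filter (IsCoprime · s)).card : ℂ) =
      (Fintype.card Fq : ℂ) ^ (n - s.natDegree) * (cop s).card := by
    rw [cop, h n hn, h _ le_rfl, Finset.mul_sum]
    refine Finset.sum_congr rfl fun T hT => ?_
    have := natDegree_le_of_dvd (monic_prod_of_subset hs (Finset.mem_powerset.1 hT)).2 hs
    rw [mul_left_comm, ← pow_add]
    congr 2
    omega
  exact_mod_cast h2

theorem card_cop {s : Fq[X]} (hs : s.Monic) : (cop s).card = phiP Fq s := by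
  rw [phiP, ← Nat.card_eq_finsetCard]
  have hm : ∀ f : cop s, IsUnit (AdjoinRoot.mk s f) := fun f =>
    isUnit_adjoinRoot_mk_iff.2 (Finset.mem_filter.1 f.2).2
  refine Nat.card_eq_of_bijective (fun f : cop s => ((hm f).unit : (AdjoinRoot s)ˣ)) ⟨?_, ?_⟩
  · intro f g hfg
    have h1 := congrArg Units.val hfg
    simp only [IsUnit.unit_spec, AdjoinRoot.mk_eq_mk] at h1
    have hf := mem_polysLT.1 (Finset.mem_filter.1 f.2).1
    have hg := mem_polysLT.1 (Finset.mem_filter.1 g.2).1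
    refine Subtype.ext (sub_eq_zero.1 (eq_zero_of_dvd_of_degree_lt h1 ?_))
    rw [degree_eq_natDegree hs.ne_zero]
    exact (degree_sub_le _ _).trans_lt (max_lt hf hg)
  · intro u
    obtain ⟨g, hg⟩ := AdjoinRoot.mk_surjective u.val
    have h1 : AdjoinRoot.mk s (g %ₘ s) = u.val := by
      rw [← hg, AdjoinRoot.mk_eq_mk]
      exact ⟨-(g /ₘ s), by linear_combination modByMonic_add_div g s⟩
    have h2 : g %ₘ s ∈ cop s := by
      refine Finset.mem_filter.2 ⟨?_, isUnit_adjoinRoot_mk_iff.1 (h1 ▸ u.isUnit)⟩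
      rw [mem_polysLT, ← degree_eq_natDegree hs.ne_zero]
      exact degree_modByMonic_lt _ hs
    exact ⟨⟨_, h2⟩, Units.ext h1⟩

theorem squarefree_iff_prod_pdiv {s : Fq[X]} (hs : s.Monic) :
    Squarefree s ↔ ∏ P ∈ pdiv s, P = s := by
  have hT := monic_prod_of_subset hs.ne_zero (Finset.Subset.refl (pdiv s))
  constructor
  · intro hsq
    obtain ⟨k, hk⟩ := hT.2
    by_cases hu : IsUnit k
    · refine eq_of_monic_of_associated hT.1 hs ⟨hu.unit, hk.symm⟩
    · obtain ⟨P, hPm, hP, hPk⟩ := exists_monic_irreducible_factor _ hu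
      have hPs : P ∈ pdiv s := (mem_pdiv hs.ne_zero).2 ⟨hPm, hP, hPk.trans ⟨_, by rw [mul_comm]; exact hk⟩⟩
      refine absurd (hsq P ?_) hP.not_isUnit
      rw [hk]
      exact mul_dvd_mul (Finset.dvd_prod_of_mem _ hPs) hPk
  · intro h
    rw [← h]
    refine Finset.squarefree_prod_of_pairwise_isCoprime ?_ ?_
    · intro P hP Q hQ hPQ
      have hP' := (mem_pdiv hs.ne_zero).1 hP
      have hQ' := (mem_pdiv hs.ne_zero).1 hQ
      exact (isCoprime_of_ne ⟨hP'.1, hP'.2.1⟩ ⟨hQ'.1, hQ'.2.1⟩ hPQ).isRelPrime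
    · intro P hP
      exact ((mem_pdiv hs.ne_zero).1 hP).2.1.squarefree

theorem muP_eq {s : Fq[X]} (hs : s.Monic) :
    (muP Fq s : ℂ) = ∑ T ∈ (pdiv s).powerset, if ∏ P ∈ T, P = s then (-1) ^ T.card else 0 := by
  have hcard : {P : Fq[X] | P.Monic ∧ Irreducible P ∧ P ∣ s}.ncard = (pdiv s).card := by
    rw [← Set.ncard_coe_finset]
    congr 1
    ext P
    rw [Finset.mem_coe, mem_pdiv hs.ne_zero]
    rfl
  rw [Finset.sum_eq_single (pdiv s), muP, hcard]
  · simp only [squarefree_iff_prod_pdiv hs]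
    split_ifs <;> simp
  · intro T hT hne
    refine if_neg fun h => hne ?_
    rw [Finset.mem_powerset] at hT
    refine Finset.Subset.antisymm hT fun P hP => ?_
    rw [mem_pdiv hs.ne_zero] at hP
    have h1 := hP.2.2
    rw [← h] at h1
    obtain ⟨Q, hQ, hPQ⟩ := (Prime.dvd_finsetProd_iff hP.2.1.prime _).1 h1
    have hQ' := (mem_pdiv hs.ne_zero).1 (hT hQ)
    rwa [eq_of_monic_of_associated hP.1 hQ'.1 (hP.2.1.associated_of_dvd hQ'.2.1 hPQ)]
  · intro h
    exact absurd (Finset.mem_powerset_self _) h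

theorem norm_muP_le (s : Fq[X]) : ‖(muP Fq s : ℂ)‖ ≤ 1 := by
  rw [muP]
  split_ifs <;> simp

end Sieve

section Arcs

variable {p Fq}

theorem exists_coeff_div_ne_zero {b h : Fq[X]} (hh : h.Monic) (hb : ¬ h ∣ b) :
    ∃ i : ℕ, 1 ≤ i ∧ i ≤ h.natDegree ∧ (toK Fq b / toK Fq h).coeff i ≠ 0 := by
  set c := b %ₘ h with hc
  have hc0 : c ≠ 0 := fun h0 => hb ((modByMonic_eq_zero_iff_dvd hh).1 h0)
  have hcd : c.natDegree < h.natDegree := by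
    have := degree_modByMonic_lt b hh
    rw [← hc, degree_eq_natDegree hc0, degree_eq_natDegree hh.ne_zero] at this
    exact_mod_cast this
  have hK := toK_ne_zero hh.ne_zero
  have heq : toK Fq b / toK Fq h = toK Fq (b /ₘ h) + toK Fq c / toK Fq h := by
    rw [← modByMonic_add_div b h, toK_add, toK_mul]
    field_simp
    rw [modByMonic_add_div, add_comm]
  have hz : toK Fq c / toK Fq h ≠ 0 := div_ne_zero (toK_ne_zero hc0) hK
  have hord : (toK Fq c / toK Fq h).order = ((h.natDegree - c.natDegree : ℕ) : ℤ) := by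
    have := HahnSeries.order_mul hz hK
    rw [div_mul_cancel₀ _ hK, order_toK hc0, order_toK hh.ne_zero] at this
    omega
  refine ⟨h.natDegree - c.natDegree, by omega, by omega, ?_⟩
  rw [heq, HahnSeries.coeff_add, coeff_toK_of_pos _ (by omega), zero_add, ← hord]
  exact HahnSeries.coeff_order_eq_zero.not.2 hz

theorem sum_ev_div_add {b h : Fq[X]} (hh : h.Monic) (hb : ¬ h ∣ b) {β : LaurentSeries Fq}
    (hβ : ∀ i : ℕ, 1 ≤ i → i ≤ h.natDegree → β.coeff i = 0) {n : ℕ} (hn : h.natDegree ≤ n) :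
    ∑ f ∈ polysLT Fq n, ev p (toK Fq b / toK Fq h + β) f = 0 := by
  obtain ⟨i, hi1, hi2, hi⟩ := exists_coeff_div_ne_zero hh hb
  refine sum_ev_eq_zero hi1 (hi2.trans hn) ?_
  rwa [HahnSeries.coeff_add, hβ i hi1 hi2, add_zero]

theorem coeff_toK_mul_eq_zero {m : ℕ} {β : LaurentSeries Fq}
    (hβ : ∀ i : ℕ, 1 ≤ i → i ≤ m → β.coeff i = 0) (d : Fq[X]) {i : ℕ} (hi : 1 ≤ i)
    (him : i + d.natDegree ≤ m) : (toK Fq d * β).coeff i = 0 := by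
  rw [coeff_toK_mul, Polynomial.sum_def]
  refine Finset.sum_eq_zero fun j hj => ?_
  have := le_natDegree_of_mem_supp j hj
  have h := hβ (i + j) (by omega) (by omega)
  push_cast at h
  rw [h, mul_zero]

theorem sum_ev_toK_mul {s : Fq[X]} (hs : s.Monic) {β : LaurentSeries Fq}
    (hβ : ∀ i : ℕ, 1 ≤ i → i ≤ s.natDegree → β.coeff i = 0) {n : ℕ} (hn : s.natDegree ≤ n) :
    (Fintype.card Fq : ℂ) ^ s.natDegree * ∑ f ∈ polysLT Fq (n - s.natDegree), ev p (toK Fq s * β) f =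
      ∑ f ∈ polysLT Fq n, ev p β f := by
  by_cases h : ∀ i : ℕ, 1 ≤ i → i ≤ n → β.coeff i = 0
  · rw [sum_ev_eq h, sum_ev_eq fun i hi hin => coeff_toK_mul_eq_zero h s hi (by omega), ← pow_add,
      Nat.add_sub_cancel' hn]
  · push Not at h
    set k := Nat.find h with hk
    obtain ⟨hk1, hkn, hk0⟩ := Nat.find_spec h
    have hmin : ∀ i : ℕ, 1 ≤ i → i < k → β.coeff i = 0 := by
      intro i hi hik
      by_contra h0
      exact Nat.find_min h hik ⟨hi, by omega, h0⟩
    have hks : s.natDegree < k := by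
      by_contra! hc
      exact hk0 (hβ _ hk1 hc)
    rw [sum_ev_eq_zero hk1 hkn hk0, sum_ev_eq_zero (i := k - s.natDegree) (by omega) (by omega),
      mul_zero]
    rw [coeff_toK_mul, Polynomial.sum_def, Finset.sum_eq_single s.natDegree]
    · rw [coeff_natDegree, hs.leadingCoeff, one_mul]
      rwa [Nat.cast_sub hks.le, sub_add_cancel]
    · intro j hj hne
      have hj' := le_natDegree_of_mem_supp j hj
      have := hmin (k - s.natDegree + j) (by omega) (by omega)
      rw [← Nat.cast_add, this, mul_zero]
    · intro hnot
      rw [notMem_support_iff.1 hnot, zero_mul]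

theorem sum_isCoprime_ev {s a : Fq[X]} (hs : s.Monic) (ha : IsCoprime a s) {β : LaurentSeries Fq}
    (hβ : ∀ i : ℕ, 1 ≤ i → i ≤ s.natDegree → β.coeff i = 0) {n : ℕ} (hn : s.natDegree ≤ n) :
    (Fintype.card Fq : ℂ) ^ s.natDegree *
      ∑ f ∈ (polysLT Fq n).filter (IsCoprime · s), ev p (toK Fq a / toK Fq s + β) f =
      muP Fq s * ∑ f ∈ polysLT Fq n, ev p β f := by
  rw [sum_isCoprime hs.ne_zero, muP_eq hs, ← sum_ev_toK_mul hs hβ hn, mul_left_comm]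
  congr 1
  rw [Finset.sum_mul]
  refine Finset.sum_congr rfl fun T hT => ?_
  obtain ⟨hTm, h, hh⟩ := monic_prod_of_subset hs.ne_zero (Finset.mem_powerset.1 hT)
  set d := ∏ P ∈ T, P with hd
  have hhm : h.Monic := hTm.of_mul_monic_left (hh ▸ hs)
  have hdeg : s.natDegree = d.natDegree + h.natDegree := by rw [hh, hTm.natDegree_mul hhm]
  have hev : ∀ g, ev p (toK Fq a / toK Fq s + β) (d * g) =
      ev p (toK Fq a / toK Fq h + toK Fq d * β) g := by
    intro g
    rw [ev_mul, mul_add, hh, toK_mul]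
    have h1 := toK_ne_zero hTm.ne_zero
    have h2 := toK_ne_zero hhm.ne_zero
    congr 2
    field_simp
  simp only [hev]
  by_cases hds : d = s
  · have hh1 : h = 1 := by
      refine mul_left_cancel₀ hTm.ne_zero ?_
      rw [← hh, mul_one, hds]
    rw [if_pos hds, hds, hh1]
    congr 1
    refine Finset.sum_congr rfl fun g _ => ?_
    rw [ev_add_left, show toK Fq a / toK Fq 1 = toK Fq a by simp [toK], ev_toK, one_mul]
  · rw [if_neg hds, zero_mul, sum_ev_div_add hhm, mul_zero]
    · intro hdvd
      have hu : IsUnit h := ha.isUnit_of_dvd' hdvd ⟨d, by rw [mul_comm]; exact hh⟩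
      rw [hhm.isUnit_iff] at hu
      exact hds (by rw [hh, hu, mul_one])
    · exact fun i hi hih => coeff_toK_mul_eq_zero hβ d hi (by omega)
    · omega

theorem exists_polynomial_part (x : LaurentSeries Fq) :
    ∃ b : Fq[X], ∀ i : ℤ, i ≤ 0 → (x - toK Fq b).coeff i = 0 := by
  set K : ℕ := (1 - x.order).toNat with hK
  refine ⟨∑ i ∈ Finset.range K, monomial i (x.coeff (-i)), fun i hi => ?_⟩
  obtain ⟨j, rfl⟩ : ∃ j : ℕ, i = -(j : ℤ) := ⟨(-i).toNat, by omega⟩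
  rw [HahnSeries.coeff_sub, coeff_toK, finsetSum_coeff]
  simp only [coeff_monomial]
  rw [Finset.sum_ite_eq']
  split_ifs with h
  · rw [sub_self]
  · rw [Finset.mem_range] at h
    rw [sub_zero, HahnSeries.coeff_eq_zero_of_lt_order]
    omega

theorem exists_mul_coeff_eq_zero (y : LaurentSeries Fq) (M : ℕ) :
    ∃ g : Fq[X], g ≠ 0 ∧ g.natDegree ≤ M ∧
      ∀ i : ℕ, 1 ≤ i → i ≤ M → (toK Fq g * y).coeff i = 0 := by
  obtain ⟨g, hg, h, hh, hne, heq⟩ := Finset.exists_ne_map_eq_of_card_lt_of_maps_to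
    (s := polysLT Fq (M + 1)) (t := (Finset.univ : Finset (Fin M → Fq)))
    (f := fun g i => (toK Fq g * y).coeff ((i : ℕ) + 1 : ℕ)) (by
      rw [card_polysLT, Finset.card_univ, Fintype.card_fun, Fintype.card_fin]
      exact Nat.pow_lt_pow_right Fintype.one_lt_card M.lt_succ_self)
    (fun _ _ => Finset.mem_univ _)
  refine ⟨g - h, sub_ne_zero.2 hne, ?_, fun i hi hiM => ?_⟩
  · rw [mem_polysLT, degree_lt_succ_iff] at hg hh
    exact (natDegree_sub_le _ _).trans (max_le hg hh)
  · have := congrFun heq ⟨i - 1, by omega⟩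
    simp only [Nat.sub_add_cancel hi] at this
    rw [toK_sub, sub_mul, HahnSeries.coeff_sub, this, sub_self]

/-- Dirichlet approximation. -/
theorem exists_approx (y : LaurentSeries Fq) (M : ℕ) :
    ∃ (s a : Fq[X]) (β : LaurentSeries Fq), s.Monic ∧ s.natDegree ≤ M ∧ IsCoprime a s ∧
      y = toK Fq a / toK Fq s + β ∧ ∀ i : ℕ, 1 ≤ i → i ≤ M + s.natDegree → β.coeff i = 0 := by
  obtain ⟨g, hg0, hgM, hg⟩ := exists_mul_coeff_eq_zero y M
  obtain ⟨b, hb⟩ := exists_polynomial_part (toK Fq g * y)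
  set t := toK Fq g * y - toK Fq b with ht
  have htc : ∀ i : ℤ, i ≤ M → t.coeff i = 0 := by
    intro i hi
    rcases le_or_gt i 0 with h0 | h0
    · exact hb i h0
    · obtain ⟨j, rfl⟩ : ∃ j : ℕ, i = j := ⟨i.toNat, by omega⟩
      rw [ht, HahnSeries.coeff_sub, hg j (by omega) (by omega), coeff_toK_of_pos _ h0, sub_zero]
  have hgK := toK_ne_zero hg0
  set d := EuclideanDomain.gcd b g with hd
  have hd0 : d ≠ 0 := fun h => hg0 (EuclideanDomain.gcd_eq_zero_iff.1 h).2
  obtain ⟨b', hb'⟩ := EuclideanDomain.gcd_dvd_left b g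
  obtain ⟨g', hg'⟩ := EuclideanDomain.gcd_dvd_right b g
  rw [← hd] at hb' hg'
  have hg'0 : g' ≠ 0 := by
    rintro rfl
    exact hg0 (by rw [hg', mul_zero])
  have hcop : IsCoprime b' g' := by
    obtain ⟨u, v, huv⟩ : ∃ u v, d = b * u + g * v := ⟨_, _, EuclideanDomain.gcd_eq_gcd_ab b g⟩
    refine ⟨u, v, mul_left_cancel₀ hd0 ?_⟩
    rw [mul_one]
    conv_rhs => rw [huv, hb', hg']
    ring
  have hc0 : g'.leadingCoeff⁻¹ ≠ 0 := inv_ne_zero (leadingCoeff_ne_zero.2 hg'0)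
  have hcK := toK_ne_zero (C_ne_zero.2 hc0)
  have hdK := toK_ne_zero hd0
  have hg'K := toK_ne_zero hg'0
  have hdeg : (C g'.leadingCoeff⁻¹ * g').natDegree = g'.natDegree := natDegree_C_mul hc0
  have hdeg' : g'.natDegree ≤ g.natDegree := natDegree_le_of_dvd ⟨d, by rw [mul_comm]; exact hg'⟩ hg0
  refine ⟨C g'.leadingCoeff⁻¹ * g', C g'.leadingCoeff⁻¹ * b', t / toK Fq g, ?_, ?_, ?_, ?_, ?_⟩
  · rw [Monic, leadingCoeff_mul, leadingCoeff_C, inv_mul_cancel₀ (leadingCoeff_ne_zero.2 hg'0)]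
  · rw [hdeg]
    exact hdeg'.trans hgM
  · have hu : IsUnit (C g'.leadingCoeff⁻¹) := isUnit_C.2 hc0.isUnit
    rwa [isCoprime_mul_unit_left hu]
  · have h1 : toK Fq (C g'.leadingCoeff⁻¹ * b') / toK Fq (C g'.leadingCoeff⁻¹ * g') =
        toK Fq b / toK Fq g := by
      rw [toK_mul, toK_mul, mul_div_mul_left _ _ hcK, hb', hg', toK_mul, toK_mul,
        mul_div_mul_left _ _ hdK]
    rw [h1, ht]
    field_simp
    ring
  · intro i _ hi
    rw [hdeg] at hi
    rcases eq_or_ne t 0 with h0 | h0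
    · rw [h0, zero_div, HahnSeries.coeff_zero]
    · refine HahnSeries.coeff_eq_zero_of_lt_order ?_
      have h1 := HahnSeries.order_mul (div_ne_zero h0 hgK) hgK
      rw [div_mul_cancel₀ _ hgK, order_toK hg0] at h1
      have h2 : (M : ℤ) < t.order := by
        by_contra! h2
        exact HahnSeries.coeff_order_eq_zero.not.2 h0 (htc _ h2)
      omega

end Arcs

section MajorArc

variable {p Fq}

/-- The polynomials of degree exactly `n`. -/
def exactDeg (F : Type*) [Field F] [Fintype F] (n : ℕ) : Finset F[X] :=
  (polysLT F (n + 1)).filter fun f => f.coeff n ≠ 0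

theorem mem_exactDeg {n : ℕ} {f : Fq[X]} :
    f ∈ exactDeg Fq n ↔ f.natDegree ≤ n ∧ f.coeff n ≠ 0 := by
  rw [exactDeg, Finset.mem_filter, mem_polysLT, degree_lt_succ_iff]

theorem sum_polysLT_succ_filter (n : ℕ) (r : Fq[X] → Prop) (h : Fq[X] → ℂ) :
    ∑ f ∈ (polysLT Fq (n + 1)).filter r, h f =
      ∑ f ∈ (polysLT Fq n).filter r, h f + ∑ f ∈ (exactDeg Fq n).filter r, h f := by
  rw [← Finset.sum_filter_add_sum_filter_not _ (fun f => f.coeff n = 0), Finset.filter_filter,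
    Finset.filter_filter]
  congr 1
  · refine Finset.sum_congr ?_ fun _ _ => rfl
    ext f
    rw [Finset.mem_filter, Finset.mem_filter, mem_polysLT, mem_polysLT, degree_lt_iff_coeff_zero,
      degree_lt_iff_coeff_zero]
    constructor
    · rintro ⟨h1, h2, h3⟩
      refine ⟨fun m hm => ?_, h2⟩
      rcases hm.eq_or_lt with rfl | hm
      · exact h3
      · exact h1 m hm
    · rintro ⟨h1, h2⟩
      exact ⟨fun m hm => h1 m (by omega), h2, h1 n le_rfl⟩
  · refine Finset.sum_congr ?_ fun _ _ => rfl
    ext f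
    rw [exactDeg, Finset.mem_filter, Finset.mem_filter, Finset.mem_filter]
    tauto

theorem sum_polysLT_succ (n : ℕ) (h : Fq[X] → ℂ) :
    ∑ f ∈ polysLT Fq (n + 1), h f = ∑ f ∈ polysLT Fq n, h f + ∑ f ∈ exactDeg Fq n, h f := by
  simpa using sum_polysLT_succ_filter n (fun _ => True) h

theorem sum_exactDeg_lam (n : ℕ) :
    ∑ f ∈ exactDeg Fq n, (lam f : ℂ) = ((Fintype.card Fq : ℂ) - 1) * (n * (primesEQ Fq n).card) := by
  rw [exactDeg, sum_polysLT_coeff_ne_zero]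
  simp only [lam_C_mul]
  rw [Finset.sum_const, Finset.card_univ, Fintype.card_units, nsmul_eq_mul,
    Nat.cast_sub Fintype.card_pos, Nat.cast_one]
  congr 1
  have : primesEQ Fq n = (monics Fq n).filter Irreducible := by
    ext P
    rw [mem_primesEQ, Finset.mem_filter, mem_monics, and_assoc]
  rw [this, Finset.card_filter]
  push_cast
  rw [Finset.mul_sum]
  refine Finset.sum_congr rfl fun g hg => ?_
  rw [lam]
  split_ifs
  · rw [(mem_monics.1 hg).2]
    simp
  · simp

theorem norm_mul_card_primesEQ_sub_le {n : ℕ} (hn : n ≠ 0) :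
    ‖(n * (primesEQ Fq n).card : ℂ) - (Fintype.card Fq : ℂ) ^ n‖ ≤ 2 * √(Fintype.card Fq) ^ n := by
  have h := norm_psi_sub_le (F := Fq) (fun _ => 1) (fun _ => by simp) hn
  rw [norm_sub_rev]
  simpa [psi_one hn] using h

theorem card_cop_pos {s : Fq[X]} (hs : s.Monic) : 0 < (cop s).card := by
  rw [Finset.card_pos]
  rcases Nat.eq_zero_or_pos s.natDegree with h | h
  · refine ⟨0, Finset.mem_filter.2 ⟨?_, ?_⟩⟩
    · rw [mem_polysLT]
      simp
    · rw [eq_one_of_monic_natDegree_zero hs h]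
      exact isCoprime_one_right
  · refine ⟨1, Finset.mem_filter.2 ⟨?_, isCoprime_one_left⟩⟩
    rw [mem_polysLT, degree_one]
    exact_mod_cast h

theorem norm_sum_exactDeg_sub_le {s a : Fq[X]} (hs : s.Monic) (ha : IsCoprime a s) {M : ℕ}
    (hsM : s.natDegree ≤ M) {β : LaurentSeries Fq}
    (hβ : ∀ i : ℕ, 1 ≤ i → i ≤ M + s.natDegree → β.coeff i = 0) {n K : ℕ} (hMn : M < n)
    (hMK : M ≤ K) (hnK : n ≤ M + K) :
    ‖∑ f ∈ exactDeg Fq n, (lam f : ℂ) * ev p (toK Fq a / toK Fq s + β) f -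
      muP Fq s / (cop s).card * ∑ f ∈ exactDeg Fq n, ev p β f‖ ≤
      Fintype.card Fq * (K + 4) * √(Fintype.card Fq) ^ (K + 1) * √(Fintype.card Fq) ^ n := by
  set y := toK Fq a / toK Fq s + β with hy
  set q : ℝ := (Fintype.card Fq : ℝ) with hq
  have hq1 : 1 ≤ q := Nat.one_le_cast.2 Fintype.card_pos
  have hsq1 : 1 ≤ √q := Real.one_le_sqrt.2 hq1
  set U := (exactDeg Fq n).filter (IsCoprime · s) with hU
  have hUmem : ∀ f, f ∈ U ↔ f.natDegree ≤ n ∧ IsCoprime f s ∧ f.coeff n ≠ 0 := by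
    intro f
    rw [hU, Finset.mem_filter, mem_exactDeg]
    tauto
  have hlamU : ∀ f ∈ exactDeg Fq n, f ∉ U → (lam f : ℂ) = 0 := by
    intro f hf hfU
    rw [lam]
    split_ifs with hirr
    · refine absurd (Finset.mem_filter.2 ⟨hf, ?_⟩) hfU
      rw [hirr.coprime_iff_not_dvd]
      intro hd
      have h1 := natDegree_le_of_dvd hd hs.ne_zero
      have h2 := le_natDegree_of_ne_zero (mem_exactDeg.1 hf).2
      omega
    · simp
  have hUsub : U ⊆ exactDeg Fq n := Finset.filter_subset _ _
  have h1 : ∑ f ∈ exactDeg Fq n, (lam f : ℂ) * ev p y f = ∑ f ∈ U, (lam f : ℂ) * ev p y f :=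
    (Finset.sum_subset hUsub fun f hf hfU => by rw [hlamU f hf hfU, zero_mul]).symm
  have h2 : ∑ f ∈ U, (lam f : ℂ) = ((Fintype.card Fq : ℂ) - 1) * (n * (primesEQ Fq n).card) := by
    rw [← sum_exactDeg_lam]
    exact Finset.sum_subset hUsub hlamU
  have h3 : (Fintype.card Fq : ℂ) ^ s.natDegree * ∑ f ∈ U, ev p y f =
      muP Fq s * ∑ f ∈ exactDeg Fq n, ev p β f := by
    have hβ' : ∀ i : ℕ, 1 ≤ i → i ≤ s.natDegree → β.coeff i = 0 := fun i hi hi' =>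
      hβ i hi (by omega)
    have e1 := sum_isCoprime_ev (p := p) hs ha hβ' (n := n + 1) (by omega)
    have e2 := sum_isCoprime_ev (p := p) hs ha hβ' (n := n) (by omega)
    rw [sum_polysLT_succ_filter, sum_polysLT_succ] at e1
    linear_combination e1 - e2
  have h4 : (U.card : ℂ) = (Fintype.card Fq : ℂ) ^ (n - s.natDegree) *
      ((Fintype.card Fq : ℂ) - 1) * (cop s).card := by
    have e1 := card_isCoprime hs.ne_zero (n := n + 1) (by omega)
    have e2 := card_isCoprime hs.ne_zero (n := n) (by omega)
    have e3 := sum_polysLT_succ_filter n (IsCoprime · s) (fun _ : Fq[X] => 1)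
    simp only [Finset.sum_const, nsmul_eq_mul, mul_one] at e3
    rw [e1, e2, Nat.sub_add_comm (by omega), pow_succ] at e3
    push_cast at e3
    linear_combination -e3
  have hq0 : (Fintype.card Fq : ℂ) ≠ 0 := Nat.cast_ne_zero.2 Fintype.card_ne_zero
  have hq10 : (Fintype.card Fq : ℂ) - 1 ≠ 0 := by
    rw [sub_ne_zero]
    exact_mod_cast Fintype.one_lt_card.ne'
  have hcop0 : ((cop s).card : ℂ) ≠ 0 := Nat.cast_ne_zero.2 (card_cop_pos hs).ne'
  set ε : ℂ := (n * (primesEQ Fq n).card : ℂ) - (Fintype.card Fq : ℂ) ^ n with hε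
  have hεle : ‖ε‖ ≤ 2 * √q ^ n := norm_mul_card_primesEQ_sub_le (by omega)
  have hmain : (∑ f ∈ U, (lam f : ℂ)) * (∑ f ∈ U, ev p y f) / U.card =
      muP Fq s / (cop s).card * ∑ f ∈ exactDeg Fq n, ev p β f +
        ((Fintype.card Fq : ℂ) - 1) * ε * ((∑ f ∈ U, ev p y f) / U.card) := by
    have e1 : muP Fq s / (cop s).card * ∑ f ∈ exactDeg Fq n, ev p β f =
        (Fintype.card Fq : ℂ) ^ s.natDegree * (∑ f ∈ U, ev p y f) / (cop s).card := by
      rw [h3]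
      ring
    have e2 : (Fintype.card Fq : ℂ) ^ n =
        (Fintype.card Fq : ℂ) ^ (n - s.natDegree) * (Fintype.card Fq : ℂ) ^ s.natDegree := by
      rw [← pow_add, Nat.sub_add_cancel (by omega)]
    have e3 : (n * (primesEQ Fq n).card : ℂ) = ε + (Fintype.card Fq : ℂ) ^ n := by
      rw [hε]
      ring
    rw [e1, h2, e3, h4, e2]
    field_simp
    ring
  have hratio : ‖(∑ f ∈ U, ev p y f) / U.card‖ ≤ 1 := by
    rw [norm_div, Complex.norm_natCast]
    refine div_le_one_of_le₀ ((norm_sum_le _ _).trans ?_) (Nat.cast_nonneg _)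
    simp [norm_ev]
  have hq1norm : ‖(Fintype.card Fq : ℂ) - 1‖ ≤ q := by
    rw [← Nat.cast_one, ← Nat.cast_sub Fintype.card_pos, Complex.norm_natCast]
    exact Nat.cast_le.2 (Nat.sub_le _ _)
  have hkey := norm_sum_lam_sub_le (l := n - (M + s.natDegree)) hs (by omega : n ≠ 0) (by omega)
    (ev p y) (fun f => (norm_ev y f).le) (fun f g hd hdeg => by
      rw [← sub_add_cancel f g, ev_add, hy, ev_add_left]
      obtain ⟨k, hk⟩ := hd
      rw [ev_eq_one hβ (f := f - g), mul_one, hk, ev_mul, mul_div_cancel₀ _ (toK_ne_zero hs.ne_zero),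
        ev_toK, one_mul]
      refine hdeg.trans_le ?_
      exact_mod_cast (by omega : n - (n - (M + s.natDegree)) ≤ M + s.natDegree)) U hUmem
  have hexp : √(q ^ (s.natDegree + (n - (M + s.natDegree)) + 1) : ℝ) ≤ √q ^ (K + 1) := by
    rw [Real.sqrt_le_left (by positivity), ← pow_mul, mul_comm, pow_mul, Real.sq_sqrt (by positivity)]
    exact pow_le_pow_right₀ hq1 (by omega)
  have hcast : ((n - (M + s.natDegree) + s.natDegree + 2 : ℕ) : ℝ) ≤ K + 2 := by
    exact_mod_cast (by omega : n - (M + s.natDegree) + s.natDegree + 2 ≤ K + 2)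
  rw [h1]
  have hsplit : ∑ f ∈ U, (lam f : ℂ) * ev p y f -
      muP Fq s / (cop s).card * ∑ f ∈ exactDeg Fq n, ev p β f =
      (∑ f ∈ U, (lam f : ℂ) * ev p y f -
        (∑ f ∈ U, (lam f : ℂ)) * (∑ f ∈ U, ev p y f) / U.card) +
        ((Fintype.card Fq : ℂ) - 1) * ε * ((∑ f ∈ U, ev p y f) / U.card) := by
    rw [hmain]
    ring
  rw [hsplit]
  refine (norm_add_le _ _).trans ?_
  have b1 : √(q ^ (s.natDegree + (n - (M + s.natDegree)) + 1) : ℝ) *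
      (q * ((n - (M + s.natDegree) + s.natDegree + 2 : ℕ) * √q ^ n)) ≤
      √q ^ (K + 1) * (q * ((K + 2) * √q ^ n)) := by gcongr
  have b2 : ‖((Fintype.card Fq : ℂ) - 1) * ε * ((∑ f ∈ U, ev p y f) / U.card)‖ ≤
      q * (2 * √q ^ n) * 1 := by
    rw [norm_mul, norm_mul]
    gcongr
  have b3 : q * (2 * √q ^ n) * 1 ≤ √q ^ (K + 1) * (q * (2 * √q ^ n)) := by
    rw [mul_one]
    exact le_mul_of_one_le_left (by positivity) (one_le_pow₀ hsq1)
  calc _ ≤ √q ^ (K + 1) * (q * ((K + 2) * √q ^ n)) + √q ^ (K + 1) * (q * (2 * √q ^ n)) :=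
        add_le_add (hkey.trans b1) (b2.trans b3)
    _ = _ := by ring

theorem lam_le {n : ℕ} {f : Fq[X]} (hf : f.natDegree ≤ n) : ‖(lam f : ℂ)‖ ≤ n := by
  rw [lam]
  split_ifs
  · simpa using hf
  · simp

theorem norm_muP_div_le (s : Fq[X]) (c : ℕ) : ‖(muP Fq s / c : ℂ)‖ ≤ 1 := by
  rw [norm_div, Complex.norm_natCast]
  rcases Nat.eq_zero_or_pos c with rfl | hc
  · simp
  · exact div_le_one_of_le₀ ((norm_muP_le s).trans (by exact_mod_cast hc)) (Nat.cast_nonneg _)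

/-- The exponential sum over irreducible polynomials near a rational point. -/
theorem norm_sum_lam_ev_sub_le {s a : Fq[X]} (hs : s.Monic) (ha : IsCoprime a s) {M K : ℕ}
    (hsM : s.natDegree ≤ M) {β : LaurentSeries Fq}
    (hβ : ∀ i : ℕ, 1 ≤ i → i ≤ M + s.natDegree → β.coeff i = 0) (hMK : M ≤ K) :
    ‖∑ f ∈ polysLT Fq (M + K + 1), (lam f : ℂ) * ev p (toK Fq a / toK Fq s + β) f -
      muP Fq s / (cop s).card * ∑ f ∈ polysLT Fq (M + K + 1), ev p β f‖ ≤
      (K + 1) * (Fintype.card Fq * (K + 4) * √(Fintype.card Fq) ^ (K + 1) *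
        √(Fintype.card Fq) ^ (M + K)) := by
  set q : ℝ := (Fintype.card Fq : ℝ) with hq
  have hq1 : 1 ≤ q := Nat.one_le_cast.2 Fintype.card_pos
  have hsq1 : 1 ≤ √q := Real.one_le_sqrt.2 hq1
  set B := q * (K + 4) * √q ^ (K + 1) * √q ^ (M + K) with hB
  have key : ∀ j, j ≤ K →
      ‖∑ f ∈ polysLT Fq (M + j + 1), (lam f : ℂ) * ev p (toK Fq a / toK Fq s + β) f -
      muP Fq s / (cop s).card * ∑ f ∈ polysLT Fq (M + j + 1), ev p β f‖ ≤ (j + 1) * B := by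
    intro j
    induction j with
    | zero =>
      intro _
      have hcard : ((polysLT Fq (M + 1)).card : ℝ) = q ^ (M + 1) := by
        rw [card_polysLT]
        simp [hq]
      have e1 : ‖∑ f ∈ polysLT Fq (M + 1), (lam f : ℂ) * ev p (toK Fq a / toK Fq s + β) f‖ ≤
          q ^ (M + 1) * M := by
        rw [← hcard, ← nsmul_eq_mul]
        refine norm_sum_le_of_le _ (f := fun f => (lam f : ℂ) * ev p (toK Fq a / toK Fq s + β) f)
          (n := fun _ => (M : ℝ)) (fun f hf => ?_) |>.trans (by rw [Finset.sum_const])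
        rw [norm_mul, norm_ev, mul_one]
        rw [mem_polysLT, degree_lt_succ_iff] at hf
        exact lam_le hf
      have e2 : ‖(muP Fq s / (cop s).card : ℂ) * ∑ f ∈ polysLT Fq (M + 1), ev p β f‖ ≤
          1 * q ^ (M + 1) := by
        rw [norm_mul, ← hcard]
        refine mul_le_mul (norm_muP_div_le _ _) ((norm_sum_le _ _).trans ?_) (norm_nonneg _) zero_le_one
        simp [norm_ev]
      have e3 : q ^ M ≤ √q ^ (M + K) := by
        calc q ^ M = √q ^ (M + M) := by
              rw [← two_mul, pow_mul, Real.sq_sqrt (by positivity)]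
          _ ≤ _ := pow_le_pow_right₀ hsq1 (by omega)
      have hMK' : (M : ℝ) ≤ K := by exact_mod_cast hMK
      rw [add_zero, Nat.cast_zero, zero_add, one_mul]
      refine (norm_sub_le _ _).trans ((add_le_add e1 e2).trans ?_)
      calc q ^ (M + 1) * M + 1 * q ^ (M + 1) = q * (M + 1) * 1 * q ^ M := by ring
        _ ≤ B := by
          rw [hB]
          gcongr
          · norm_num
          · exact one_le_pow₀ hsq1
    | succ j ih =>
      intro hj
      have e1 := ih (by omega)
      have e2 := norm_sum_exactDeg_sub_le (p := p) hs ha hsM hβ (n := M + (j + 1)) (by omega) hMK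
        (by omega)
      have e3 : q * (K + 4) * √q ^ (K + 1) * √q ^ (M + (j + 1)) ≤ B := by
        rw [hB]
        gcongr
      rw [sum_polysLT_succ, sum_polysLT_succ, mul_add, add_sub_add_comm]
      refine (norm_add_le _ _).trans ((add_le_add e1 (e2.trans e3)).trans_eq ?_)
      push_cast
      ring
  exact key K le_rfl

end MajorArc

section LambdaSide

variable {p Fq}

/-- The monic squarefree polynomials of degree at most `n`. -/
def sqf (F : Type) [Field F] [Fintype F] (n : ℕ) : Finset F[X] :=
  (polysLT F (n + 1)).filter fun g => g.Monic ∧ Squarefree g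

theorem mem_sqf {n : ℕ} {g : Fq[X]} :
    g ∈ sqf Fq n ↔ g.Monic ∧ Squarefree g ∧ g.natDegree ≤ n := by
  rw [sqf, Finset.mem_filter, mem_polysLT, degree_lt_succ_iff]
  tauto

/-- The Ramanujan sum as a finite sum. -/
def ram (p : ℕ) [Fact p.Prime] [Algebra (ZMod p) Fq] (g f : Fq[X]) : ℂ :=
  ∑ b ∈ cop g, ev p (toK Fq b / toK Fq g) f

theorem mem_cop {b g : Fq[X]} (hg : g ≠ 0) : b ∈ cop g ↔ b.degree < g.degree ∧ IsCoprime b g := by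
  rw [cop, Finset.mem_filter, mem_polysLT, degree_eq_natDegree hg]

theorem ramanujanC_eq {g : Fq[X]} (hg : g ≠ 0) (f : Fq[X]) :
    ramanujanC p Fq g f = ram p g f := by
  have hset : {a : Fq[X] | a.degree < g.degree ∧ IsCoprime a g} = ↑(cop g) := by
    ext b
    rw [Finset.mem_coe, mem_cop hg, Set.mem_ofPred_eq]
  rw [ramanujanC, hset, finsum_mem_coe_finset, ram]
  refine Finset.sum_congr rfl fun b _ => ?_
  rw [ev, toK_mul, mul_comm (toK Fq b), mul_div_assoc]

theorem setOf_sqf {X : ℝ} (hX : 0 ≤ X) :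
    {g : Fq[X] | g.Monic ∧ Squarefree g ∧ (g.natDegree : ℝ) ≤ X} = ↑(sqf Fq ⌊X⌋₊) := by
  ext g
  rw [Finset.mem_coe, mem_sqf, Set.mem_ofPred_eq, Nat.le_floor_iff hX]

/-- The truncated Ramanujan expansion of the von Mangoldt function as a finite sum. -/
def lamX (p : ℕ) [Fact p.Prime] [Algebra (ZMod p) Fq] (n : ℕ) (f : Fq[X]) : ℂ :=
  ∑ g ∈ sqf Fq n, (muP Fq g / (cop g).card : ℂ) * ram p g f

theorem LambdaX_eq {X : ℝ} (hX : 0 ≤ X) (f : Fq[X]) :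
    LambdaX p Fq X f = lamX p ⌊X⌋₊ f := by
  rw [LambdaX, setOf_sqf hX, finsum_mem_coe_finset, lamX]
  refine Finset.sum_congr rfl fun g hg => ?_
  have hm := (mem_sqf.1 hg).1
  rw [ramanujanC_eq hm.ne_zero, card_cop hm]

/-- The coefficients of the sieve weight. -/
def alp (g : Fq[X]) : ℂ := ∏ P ∈ pdiv g, (1 : ℂ) / ((pnorm Fq P : ℂ) + 3)

theorem HXf_eq {X : ℝ} (hX : 0 ≤ X) (f : Fq[X]) :
    HXf p Fq X f = ∑ g ∈ sqf Fq ⌊X⌋₊, alp g * ram p g f := by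
  rw [HXf, setOf_sqf hX, finsum_mem_coe_finset]
  refine Finset.sum_congr rfl fun g hg => ?_
  have hm := (mem_sqf.1 hg).1
  have hset : {P : Fq[X] | P.Monic ∧ Irreducible P ∧ P ∣ g} = ↑(pdiv g) := by
    ext P
    rw [Finset.mem_coe, mem_pdiv hm.ne_zero, Set.mem_ofPred_eq]
  rw [ramanujanC_eq hm.ne_zero, hset, finprod_mem_coe_finset, alp]

theorem sum_ram_ev {s a g : Fq[X]} (hs : s.Monic) (ha : IsCoprime a s) (hg : g.Monic) {n : ℕ}
    (hn : g.natDegree + s.natDegree ≤ n) {β : LaurentSeries Fq}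
    (hβ : ∀ i : ℕ, 1 ≤ i → i ≤ g.natDegree + s.natDegree → β.coeff i = 0) :
    ∑ f ∈ polysLT Fq n, ram p g f * ev p (toK Fq a / toK Fq s + β) f =
      if g = s then ∑ f ∈ polysLT Fq n, ev p β f else 0 := by
  have hsK := toK_ne_zero hs.ne_zero
  have hgK := toK_ne_zero hg.ne_zero
  have hdeg : (g * s).natDegree = g.natDegree + s.natDegree := hg.natDegree_mul hs
  have hterm : ∀ b, ∑ f ∈ polysLT Fq n, ev p (toK Fq b / toK Fq g) f *
      ev p (toK Fq a / toK Fq s + β) f =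
      ∑ f ∈ polysLT Fq n, ev p (toK Fq (b * s + a * g) / toK Fq (g * s) + β) f := by
    intro b
    refine Finset.sum_congr rfl fun f _ => ?_
    rw [← ev_add_left, toK_add, toK_mul, toK_mul, toK_mul, ← add_assoc]
    congr 2
    field_simp
  have hzero : ∀ b, ¬ g * s ∣ b * s + a * g → ∑ f ∈ polysLT Fq n, ev p (toK Fq b / toK Fq g) f *
      ev p (toK Fq a / toK Fq s + β) f = 0 := by
    intro b hb
    rw [hterm]
    exact sum_ev_div_add (hg.mul hs) hb (by rwa [hdeg]) (by rwa [hdeg])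
  simp only [ram, Finset.sum_mul]
  rw [Finset.sum_comm]
  split_ifs with hgs
  · subst hgs
    set b₀ := (-a) %ₘ g with hb₀
    have hdvd : g ∣ b₀ + a := by
      obtain ⟨c, hc⟩ : g ∣ b₀ - -a := by
        rw [hb₀, ← neg_sub, dvd_neg]
        exact ⟨(-a) /ₘ g, by rw [sub_eq_iff_eq_add', modByMonic_add_div]⟩
      exact ⟨c, by rw [← hc]; ring⟩
    have hlt : b₀.degree < g.degree := degree_modByMonic_lt _ hg
    rw [Finset.sum_eq_single b₀]
    · obtain ⟨k, hk⟩ := hdvd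
      refine Finset.sum_congr rfl fun f _ => ?_
      rw [← ev_add_left, ← add_assoc, ← add_div, ← toK_add, hk, toK_mul, mul_div_cancel_left₀ _ hgK,
        ev_add_left, ev_toK, one_mul]
    · intro b hb hne
      refine hzero b fun hd => hne ?_
      rw [← add_mul] at hd
      have h1 : g ∣ b + a := (mul_dvd_mul_iff_right hg.ne_zero).1 hd
      have h2 : g ∣ b - b₀ := by
        have := dvd_sub h1 hdvd
        rwa [add_sub_add_right_eq_sub] at this
      have h3 := eq_zero_of_dvd_of_degree_lt h2
        ((degree_sub_le _ _).trans_lt (max_lt ((mem_cop hg.ne_zero).1 hb).1 hlt))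
      exact sub_eq_zero.1 h3
    · intro hnot
      refine absurd ((mem_cop hg.ne_zero).2 ⟨hlt, ?_⟩) hnot
      obtain ⟨k, hk⟩ := hdvd
      have : b₀ = -a + g * k := by rw [← hk]; ring
      rw [this]
      exact (IsCoprime.neg_left ha).add_mul_left_left k
  · refine Finset.sum_eq_zero fun b hb => hzero b fun hd => hgs ?_
    have hbg := ((mem_cop hg.ne_zero).1 hb).2
    have h1 : g ∣ s := by
      have h := (dvd_add_left (Dvd.intro_left a rfl)).1 ((Dvd.intro s rfl).trans hd)
      exact hbg.symm.dvd_of_dvd_mul_left h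
    have h2 : s ∣ g := by
      have h := (dvd_add_right (Dvd.intro_left b rfl)).1 ((Dvd.intro_left g rfl).trans hd)
      exact ha.symm.dvd_of_dvd_mul_left h
    exact eq_of_monic_of_associated hg hs (associated_of_dvd_dvd h1 h2)

theorem sum_lamX_ev {s a : Fq[X]} (hs : s.Monic) (ha : IsCoprime a s) {X n : ℕ}
    (hn : X + s.natDegree ≤ n) {β : LaurentSeries Fq}
    (hβ : ∀ i : ℕ, 1 ≤ i → i ≤ X + s.natDegree → β.coeff i = 0) :
    ∑ f ∈ polysLT Fq n, lamX p X f * ev p (toK Fq a / toK Fq s + β) f =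
      if s.natDegree ≤ X then
        (muP Fq s / (cop s).card : ℂ) * ∑ f ∈ polysLT Fq n, ev p β f else 0 := by
  have h1 : ∑ f ∈ polysLT Fq n, lamX p X f * ev p (toK Fq a / toK Fq s + β) f =
      ∑ g ∈ sqf Fq X, (muP Fq g / (cop g).card : ℂ) *
        if g = s then ∑ f ∈ polysLT Fq n, ev p β f else 0 := by
    simp only [lamX, Finset.sum_mul]
    rw [Finset.sum_comm]
    refine Finset.sum_congr rfl fun g hg => ?_
    obtain ⟨hgm, -, hgX⟩ := mem_sqf.1 hg
    rw [← sum_ram_ev (p := p) hs ha hgm (by omega) fun i hi hi' => hβ i hi (by omega), Finset.mul_sum]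
    exact Finset.sum_congr rfl fun f _ => mul_assoc _ _ _
  rw [h1]
  simp only [mul_ite, mul_zero, Finset.sum_ite_eq', mem_sqf]
  by_cases hsq : Squarefree s
  · simp [hs, hsq]
  · simp [hsq, muP]

end LambdaSide

section Uniform

variable {p Fq}

theorem mul_card_filter_dvd_le {s : Fq[X]} (hs : s ≠ 0) (n : ℕ) :
    n * ((primesEQ Fq n).filter (· ∣ s)).card ≤ s.natDegree := by
  set D := (primesEQ Fq n).filter (· ∣ s) with hD
  have hmem : ∀ P ∈ D, P.Monic ∧ P.natDegree = n ∧ Irreducible P ∧ P ∣ s := by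
    intro P hP
    rw [hD, Finset.mem_filter, mem_primesEQ] at hP
    tauto
  have hsub : D ⊆ pdiv s := by
    intro P hP
    have := hmem P hP
    rw [mem_pdiv hs]
    tauto
  have hdeg : (∏ P ∈ D, P).natDegree = n * D.card := by
    rw [natDegree_prod_of_monic _ _ fun P hP => (hmem P hP).1,
      Finset.sum_congr rfl fun P hP => (hmem P hP).2.1, Finset.sum_const, smul_eq_mul, mul_comm]
  rw [← hdeg]
  exact natDegree_le_of_dvd (monic_prod_of_subset hs hsub).2 hs

theorem mul_card_primesEQ_le_cop {s : Fq[X]} (hs : s ≠ 0) {n : ℕ} (hn : n < s.natDegree) :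
    n * (primesEQ Fq n).card ≤ n * (cop s).card + s.natDegree := by
  rw [← Finset.card_filter_add_card_filter_not (· ∣ s), mul_add, add_comm]
  refine add_le_add (Nat.mul_le_mul_left _ (Finset.card_le_card fun P hP => ?_))
    (mul_card_filter_dvd_le hs n)
  rw [Finset.mem_filter, mem_primesEQ] at hP
  refine (mem_cop hs).2 ⟨degree_lt_degree (by omega), ?_⟩
  exact hP.1.2.2.coprime_iff_not_dvd.2 hP.2

/-- A lower bound for the number of residues coprime to `s`. -/
theorem pow_le_mul_card_cop {s : Fq[X]} (hs : s ≠ 0) (h8 : 8 ≤ s.natDegree) :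
    (Fintype.card Fq : ℝ) ^ s.natDegree ≤ 4 * Fintype.card Fq * s.natDegree * (cop s).card := by
  obtain ⟨n, hn⟩ : ∃ n, s.natDegree = n + 1 := ⟨s.natDegree - 1, by omega⟩
  set q : ℝ := (Fintype.card Fq : ℝ) with hq
  have hq2 : (2 : ℝ) ≤ q := by
    rw [hq]
    exact_mod_cast Fintype.one_lt_card (α := Fq)
  have h1 := mul_card_primesEQ_le_cop hs (n := n) (by omega)
  have h1' : (n : ℝ) * (primesEQ Fq n).card ≤ n * (cop s).card + (n + 1) := by
    rw [hn] at h1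
    exact_mod_cast h1
  have h2 := norm_mul_card_primesEQ_sub_le (Fq := Fq) (n := n) (by omega)
  have h3 : q ^ n - 2 * √q ^ n ≤ n * (primesEQ Fq n).card := by
    have e : (n * (primesEQ Fq n).card : ℂ) - (Fintype.card Fq : ℂ) ^ n =
        ((n * (primesEQ Fq n).card - q ^ n : ℝ) : ℂ) := by
      push_cast [hq]
      rfl
    rw [e, Complex.norm_real, Real.norm_eq_abs] at h2
    linarith [(abs_le.1 h2).1]
  have h4 : q ^ n = √q ^ n * √q ^ n := by
    rw [← mul_pow, Real.mul_self_sqrt (by positivity)]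
  have h5 : (2 : ℝ) ^ n ≤ q ^ n := by gcongr
  have h6 : ∀ m : ℕ, 7 ≤ m → 4 * (m + 1) ≤ 2 ^ m := by
    intro m hm
    induction m, hm using Nat.le_induction with
    | base => norm_num
    | succ m hm ih =>
      rw [pow_succ]
      omega
  have h7 : (4 : ℝ) * (n + 1) ≤ 2 ^ n := by exact_mod_cast h6 n (by omega)
  have h8' : (64 : ℝ) ≤ q ^ n := by
    have : (2 : ℝ) ^ 7 ≤ 2 ^ n := pow_le_pow_right₀ (by norm_num) (by omega)
    norm_num at this
    linarith
  have h9 : 8 ≤ √q ^ n := by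
    have : 0 ≤ √q ^ n := by positivity
    nlinarith
  have h10 : q ^ n ≤ 4 * (n * (cop s).card) := by nlinarith
  rw [hn, pow_succ]
  push_cast
  have h11 : (0 : ℝ) ≤ (cop s).card := Nat.cast_nonneg _
  nlinarith [mul_le_mul_of_nonneg_right h10 (by positivity : 0 ≤ q),
    mul_nonneg h11 (by positivity : 0 ≤ q)]

theorem norm_sum_ev_le (y : LaurentSeries Fq) (n : ℕ) :
    ‖∑ f ∈ polysLT Fq n, ev p y f‖ ≤ (Fintype.card Fq : ℝ) ^ n := by
  refine (norm_sum_le _ _).trans_eq ?_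
  simp [norm_ev, card_polysLT]

/-- The von Mangoldt function is uniformly close to its truncated Ramanujan expansion in the
Fourier sense. -/
theorem norm_sum_lam_sub_lamX_le {N : ℕ} (hN : 32 ≤ N) (y : LaurentSeries Fq) :
    ‖∑ f ∈ polysLT Fq (N + 1), ((lam f : ℂ) - lamX p (N / 4) f) * ev p y f‖ ≤
      5 * (Fintype.card Fq : ℝ) ^ 2 * (N + 5) ^ 2 * (Fintype.card Fq : ℝ) ^ (3 / 4 * (N : ℝ)) := by
  obtain ⟨s, a, β, hs, hsM, ha, rfl, hβ⟩ := exists_approx y (N / 2)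
  set M := N / 2 with hM
  obtain ⟨K, hK⟩ : ∃ K, N = M + K := ⟨N - M, by omega⟩
  have h1 := norm_sum_lam_ev_sub_le (p := p) hs ha hsM hβ (K := K) (by omega)
  have h2 := sum_lamX_ev (p := p) hs ha (X := N / 4) (n := N + 1) (by omega) (β := β)
    (fun i hi hi' => hβ i hi (by omega))
  rw [← hK] at h1
  set q : ℝ := (Fintype.card Fq : ℝ) with hq
  have hq1 : 1 ≤ q := Nat.one_le_cast.2 Fintype.card_pos
  have hq0 : 0 < q := by linarith
  set R := q ^ (3 / 4 * (N : ℝ)) with hR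
  have hR0 : 0 < R := Real.rpow_pos_of_pos hq0 _
  have hK2 : ((K : ℝ) + 1) * 2 ≤ N + 3 := by exact_mod_cast (by omega : (K + 1) * 2 ≤ N + 3)
  have hKN : (K : ℝ) ≤ N := by exact_mod_cast (by omega : K ≤ N)
  have hA : (K + 1) * (q * (K + 4) * √q ^ (K + 1) * √q ^ N) ≤ q ^ 2 * (N + 5) ^ 2 * R := by
    have e1 : √q ^ (K + 1) * √q ^ N ≤ q * R := by
      rw [← pow_add, Real.sqrt_eq_rpow, ← Real.rpow_natCast, ← Real.rpow_mul hq0.le, hR]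
      nth_rewrite 2 [← Real.rpow_one q]
      rw [← Real.rpow_add hq0]
      refine Real.rpow_le_rpow_of_exponent_le hq1 ?_
      push_cast
      linarith
    calc (K + 1) * (q * (K + 4) * √q ^ (K + 1) * √q ^ N)
        = (K + 1) * (K + 4) * q * (√q ^ (K + 1) * √q ^ N) := by ring
      _ ≤ (N + 5) * (N + 5) * q * (q * R) := by
          gcongr <;> linarith
      _ = _ := by ring
  simp only [sub_mul, Finset.sum_sub_distrib]
  rw [h2]
  have hN0 : (0 : ℝ) ≤ N := Nat.cast_nonneg _
  split_ifs with hr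
  · refine (h1.trans hA).trans ?_
    have : 0 ≤ q ^ 2 * (N + 5) ^ 2 * R := by positivity
    linarith
  · rw [sub_zero]
    set V := ∑ f ∈ polysLT Fq (N + 1), ev p β f with hV
    have hcop : (0 : ℝ) < (cop s).card := Nat.cast_pos.2 (card_cop_pos hs)
    have hr' : (N : ℝ) ≤ 4 * s.natDegree := by exact_mod_cast (by omega : N ≤ 4 * s.natDegree)
    have hrN : (s.natDegree : ℝ) ≤ N := by exact_mod_cast (by omega : s.natDegree ≤ N)
    have hlow := pow_le_mul_card_cop hs.ne_zero (by omega)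
    rw [← hq] at hlow
    have hB : ‖(muP Fq s / (cop s).card : ℂ) * V‖ ≤ 4 * N * q ^ 2 * R := by
      rw [norm_mul, norm_div, Complex.norm_natCast]
      have e1 : q ^ (N + 1) ≤ 4 * N * q ^ 2 * R * (cop s).card := by
        have e2 : q ^ N ≤ R * q ^ s.natDegree := by
          rw [hR, ← Real.rpow_natCast, ← Real.rpow_natCast, ← Real.rpow_add hq0]
          refine Real.rpow_le_rpow_of_exponent_le hq1 ?_
          linarith
        calc q ^ (N + 1) = q ^ N * q := pow_succ _ _
          _ ≤ R * q ^ s.natDegree * q := mul_le_mul_of_nonneg_right e2 hq0.le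
          _ ≤ R * (4 * q * N * (cop s).card) * q := by
            refine mul_le_mul_of_nonneg_right (mul_le_mul_of_nonneg_left (hlow.trans ?_) hR0.le) hq0.le
            exact mul_le_mul_of_nonneg_right (mul_le_mul_of_nonneg_left hrN (by positivity)) hcop.le
          _ = _ := by ring
      calc _ ≤ 1 / ((cop s).card : ℝ) * q ^ (N + 1) :=
            mul_le_mul (div_le_div_of_nonneg_right (norm_muP_le s) hcop.le) (norm_sum_ev_le _ _)
              (norm_nonneg _) (div_nonneg zero_le_one hcop.le)
        _ ≤ _ := by
            rw [one_div_mul_eq_div]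
            exact (div_le_iff₀ hcop).2 e1
    have e3 : ∑ f ∈ polysLT Fq (N + 1), (lam f : ℂ) * ev p (toK Fq a / toK Fq s + β) f =
        (∑ f ∈ polysLT Fq (N + 1), (lam f : ℂ) * ev p (toK Fq a / toK Fq s + β) f -
          muP Fq s / (cop s).card * V) + muP Fq s / (cop s).card * V := by ring
    rw [e3]
    refine (norm_add_le _ _).trans ((add_le_add (h1.trans hA) hB).trans ?_)
    have e4 : (N : ℝ) ≤ (N + 5) ^ 2 := by nlinarith
    calc _ ≤ q ^ 2 * (N + 5) ^ 2 * R + 4 * (N + 5) ^ 2 * q ^ 2 * R := by gcongr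
      _ = _ := by ring

end Uniform

section Assembly

variable {p Fq}

/-- Multiplication by `h` increases the uniform norm of a Fourier transform by a factor of at
most `W`. -/
def TrigBound (p : ℕ) [Fact p.Prime] [Algebra (ZMod p) Fq] (h : Fq[X] → ℂ) (W : ℝ) : Prop :=
  ∀ (S : Finset Fq[X]) (D : Fq[X] → ℂ) (K : ℝ), (∀ y, ‖∑ f ∈ S, D f * ev p y f‖ ≤ K) →
    ∀ y, ‖∑ f ∈ S, D f * h f * ev p y f‖ ≤ W * K

theorem trigBound_ev (z : LaurentSeries Fq) : TrigBound p (ev p z) 1 := by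
  intro S D K hK y
  rw [one_mul]
  refine le_of_eq_of_le (congrArg norm (Finset.sum_congr rfl fun f _ => ?_)) (hK (z + y))
  rw [ev_add_left, mul_assoc]

theorem TrigBound.mono {h : Fq[X] → ℂ} {W W' : ℝ} (H : TrigBound p h W) (hW : W ≤ W') :
    TrigBound p h W' := fun S D K hK y =>
  (H S D K hK y).trans (mul_le_mul_of_nonneg_right hW ((norm_nonneg _).trans (hK 0)))

theorem TrigBound.sum {ι : Type*} {T : Finset ι} {w : ι → ℂ} {h : ι → Fq[X] → ℂ} {W : ι → ℝ}
    (H : ∀ i ∈ T, TrigBound p (h i) (W i)) :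
    TrigBound p (fun f => ∑ i ∈ T, w i * h i f) (∑ i ∈ T, ‖w i‖ * W i) := by
  intro S D K hK y
  have e : ∑ f ∈ S, D f * (∑ i ∈ T, w i * h i f) * ev p y f =
      ∑ i ∈ T, w i * ∑ f ∈ S, D f * h i f * ev p y f := by
    simp only [Finset.mul_sum, Finset.sum_mul]
    rw [Finset.sum_comm]
    refine Finset.sum_congr rfl fun i _ => Finset.sum_congr rfl fun f _ => ?_
    ring
  rw [e, Finset.sum_mul]
  refine norm_sum_le_of_le _ fun i hi => ?_
  rw [norm_mul, mul_assoc]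
  exact mul_le_mul_of_nonneg_left (H i hi S D K hK y) (norm_nonneg _)

theorem trigBound_ram (g c : Fq[X]) : TrigBound p (fun f => ram p g (f - c)) (cop g).card := by
  have h := TrigBound.sum (p := p) (T := cop g) (w := fun b => ev p (toK Fq b / toK Fq g) (-c))
    (h := fun b => ev p (toK Fq b / toK Fq g)) (W := fun _ => 1) fun b _ => trigBound_ev _
  simp only [norm_ev, mul_one, Finset.sum_const, nsmul_eq_mul] at h
  convert h using 3 with f
  refine Finset.sum_congr rfl fun b _ => ?_
  rw [sub_eq_neg_add, ev_add]

theorem trigBound_sum_ram (n : ℕ) (w : Fq[X] → ℂ)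
    (hw : ∀ g ∈ sqf Fq n, ‖w g‖ * (cop g).card ≤ 1) (c : Fq[X]) :
    TrigBound p (fun f => ∑ g ∈ sqf Fq n, w g * ram p g (f - c)) ((Fintype.card Fq : ℝ) ^ (n + 1)) := by
  refine (TrigBound.sum fun g _ => trigBound_ram g c).mono ((Finset.sum_le_sum hw).trans ?_)
  rw [Finset.sum_const, nsmul_eq_mul, mul_one]
  have := Finset.card_filter_le (polysLT Fq (n + 1)) fun g => g.Monic ∧ Squarefree g
  rw [card_polysLT] at this
  exact_mod_cast this

theorem norm_muP_div_mul_card_le {g : Fq[X]} (hg : g.Monic) :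
    ‖(muP Fq g / (cop g).card : ℂ)‖ * (cop g).card ≤ 1 := by
  have h0 : ((cop g).card : ℝ) ≠ 0 := Nat.cast_ne_zero.2 (card_cop_pos hg).ne'
  rw [norm_div, Complex.norm_natCast, div_mul_cancel₀ _ h0]
  exact norm_muP_le g

theorem norm_alp_mul_card_le {g : Fq[X]} (hg : g.Monic) (hsq : Squarefree g) :
    ‖alp g‖ * (cop g).card ≤ 1 := by
  have h1 : ((cop g).card : ℝ) ≤ (Fintype.card Fq : ℝ) ^ g.natDegree := by
    have := Finset.card_filter_le (polysLT Fq g.natDegree) (IsCoprime · g)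
    rw [card_polysLT] at this
    exact_mod_cast this
  have hmem : ∀ P ∈ pdiv g, P.Monic := fun P hP => ((mem_pdiv hg.ne_zero).1 hP).1
  have h2 : (Fintype.card Fq : ℝ) ^ g.natDegree = ∏ P ∈ pdiv g, pnorm Fq P := by
    conv_lhs => rw [← (squarefree_iff_prod_pdiv hg).1 hsq]
    rw [natDegree_prod_of_monic _ _ hmem, ← Finset.prod_pow_eq_pow_sum]
    refine Finset.prod_congr rfl fun P hP => ?_
    rw [pnorm, if_neg (hmem P hP).ne_zero]
  refine (mul_le_mul_of_nonneg_left h1 (norm_nonneg _)).trans ?_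
  rw [h2, alp, norm_prod, ← Finset.prod_mul_distrib]
  refine Finset.prod_le_one (fun P _ => ?_) fun P _ => ?_ <;>
  have h0 : 0 ≤ pnorm Fq P := by
    rw [pnorm]
    split_ifs <;> positivity
  · positivity
  · have e : ((pnorm Fq P : ℂ) + 3) = ((pnorm Fq P + 3 : ℝ) : ℂ) := by push_cast; rfl
    rw [norm_div, norm_one, e, Complex.norm_real, Real.norm_of_nonneg (by positivity),
      one_div_mul_eq_div]
    exact div_le_one_of_le₀ (by linarith) (by positivity)

theorem sum_polysLT_add_one (N : ℕ) (h : Fq[X] → ℂ) :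
    ∑ f ∈ polysLT Fq (N + 1), h (f + 1) = ∑ f ∈ polysLT Fq (N + 1), h f := by
  refine Finset.sum_nbij' (· + 1) (· - 1) ?_ ?_ (fun f _ => by simp) (fun f _ => by simp)
    fun _ _ => rfl
  · intro f hf
    rw [mem_polysLT, degree_lt_succ_iff] at hf ⊢
    exact (natDegree_add_le _ _).trans (max_le hf (by simp))
  · intro f hf
    rw [mem_polysLT, degree_lt_succ_iff] at hf ⊢
    exact (natDegree_sub_le _ _).trans (max_le hf (by simp))

theorem norm_sum_shift_le {N : ℕ} (hN : 32 ≤ N) (y : LaurentSeries Fq) :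
    ‖∑ f ∈ polysLT Fq (N + 1), ((lam (f + 1) : ℂ) - lamX p (N / 4) (f + 1)) * ev p y f‖ ≤
      5 * (Fintype.card Fq : ℝ) ^ 2 * (N + 5) ^ 2 * (Fintype.card Fq : ℝ) ^ (3 / 4 * (N : ℝ)) := by
  have e : ∑ f ∈ polysLT Fq (N + 1), ((lam (f + 1) : ℂ) - lamX p (N / 4) (f + 1)) * ev p y f =
      ev p y (-1) *
        ∑ f ∈ polysLT Fq (N + 1), ((lam f : ℂ) - lamX p (N / 4) f) * ev p y f := by
    rw [← sum_polysLT_add_one N fun f => ((lam f : ℂ) - lamX p (N / 4) f) * ev p y f, Finset.mul_sum]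
    refine Finset.sum_congr rfl fun f _ => ?_
    conv_lhs => rw [← add_neg_cancel_right f 1, ev_add, add_neg_cancel_right]
    ring
  rw [e, norm_mul, norm_ev, one_mul]
  exact norm_sum_lam_sub_lamX_le hN y

theorem norm_sum_shift_mul_mul_le {N : ℕ} (hN : 32 ≤ N) (y : LaurentSeries Fq) :
    ‖∑ f ∈ polysLT Fq (N + 1), ((lam (f + 1) : ℂ) - lamX p (N / 4) (f + 1)) *
      lamX p (N / 12) (f - 1) * (∑ g ∈ sqf Fq (N / 12), alp g * ram p g f) * ev p y f‖ ≤
      5 * (Fintype.card Fq : ℝ) ^ 4 * (N + 5) ^ 2 * (Fintype.card Fq : ℝ) ^ (11 / 12 * (N : ℝ)) := by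
  have h1 := trigBound_sum_ram (p := p) (N / 12) (fun g : Fq[X] => (muP Fq g / (cop g).card : ℂ))
    (fun g hg => norm_muP_div_mul_card_le (mem_sqf.1 hg).1) 1
  have h2 := trigBound_sum_ram (p := p) (N / 12) (alp (Fq := Fq))
    (fun g hg => norm_alp_mul_card_le (mem_sqf.1 hg).1 (mem_sqf.1 hg).2.1) 0
  simp only [sub_zero] at h2
  refine (h2 _ _ _ (h1 _ _ _ fun y => norm_sum_shift_le (p := p) hN y) y).trans ?_
  set q : ℝ := (Fintype.card Fq : ℝ) with hq
  have hq1 : 1 ≤ q := Nat.one_le_cast.2 Fintype.card_pos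
  have hq0 : 0 < q := by linarith
  have hdiv : ((N / 12 : ℕ) : ℝ) ≤ N / 12 := Nat.cast_div_le
  have e : q ^ (N / 12) * q ^ (N / 12) * q ^ (3 / 4 * (N : ℝ)) ≤ q ^ (11 / 12 * (N : ℝ)) := by
    rw [← pow_add, ← Real.rpow_natCast, ← Real.rpow_add hq0]
    refine Real.rpow_le_rpow_of_exponent_le hq1 ?_
    push_cast
    linarith
  calc _ = 5 * q ^ 4 * (N + 5) ^ 2 * (q ^ (N / 12) * q ^ (N / 12) * q ^ (3 / 4 * (N : ℝ))) := by ring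
    _ ≤ _ := mul_le_mul_of_nonneg_left e (by positivity)

theorem eventually_poly_le {c C : ℝ} (hc : 1 < c) :
    ∀ᶠ N : ℕ in Filter.atTop, C * ((N : ℝ) + 5) ^ 2 ≤ c ^ N := by
  have h := (isLittleO_pow_const_const_pow_of_one_lt (R := ℝ) 2 hc).bound
    (c := (36 * (|C| + 1))⁻¹) (by positivity)
  filter_upwards [h, Filter.eventually_ge_atTop 1] with N hN h1
  have h1' : (1 : ℝ) ≤ N := by exact_mod_cast h1
  rw [Real.norm_of_nonneg (by positivity), Real.norm_of_nonneg (by positivity),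
    inv_mul_eq_div, le_div_iff₀ (by positivity)] at hN
  refine le_trans ?_ hN
  calc C * ((N : ℝ) + 5) ^ 2 ≤ (|C| + 1) * (6 * N) ^ 2 := by
        gcongr
        · linarith [le_abs_self C]
        · linarith
    _ = _ := by ring

end Assembly

end Stepanov

/-- `Ψ` and `Ψ'` are uniformly close in the Fourier sense: for every `η ∈ (0,1/12)` and all
sufficiently large `N`, uniformly in `x ∈ 𝕋`,
`|Σ_{deg f ≤ N} (Λ'(f+1) − Λ_{N/4}(f+1))·Λ_{N/12}(f−1)·H_{N/12}(f)·e(fx)| ≤ q^(N(11/12+η))/2`. -/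
theorem proxy_fourier_close (η : ℝ) (hη0 : 0 < η) (hη : η < 1 / 12) :
    ∃ N₀ : ℕ, ∀ N : ℕ, N₀ ≤ N → ∀ x : LaurentSeries Fq, Knorm Fq x < 1 →
      ‖∑ᶠ f ∈ {f : Polynomial Fq | f.degree ≤ (N : ℕ)},
          ((vonMangoldt' Fq (f + 1) : ℂ) - LambdaX p Fq ((N : ℝ) / 4) (f + 1)) *
            LambdaX p Fq ((N : ℝ) / 12) (f - 1) * HXf p Fq ((N : ℝ) / 12) f *
              eC p Fq (toK Fq f * x)‖ ≤
        (Fintype.card Fq : ℝ) ^ ((N : ℝ) * (11 / 12 + η)) / 2 := by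
  have hq1 : (1 : ℝ) < Fintype.card Fq := by exact_mod_cast Fintype.one_lt_card
  have hq0 : (0 : ℝ) < Fintype.card Fq := by linarith
  obtain ⟨N₀, hN₀⟩ := Filter.eventually_atTop.1 (Stepanov.eventually_poly_le
    (c := (Fintype.card Fq : ℝ) ^ η) (C := 10 * (Fintype.card Fq : ℝ) ^ 4)
    (Real.one_lt_rpow hq1 hη0))
  refine ⟨max N₀ 32, fun N hN x _ => ?_⟩
  have hset : {f : Polynomial Fq | f.degree ≤ (N : ℕ)} = ↑(Stepanov.polysLT Fq (N + 1)) := by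
    ext f
    rw [Finset.mem_coe, Stepanov.mem_polysLT, Stepanov.degree_lt_succ_iff, Set.mem_ofPred_eq,
      natDegree_le_iff_degree_le]
  have h4 : ⌊(N : ℝ) / 4⌋₊ = N / 4 := by exact_mod_cast Nat.floor_div_eq_div (K := ℝ) N 4
  have h12 : ⌊(N : ℝ) / 12⌋₊ = N / 12 := by exact_mod_cast Nat.floor_div_eq_div (K := ℝ) N 12
  have h4' : (0 : ℝ) ≤ (N : ℝ) / 4 := by positivity
  have h12' : (0 : ℝ) ≤ (N : ℝ) / 12 := by positivity
  rw [hset, finsum_mem_coe_finset]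
  simp only [Stepanov.LambdaX_eq h4', Stepanov.LambdaX_eq h12', Stepanov.HXf_eq h12', h4, h12]
  refine (Stepanov.norm_sum_shift_mul_mul_le (p := p) (le_trans (le_max_right _ _) hN) x).trans ?_
  have h := hN₀ N (le_trans (le_max_left _ _) hN)
  have e : (Fintype.card Fq : ℝ) ^ ((N : ℝ) * (11 / 12 + η)) =
      (Fintype.card Fq : ℝ) ^ (11 / 12 * (N : ℝ)) * ((Fintype.card Fq : ℝ) ^ η) ^ N := by
    rw [← Real.rpow_natCast, ← Real.rpow_mul hq0.le, ← Real.rpow_add hq0]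
    ring_nf
  rw [e, mul_div_assoc, mul_comm]
  refine mul_le_mul_of_nonneg_left ?_ (by positivity)
  linarith

end
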